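/- Let Σ be a symmetric positive-definite d×d real matrix and let {W(x)}_{x∈ℝ^d} be a centred Gaussian random field with stationary increments, W(0) = 0 almost surely, and Var(W(x)) = xᵀΣ⁻¹x. Let {Z(x)}_{x∈ℝ^d} be a strictly stationary, sample-continuous, jointly measurable random field whose finite-dimensional distributions are those of the Smith random field with covariance matrix Σ, i.e. of the Brown–Resnick field associated with the variogram γ(x) = xᵀΣ⁻¹x: for all x₁,…,x_n ∈ ℝ^d and z₁,…,z_n > 0, P(Z(x_i) ≤ z_i, i = 1,…,n) = exp(−E[max_{1≤i≤n} Y(x_i)/z_i]), where Y(x) = exp(W(x) − xᵀΣ⁻¹x/2). Let δ > 0 and F : (0,∞) → ℝ be Borel measurable with E[|F(Z(0))|^{2+δ}] < ∞ and σ² := ∫_{ℝ^d} Cov(F(Z(0)), F(Z(x))) λ(dx) > 0. Then X = {F(Z(x))}_{x∈ℝ^d} satisfies the CLT: ∫_{ℝ^d} |Cov(X(0), X(x))| λ(dx) < ∞, and for every Van Hove sequence (V_n) in ℝ^d, λ(V_n)^{−1/2} ∫_{V_n} (X(x) − E[X(x)]) λ(dx) converges in distribution to N(0, σ²) as n → ∞.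 -/

import Mathlib

open MeasureTheory ProbabilityTheory Filter Topology Matrix
open scoped ENNReal NNReal

noncomputable section

/-- Covariance of two real random variables. -/
def cov {Ω : Type*} [MeasurableSpace Ω] (P : Measure Ω) (X Y : Ω → ℝ) : ℝ :=
  ∫ ω, X ω * Y ω ∂P - (∫ ω, X ω ∂P) * (∫ ω, Y ω ∂P)

/-- A Van Hove sequence in `ℝ^d`. -/
def IsVanHove {d : ℕ} (V : ℕ → Set (EuclideanSpace ℝ (Fin d))) : Prop :=
  (∀ n, Bornology.IsBounded (V n)) ∧ (∀ n, MeasurableSet (V n)) ∧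
  (∀ n, V n ⊆ V (n + 1)) ∧ (⋃ n, V n) = Set.univ ∧
  Tendsto (fun n => (volume (V n)).toReal) atTop atTop ∧
  (∀ r > 0,
    Tendsto
      (fun n => (volume {x | Metric.infDist x (frontier (V n)) ≤ r}).toReal
        / (volume (V n)).toReal) atTop (𝓝 0))

/-- Convergence in distribution of a sequence of real random variables to a limit law,
tested against bounded continuous functions. -/
def TendstoInDistribution {Ω : Type*} [MeasurableSpace Ω] (P : Measure Ω)
    (S : ℕ → Ω → ℝ) (μ : Measure ℝ) : Prop :=
  ∀ f : BoundedContinuousFunction ℝ ℝ,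
    Tendsto (fun n => ∫ ω, f (S n ω) ∂P) atTop (𝓝 (∫ x, f x ∂μ))

/-- The quadratic form `x ↦ xᵀ Σ⁻¹ x` on `ℝ^d` associated with an invertible matrix `Σ`. -/
def quadInv {d : ℕ} (Sig : Matrix (Fin d) (Fin d) ℝ) (x : EuclideanSpace ℝ (Fin d)) : ℝ :=
  (fun i => x i) ⬝ᵥ Sig⁻¹.mulVec fun i => x i

section SupConvolution

variable {ι : Type*}

lemma measurable_sup_pi : Measurable (fun p : (ι → ℝ) × (ι → ℝ) => p.1 ⊔ p.2) := by
  refine measurable_pi_lambda _ fun i => ?_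
  exact ((measurable_pi_apply i).comp measurable_fst).max
    ((measurable_pi_apply i).comp measurable_snd)


/-- Finite measures on `ι → ℝ` are determined by their distribution functions. -/
lemma ext_of_Iic_pi [Fintype ι] (μ ν : Measure (ι → ℝ)) [IsProbabilityMeasure μ]
    [IsProbabilityMeasure ν]
    (h : ∀ z, μ (Set.Iic z) = ν (Set.Iic z)) : μ = ν := by
  have hgen : (MeasurableSpace.pi : MeasurableSpace (ι → ℝ)) =
      MeasurableSpace.generateFrom (Set.pi Set.univ '' Set.pi Set.univ
        (fun _ : ι => Set.range (Set.Iic : ℝ → Set ℝ))) := by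
    refine (generateFrom_eq_pi (fun _ => ?_) (fun _ => ?_)).symm
    · rw [← borel_eq_generateFrom_Iic ℝ]
      exact (BorelSpace.measurable_eq (α := ℝ)).symm
    · refine ⟨fun n => Set.Iic (n : ℝ), fun n => ⟨_, rfl⟩, ?_⟩
      ext x
      simpa using exists_nat_ge x
  refine ext_of_generate_finite _ hgen ?_ ?_ (by simp)
  · refine IsPiSystem.pi (fun _ => ?_)
    rintro _ ⟨a, rfl⟩ _ ⟨b, rfl⟩ -
    exact ⟨a ⊓ b, Set.Iic_inter_Iic.symm⟩
  · rintro _ ⟨f, hf, rfl⟩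
    choose z hz using fun i => hf i (Set.mem_univ i)
    have : Set.pi Set.univ f = Set.Iic z := by
      rw [← Set.pi_univ_Iic]
      congr 1
      funext i
      exact (hz i).symm
    rw [this, h]

/-- The law of the componentwise maximum of two independent random vectors. -/
def supConv (μ ν : Measure (ι → ℝ)) : Measure (ι → ℝ) :=
  (μ.prod ν).map (fun p => p.1 ⊔ p.2)

lemma measurableSet_Iic_pi [Fintype ι] (z : ι → ℝ) : MeasurableSet (Set.Iic z) := measurableSet_Iic

lemma supConv_Iic [Fintype ι] (μ ν : Measure (ι → ℝ)) [SFinite ν] (z : ι → ℝ) :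
    supConv μ ν (Set.Iic z) = μ (Set.Iic z) * ν (Set.Iic z) := by
  rw [supConv, Measure.map_apply measurable_sup_pi (measurableSet_Iic_pi z), ← Measure.prod_prod]
  congr 1
  ext p
  simp [Prod.le_def]

lemma supConv_univ (μ ν : Measure (ι → ℝ)) [SFinite ν] :
    supConv μ ν Set.univ = μ Set.univ * ν Set.univ := by
  rw [supConv, Measure.map_apply measurable_sup_pi MeasurableSet.univ, ← Measure.prod_prod]
  simp

instance (μ ν : Measure (ι → ℝ)) [IsProbabilityMeasure μ] [IsProbabilityMeasure ν] :
    IsProbabilityMeasure (supConv μ ν) :=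
  ⟨by rw [supConv_univ]; simp⟩

instance (μ ν : Measure (ι → ℝ)) [IsFiniteMeasure μ] [IsFiniteMeasure ν] :
    IsFiniteMeasure (supConv μ ν) :=
  ⟨by rw [supConv_univ]; exact ENNReal.mul_lt_top (measure_lt_top _ _) (measure_lt_top _ _)⟩

/-- Powers of a measure for `supConv`, with unit the Dirac mass at `s`. -/
def supPow (s : ι → ℝ) (ν : Measure (ι → ℝ)) : ℕ → Measure (ι → ℝ)
  | 0 => Measure.dirac s
  | k + 1 => supConv (supPow s ν k) ν

/-- The compound Poisson law for `supConv`: the law of the maximum of the atoms of a Poisson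
process of finite intensity `ν` and of `s`. -/
def supExp (s : ι → ℝ) (ν : Measure (ι → ℝ)) : Measure (ι → ℝ) :=
  Measure.sum fun k : ℕ =>
    ENNReal.ofReal (Real.exp (-ν.real Set.univ) / k.factorial) • supPow s ν k

lemma supExp_apply_of_pow (s : ι → ℝ) (ν : Measure (ι → ℝ)) [IsFiniteMeasure ν]
    {A : Set (ι → ℝ)} (hA : MeasurableSet A) (h : ∀ k, supPow s ν k A = ν A ^ k) :
    supExp s ν A = ENNReal.ofReal (Real.exp (ν.real A - ν.real Set.univ)) := by
  have hsum : HasSum (fun k : ℕ => Real.exp (-ν.real Set.univ) / k.factorial * ν.real A ^ k)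
      (Real.exp (ν.real A - ν.real Set.univ)) := by
    have := (NormedSpace.expSeries_div_hasSum_exp (𝔸 := ℝ) (ν.real A)).mul_left
      (Real.exp (-ν.real Set.univ))
    rw [← Real.exp_eq_exp_ℝ, ← Real.exp_add] at this
    rw [sub_eq_neg_add]
    have e : (fun k : ℕ => Real.exp (-ν.real Set.univ) / k.factorial * ν.real A ^ k) =
        fun k : ℕ => Real.exp (-ν.real Set.univ) * (ν.real A ^ k / k.factorial) := by
      funext k; ring
    rw [e]
    exact this
  rw [supExp, Measure.sum_apply _ hA, ← hsum.tsum_eq, ENNReal.ofReal_tsum_of_nonneg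
    (fun k => by positivity) hsum.summable]
  congr 1
  funext k
  rw [Measure.smul_apply, h, ENNReal.ofReal_mul (by positivity), ENNReal.ofReal_pow (by positivity),
    ofReal_measureReal, smul_eq_mul]

lemma supPow_univ (s : ι → ℝ) (ν : Measure (ι → ℝ)) [IsFiniteMeasure ν] (k : ℕ) :
    supPow s ν k Set.univ = ν Set.univ ^ k := by
  induction k with
  | zero => simp [supPow]
  | succ k ih => rw [supPow, supConv_univ, ih, pow_succ]

lemma supPow_Iic [Fintype ι] {s z : ι → ℝ} (hz : s ≤ z) (ν : Measure (ι → ℝ))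
    [IsFiniteMeasure ν] (k : ℕ) :
    supPow s ν k (Set.Iic z) = ν (Set.Iic z) ^ k := by
  induction k with
  | zero => simp [supPow, Measure.dirac_apply' _ (measurableSet_Iic_pi z), hz]
  | succ k ih => rw [supPow, supConv_Iic, ih, pow_succ]

lemma supExp_Iic [Fintype ι] {s z : ι → ℝ} (hz : s ≤ z) (ν : Measure (ι → ℝ)) [IsFiniteMeasure ν] :
    supExp s ν (Set.Iic z) =
      ENNReal.ofReal (Real.exp (ν.real (Set.Iic z) - ν.real Set.univ)) :=
  supExp_apply_of_pow s ν (measurableSet_Iic_pi z) (supPow_Iic hz ν)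

instance (s : ι → ℝ) (ν : Measure (ι → ℝ)) [IsFiniteMeasure ν] :
    IsProbabilityMeasure (supExp s ν) :=
  ⟨by rw [supExp_apply_of_pow s ν MeasurableSet.univ (supPow_univ s ν)]; simp⟩

lemma le_supExp_singleton [Fintype ι] (s : ι → ℝ) (ν : Measure (ι → ℝ)) [IsFiniteMeasure ν] :
    1 - ν.real Set.univ ≤ (supExp s ν).real {s} := by
  have h1 : ENNReal.ofReal (Real.exp (-ν.real Set.univ)) ≤ supExp s ν {s} := by
    rw [supExp, Measure.sum_apply _ (measurableSet_singleton s)]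
    refine le_trans ?_ (ENNReal.le_tsum 0)
    simp [supPow]
  have h2 := ENNReal.toReal_mono (measure_ne_top _ _) h1
  rw [ENNReal.toReal_ofReal (Real.exp_pos _).le] at h2
  have := Real.add_one_le_exp (-ν.real Set.univ)
  change _ ≤ ((supExp s ν) {s}).toReal
  linarith

/-- Taking the maximum with an independent variable that equals the lower bound `s` with high
probability perturbs a law little in total variation. -/
lemma abs_integral_supConv_sub_le [Fintype ι] (s : ι → ℝ) (G κ : Measure (ι → ℝ))
    [IsProbabilityMeasure G]
    [IsProbabilityMeasure κ] (hG : ∀ᵐ x ∂G, s ≤ x) {φ : (ι → ℝ) → ℝ} (hφ : Measurable φ)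
    {M : ℝ} (hM : ∀ x, |φ x| ≤ M) :
    |∫ x, φ x ∂(supConv G κ) - ∫ x, φ x ∂G| ≤ 2 * M * (1 - κ.real {s}) := by
  have hint : ∀ {T : Type _} [MeasurableSpace T] (ρ : Measure T) [IsProbabilityMeasure ρ]
      (g : T → ι → ℝ), Measurable g → Integrable (fun t => φ (g t)) ρ := by
    intro T _ ρ _ g hg
    exact Integrable.of_bound (hφ.comp hg).aestronglyMeasurable M (ae_of_all _ fun t => hM _)
  have h1 : ∫ x, φ x ∂(supConv G κ) = ∫ p, φ (p.1 ⊔ p.2) ∂(G.prod κ) :=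
    integral_map measurable_sup_pi.aemeasurable hφ.aestronglyMeasurable
  have h2 : ∫ x, φ x ∂G = ∫ p, φ p.1 ∂(G.prod κ) := by
    rw [integral_fun_fst (μ := G) (ν := κ) φ]; simp
  have hms : MeasurableSet {p : (ι → ℝ) × (ι → ℝ) | p.2 ∈ ({s} : Set (ι → ℝ))ᶜ} :=
    measurable_snd (measurableSet_singleton s).compl
  rw [h1, h2, ← integral_sub (hint _ _ measurable_sup_pi) (hint _ _ measurable_fst)]
  have h3 : ∫ p, ({p : (ι → ℝ) × (ι → ℝ) | p.2 ∈ ({s} : Set (ι → ℝ))ᶜ}).indicator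
      (fun _ => 2 * M) p ∂(G.prod κ) = 2 * M * (1 - κ.real {s}) := by
    rw [integral_indicator_const _ hms, smul_eq_mul, mul_comm]
    congr 1
    have : {p : (ι → ℝ) × (ι → ℝ) | p.2 ∈ ({s} : Set (ι → ℝ))ᶜ} =
        Set.univ ×ˢ ({s} : Set (ι → ℝ))ᶜ := by ext p; simp
    rw [this, Measure.real, Measure.prod_prod, measure_univ, one_mul, ← Measure.real,
      probReal_compl_eq_one_sub (measurableSet_singleton s)]
  rw [← h3, ← Real.norm_eq_abs]
  refine norm_integral_le_of_norm_le ((integrable_const _).indicator hms) ?_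
  have hG' : ∀ᵐ p ∂(G.prod κ), s ≤ p.1 := Measure.quasiMeasurePreserving_fst.ae hG
  filter_upwards [hG'] with p hp
  by_cases hps : p.2 = s
  · simp [hps, sup_eq_left.2 hp]
  · rw [Set.indicator_of_mem (by simpa using hps), Real.norm_eq_abs]
    exact (abs_sub _ _).trans (by linarith [hM (p.1 ⊔ p.2), hM p.1])

end SupConvolution

section Blocks

variable {ι κ : Type*}

lemma measurable_sumElim :
    Measurable (fun p : (ι → ℝ) × (κ → ℝ) => (Sum.elim p.1 p.2 : ι ⊕ κ → ℝ)) := by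
  refine measurable_pi_lambda _ fun i => ?_
  rcases i with i | i
  · exact (measurable_pi_apply i).comp measurable_fst
  · exact (measurable_pi_apply i).comp measurable_snd

lemma measurable_comp_inl : Measurable (fun x : ι ⊕ κ → ℝ => fun i => x (Sum.inl i)) :=
  measurable_pi_lambda _ fun _ => measurable_pi_apply _

lemma measurable_comp_inr : Measurable (fun x : ι ⊕ κ → ℝ => fun i => x (Sum.inr i)) :=
  measurable_pi_lambda _ fun _ => measurable_pi_apply _

variable [Fintype ι] [Fintype κ]

/-- The coupling of the two blocks of a random vector as independent blocks. -/
def decouple (G : Measure (ι ⊕ κ → ℝ)) : Measure (ι ⊕ κ → ℝ) :=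
  ((G.map (fun x i => x (Sum.inl i))).prod (G.map (fun x i => x (Sum.inr i)))).map
    (fun p => Sum.elim p.1 p.2)

instance (G : Measure (ι ⊕ κ → ℝ)) [IsProbabilityMeasure G] :
    IsProbabilityMeasure (decouple G) := by
  have := Measure.isProbabilityMeasure_map (μ := G)
    (measurable_comp_inl (ι := ι) (κ := κ)).aemeasurable
  have := Measure.isProbabilityMeasure_map (μ := G)
    (measurable_comp_inr (ι := ι) (κ := κ)).aemeasurable
  exact Measure.isProbabilityMeasure_map measurable_sumElim.aemeasurable

lemma decouple_Iic (G : Measure (ι ⊕ κ → ℝ)) [IsProbabilityMeasure G] (z : ι ⊕ κ → ℝ) :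
    decouple G (Set.Iic z) = G {x | ∀ i, x (Sum.inl i) ≤ z (Sum.inl i)} *
      G {x | ∀ i, x (Sum.inr i) ≤ z (Sum.inr i)} := by
  have := Measure.isProbabilityMeasure_map (μ := G)
    (measurable_comp_inr (ι := ι) (κ := κ)).aemeasurable
  rw [decouple, Measure.map_apply measurable_sumElim (measurableSet_Iic_pi z)]
  have : (fun p : (ι → ℝ) × (κ → ℝ) => (Sum.elim p.1 p.2 : ι ⊕ κ → ℝ)) ⁻¹' Set.Iic z =
      Set.Iic (fun i => z (Sum.inl i)) ×ˢ Set.Iic (fun i => z (Sum.inr i)) := by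
    ext p
    simp [Pi.le_def, Prod.le_def]
  rw [this, Measure.prod_prod, Measure.map_apply measurable_comp_inl (measurableSet_Iic_pi _),
    Measure.map_apply measurable_comp_inr (measurableSet_Iic_pi _)]
  rfl

/-- A total variation bound between a random vector and its decoupled version, when the ratio of
their distribution functions is driven by a finite measure `ν` of points exceeding the level in
both blocks. -/
lemma abs_integral_sub_decouple_le (s : ℝ) (G ν : Measure (ι ⊕ κ → ℝ)) [IsProbabilityMeasure G]
    [IsFiniteMeasure ν] (hG : ∀ᵐ x ∂G, (fun _ => s) ≤ x)
    (h : ∀ z : ι ⊕ κ → ℝ, (fun _ => s) ≤ z → G (Set.Iic z) =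
      decouple G (Set.Iic z) * ENNReal.ofReal (Real.exp (ν.real
        {x | (¬ ∀ i, x (Sum.inl i) ≤ z (Sum.inl i)) ∧ ¬ ∀ i, x (Sum.inr i) ≤ z (Sum.inr i)})))
    {φ : (ι ⊕ κ → ℝ) → ℝ} (hφ : Measurable φ) {M : ℝ} (hM : ∀ x, |φ x| ≤ M) :
    |∫ x, φ x ∂G - ∫ x, φ x ∂(decouple G)| ≤ 6 * M * ν.real Set.univ := by
  set S : ι ⊕ κ → ℝ := fun _ => s with hS
  let rA : (ι ⊕ κ → ℝ) → (ι ⊕ κ → ℝ) := fun x => Sum.elim (fun i => x (Sum.inl i)) (fun _ => s)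
  let rB : (ι ⊕ κ → ℝ) → (ι ⊕ κ → ℝ) := fun x => Sum.elim (fun _ => s) (fun i => x (Sum.inr i))
  have hrA : Measurable rA := measurable_sumElim.comp (measurable_comp_inl.prodMk measurable_const)
  have hrB : Measurable rB := measurable_sumElim.comp (measurable_const.prodMk measurable_comp_inr)
  have hmA : ∀ z : ι ⊕ κ → ℝ, MeasurableSet {x : ι ⊕ κ → ℝ | ∀ i, x (Sum.inl i) ≤ z (Sum.inl i)} :=
    fun z => measurable_comp_inl (measurableSet_Iic_pi fun i => z (Sum.inl i))
  have hmB : ∀ z : ι ⊕ κ → ℝ, MeasurableSet {x : ι ⊕ κ → ℝ | ∀ i, x (Sum.inr i) ≤ z (Sum.inr i)} :=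
    fun z => measurable_comp_inr (measurableSet_Iic_pi fun i => z (Sum.inr i))
  have huA : (ν.map rA).real Set.univ = ν.real Set.univ := by
    rw [map_measureReal_apply hrA MeasurableSet.univ, Set.preimage_univ]
  have huB : (ν.map rB).real Set.univ = ν.real Set.univ := by
    rw [map_measureReal_apply hrB MeasurableSet.univ, Set.preimage_univ]
  have hdS : ∀ᵐ x ∂(decouple G), S ≤ x := by
    have h1 : decouple G {x | S ≤ x}ᶜ = 0 := by
      have hm : MeasurableSet {x : ι ⊕ κ → ℝ | S ≤ x} := measurableSet_Ici
      rw [prob_compl_eq_zero_iff hm, decouple, Measure.map_apply measurable_sumElim hm]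
      have : (fun p : (ι → ℝ) × (κ → ℝ) => (Sum.elim p.1 p.2 : ι ⊕ κ → ℝ)) ⁻¹' {x | S ≤ x} =
          Set.Ici (fun _ => s) ×ˢ Set.Ici (fun _ => s) := by
        ext p
        simp [Pi.le_def, Prod.le_def, hS]
      rw [this]
      have := Measure.isProbabilityMeasure_map (μ := G)
        (measurable_comp_inr (ι := ι) (κ := κ)).aemeasurable
      rw [Measure.prod_prod, Measure.map_apply measurable_comp_inl measurableSet_Ici,
        Measure.map_apply measurable_comp_inr measurableSet_Ici]
      have e1 : G ((fun x i => x (Sum.inl i)) ⁻¹' Set.Ici (fun _ : ι => s)) = 1 := by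
        refine (prob_compl_eq_zero_iff (measurable_comp_inl measurableSet_Ici)).1
          (measure_mono_null ?_ (ae_iff.1 hG))
        exact fun x hx hx' => hx fun i => hx' _
      have e2 : G ((fun x i => x (Sum.inr i)) ⁻¹' Set.Ici (fun _ : κ => s)) = 1 := by
        refine (prob_compl_eq_zero_iff (measurable_comp_inr measurableSet_Ici)).1
          (measure_mono_null ?_ (ae_iff.1 hG))
        exact fun x hx hx' => hx fun i => hx' _
      rw [e1, e2, one_mul]
    exact h1
  have key : supConv (supConv G (supExp S (ν.map rA))) (supExp S (ν.map rB)) =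
      supConv (decouple G) (supExp S ν) := by
    refine ext_of_Iic_pi _ _ fun z => ?_
    rw [supConv_Iic, supConv_Iic, supConv_Iic]
    by_cases hz : S ≤ z
    · rw [supExp_Iic hz, supExp_Iic hz, supExp_Iic hz, h z hz, huA, huB]
      have a1 : (ν.map rA).real (Set.Iic z) = ν.real {x | ∀ i, x (Sum.inl i) ≤ z (Sum.inl i)} := by
        rw [map_measureReal_apply hrA (measurableSet_Iic_pi z)]
        congr 1
        ext x
        have : ∀ i, s ≤ z i := hz
        simp [rA, Pi.le_def, this]
      have a2 : (ν.map rB).real (Set.Iic z) = ν.real {x | ∀ i, x (Sum.inr i) ≤ z (Sum.inr i)} := by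
        rw [map_measureReal_apply hrB (measurableSet_Iic_pi z)]
        congr 1
        ext x
        have : ∀ i, s ≤ z i := hz
        simp [rB, Pi.le_def, this]
      rw [a1, a2, mul_assoc, mul_assoc, ← ENNReal.ofReal_mul (Real.exp_pos _).le,
        ← ENNReal.ofReal_mul (Real.exp_pos _).le, ← Real.exp_add, ← Real.exp_add]
      congr 3
      set A := {x : ι ⊕ κ → ℝ | ∀ i, x (Sum.inl i) ≤ z (Sum.inl i)} with hA
      set B := {x : ι ⊕ κ → ℝ | ∀ i, x (Sum.inr i) ≤ z (Sum.inr i)} with hB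
      have b1 : {x : ι ⊕ κ → ℝ | (¬ ∀ i, x (Sum.inl i) ≤ z (Sum.inl i)) ∧
          ¬ ∀ i, x (Sum.inr i) ≤ z (Sum.inr i)} = (A ∪ B)ᶜ := by
        ext x; simp [hA, hB]
      have b2 : Set.Iic z = A ∩ B := by
        ext x; simp [hA, hB, Pi.le_def]
      rw [b1, b2, measureReal_compl ((hmA z).union (hmB z))]
      have := measureReal_union_add_inter (μ := ν) (s := A) (hmB z)
      linarith
    · have z1 : G (Set.Iic z) = 0 := by
        refine measure_mono_null (fun x hx => ?_) hG
        exact fun hx' => hz (hx'.trans hx)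
      have z2 : decouple G (Set.Iic z) = 0 := by
        refine measure_mono_null (fun x hx => ?_) hdS
        exact fun hx' => hz (hx'.trans hx)
      simp [z1, z2]
  have hG1 : ∀ᵐ x ∂(supConv G (supExp S (ν.map rA))), S ≤ x := by
    rw [supConv, ae_map_iff measurable_sup_pi.aemeasurable measurableSet_Ici]
    have hG' : ∀ᵐ p ∂(G.prod (supExp S (ν.map rA))), S ≤ p.1 :=
      Measure.quasiMeasurePreserving_fst.ae hG
    filter_upwards [hG'] with p hp using hp.trans le_sup_left
  have i1 := abs_integral_supConv_sub_le S G (supExp S (ν.map rA)) hG hφ hM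
  have i2 := abs_integral_supConv_sub_le S _ (supExp S (ν.map rB)) hG1 hφ hM
  have i3 := abs_integral_supConv_sub_le S _ (supExp S ν) hdS hφ hM
  have j1 := le_supExp_singleton S (ν.map rA)
  have j2 := le_supExp_singleton S (ν.map rB)
  have j3 := le_supExp_singleton S ν
  rw [huA] at j1
  rw [huB] at j2
  rw [key] at i2
  have hM0 : 0 ≤ M := (abs_nonneg _).trans (hM 0)
  have k1 := mul_le_mul_of_nonneg_left j1 hM0
  have k2 := mul_le_mul_of_nonneg_left j2 hM0
  have k3 := mul_le_mul_of_nonneg_left j3 hM0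
  rw [abs_le] at *
  constructor <;> nlinarith

end Blocks

section MaxStable

/-- For a finite family of nonnegative numbers, `t > 0` lies below the maximum iff it lies below
one of the members; this includes the empty family. -/
lemma lt_iSup_iff_of_pos {ι : Type*} [Finite ι] {f : ι → ℝ} {t : ℝ} (ht : 0 < t) :
    t < ⨆ i, f i ↔ ∃ i, t < f i := by
  rcases isEmpty_or_nonempty ι with h | h
  · simp [Real.iSup_of_isEmpty, ht.le]
  · exact lt_ciSup_iff (Set.finite_range f).bddAbove

lemma iSup_sum_type_of_nonneg {ι κ : Type*} [Finite ι] [Finite κ] {f : ι ⊕ κ → ℝ}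
    (hf : ∀ i, 0 ≤ f i) :
    ⨆ i, f i = max (⨆ i, f (Sum.inl i)) (⨆ i, f (Sum.inr i)) := by
  refine le_antisymm (Real.iSup_le (fun i => ?_) ?_) (max_le ?_ ?_)
  · rcases i with i | i
    · exact (le_ciSup (Set.finite_range fun i => f (Sum.inl i)).bddAbove i).trans (le_max_left _ _)
    · exact (le_ciSup (Set.finite_range fun i => f (Sum.inr i)).bddAbove i).trans (le_max_right _ _)
  · exact (Real.iSup_nonneg fun i => hf _).trans (le_max_left _ _)
  · exact Real.iSup_le (fun i => le_ciSup (Set.finite_range f).bddAbove _) (Real.iSup_nonneg hf)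
  · exact Real.iSup_le (fun i => le_ciSup (Set.finite_range f).bddAbove _) (Real.iSup_nonneg hf)

lemma iSup_le_sum_of_nonneg {ι : Type*} [Fintype ι] {f : ι → ℝ} (hf : ∀ i, 0 ≤ f i) :
    ⨆ i, f i ≤ ∑ i, f i :=
  Real.iSup_le (fun i => Finset.single_le_sum (fun i _ => hf i) (Finset.mem_univ i))
    (Finset.sum_nonneg fun i _ => hf i)

lemma min_iSup_le_sum_of_nonneg {ι κ : Type*} [Fintype ι] [Fintype κ] {f : ι → ℝ} {g : κ → ℝ}
    (hf : ∀ i, 0 ≤ f i) (hg : ∀ i, 0 ≤ g i) :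
    min (⨆ i, f i) (⨆ j, g j) ≤ ∑ i, ∑ j, min (f i) (g j) := by
  have h0 : 0 ≤ ∑ i, ∑ j, min (f i) (g j) :=
    Finset.sum_nonneg fun i _ => Finset.sum_nonneg fun j _ => le_min (hf i) (hg j)
  rcases isEmpty_or_nonempty ι with h | h
  · simp [Real.iSup_of_isEmpty, Real.iSup_nonneg hg]
  rcases isEmpty_or_nonempty κ with h | h
  · simp [Real.iSup_of_isEmpty, Real.iSup_nonneg hf]
  obtain ⟨i, hi⟩ := exists_eq_ciSup_of_finite (f := f)
  obtain ⟨j, hj⟩ := exists_eq_ciSup_of_finite (f := g)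
  rw [← hi, ← hj]
  calc min (f i) (g j) ≤ ∑ j, min (f i) (g j) :=
        Finset.single_le_sum (f := fun j => min (f i) (g j))
          (fun j _ => le_min (hf i) (hg j)) (Finset.mem_univ j)
    _ ≤ _ := Finset.single_le_sum (f := fun i => ∑ j, min (f i) (g j))
          (fun i _ => Finset.sum_nonneg fun j _ => le_min (hf i) (hg j)) (Finset.mem_univ i)

/-- The region below the graph of an integrable function. -/
lemma prod_volume_region {Ω : Type*} [MeasurableSpace Ω] (P : Measure Ω) [SFinite P]
    {m : Ω → ℝ} (hm : Measurable m) (hm0 : ∀ ω, 0 ≤ m ω) (hi : Integrable m P) :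
    (P.prod volume) {p : Ω × ℝ | 0 < p.2 ∧ p.2 < m p.1} = ENNReal.ofReal (∫ ω, m ω ∂P) := by
  have hms : MeasurableSet {p : Ω × ℝ | 0 < p.2 ∧ p.2 < m p.1} :=
    (measurableSet_lt measurable_const measurable_snd).inter
      (measurableSet_lt measurable_snd (hm.comp measurable_fst))
  rw [Measure.prod_apply hms, ofReal_integral_eq_lintegral_ofReal hi (ae_of_all _ hm0)]
  refine lintegral_congr fun ω => ?_
  have : Prod.mk ω ⁻¹' {p : Ω × ℝ | 0 < p.2 ∧ p.2 < m p.1} = Set.Ioo 0 (m ω) := by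
    ext t; simp
  rw [this, Real.volume_Ioo, sub_zero]

/-- `Z` has the finite-dimensional distributions of the simple max-stable field with spectral
field `Y`. -/
structure IsMaxStableWith {E Ω : Type*} [MeasurableSpace Ω] (P : Measure Ω)
    (Y Z : E → Ω → ℝ) : Prop where
  measurable_spectral : ∀ x, Measurable (Y x)
  pos_spectral : ∀ x ω, 0 < Y x ω
  integrable_spectral : ∀ x, Integrable (Y x) P
  integral_spectral : ∀ x, ∫ ω, Y x ω ∂P = 1
  measurable_field : ∀ x, Measurable (Z x)
  fdd : ∀ (n : ℕ) (x : Fin n → E) (z : Fin n → ℝ), (∀ i, 0 < z i) →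
    P {ω | ∀ i, Z (x i) ω ≤ z i}
      = ENNReal.ofReal (Real.exp (-(∫ ω, ⨆ i, Y (x i) ω / z i ∂P)))

namespace IsMaxStableWith

variable {E Ω : Type*} [MeasurableSpace Ω] {P : Measure Ω} {Y Z : E → Ω → ℝ}
  {ι κ : Type*} [Fintype ι] [Fintype κ]

lemma fdd_fintype (h : IsMaxStableWith P Y Z) (x : ι → E) (z : ι → ℝ) (hz : ∀ i, 0 < z i) :
    P {ω | ∀ i, Z (x i) ω ≤ z i}
      = ENNReal.ofReal (Real.exp (-(∫ ω, ⨆ i, Y (x i) ω / z i ∂P))) := by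
  let e := (Fintype.equivFin ι).symm
  have := h.fdd _ (x ∘ e) (z ∘ e) (fun i => hz _)
  convert this using 6 with ω ω
  · exact (e.forall_congr_right (q := fun i => Z (x i) ω ≤ z i)).symm
  · exact (e.iSup_comp (g := fun i => Y (x i) ω / z i)).symm

lemma measurable_max (h : IsMaxStableWith P Y Z)
    (x : ι → E) (z : ι → ℝ) : Measurable fun ω => ⨆ i, Y (x i) ω / z i :=
  Measurable.iSup fun _ => (h.measurable_spectral _).div_const _

lemma max_nonneg {ι : Type*} (h : IsMaxStableWith P Y Z) (x : ι → E) {z : ι → ℝ}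
    (hz : ∀ i, 0 < z i) (ω : Ω) :
    0 ≤ ⨆ i, Y (x i) ω / z i :=
  Real.iSup_nonneg fun i => (div_pos (h.pos_spectral _ ω) (hz i)).le

lemma integrable_max (h : IsMaxStableWith P Y Z) (x : ι → E) {z : ι → ℝ} (hz : ∀ i, 0 < z i) :
    Integrable (fun ω => ⨆ i, Y (x i) ω / z i) P := by
  refine Integrable.mono' (g := fun ω => ∑ i, Y (x i) ω / z i)
    (integrable_finsetSum _ fun i _ => (h.integrable_spectral _).div_const _)
    (h.measurable_max x z).aestronglyMeasurable (ae_of_all _ fun ω => ?_)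
  rw [Real.norm_eq_abs, abs_of_nonneg (h.max_nonneg x hz ω)]
  exact iSup_le_sum_of_nonneg fun i => (div_pos (h.pos_spectral _ ω) (hz i)).le

lemma measure_lt_le (h : IsMaxStableWith P Y Z) [IsProbabilityMeasure P] (x : E)
    {s : ℝ} (hs : 0 < s) :
    P.real {ω | Z x ω < s} ≤ Real.exp (-(1 / s)) := by
  have h1 := h.fdd_fintype (fun _ : Unit => x) (fun _ => s) (fun _ => hs)
  have h2 : P.real {ω | Z x ω ≤ s} = Real.exp (-(1 / s)) := by
    have e : {ω | ∀ _ : Unit, Z x ω ≤ s} = {ω | Z x ω ≤ s} := by ext; simp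
    rw [e] at h1
    rw [Measure.real, h1, ENNReal.toReal_ofReal (Real.exp_pos _).le]
    congr 2
    simp only [ciSup_unique]
    rw [integral_div, h.integral_spectral]
  rw [← h2]
  exact measureReal_mono fun ω (hω : Z x ω < s) => hω.le

/-- Decoupling for the field truncated from below at level `s`. -/
lemma abs_integral_truncated_sub_le (h : IsMaxStableWith P Y Z)
    [IsProbabilityMeasure P] (x : ι → E) (y : κ → E) {s : ℝ}
    (hs : 0 < s) {f : (ι → ℝ) → ℝ} {g : (κ → ℝ) → ℝ} (hf : Measurable f) (hg : Measurable g)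
    {M N : ℝ} (hM : ∀ u, |f u| ≤ M) (hN : ∀ u, |g u| ≤ N) :
    |∫ ω, f (fun i => max (Z (x i) ω) s) * g (fun j => max (Z (y j) ω) s) ∂P -
      (∫ ω, f (fun i => max (Z (x i) ω) s) ∂P) * ∫ ω, g (fun j => max (Z (y j) ω) s) ∂P|
      ≤ M * N * (6 * (1 / s * ∑ i, ∑ j, ∫ ω, min (Y (x i) ω) (Y (y j) ω) ∂P)) := by
  let pt : ι ⊕ κ → E := Sum.elim x y
  let Q : Ω → ι ⊕ κ → ℝ := fun ω i => max (Z (pt i) ω) s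
  have hQ : Measurable Q :=
    measurable_pi_lambda _ fun i => (h.measurable_field _).max measurable_const
  let G := P.map Q
  have : IsProbabilityMeasure G := Measure.isProbabilityMeasure_map hQ.aemeasurable
  let MA : Ω → ℝ := fun ω => ⨆ i, Y (x i) ω / s
  let MB : Ω → ℝ := fun ω => ⨆ i, Y (y i) ω / s
  have hMA : Measurable MA := h.measurable_max x _
  have hMB : Measurable MB := h.measurable_max y _
  let D : Set (Ω × ℝ) := {p | 0 < p.2 ∧ p.2 < min (MA p.1) (MB p.1)}
  have hD : MeasurableSet D :=
    (measurableSet_lt measurable_const measurable_snd).inter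
      (measurableSet_lt measurable_snd ((hMA.min hMB).comp measurable_fst))
  let T : Ω × ℝ → ι ⊕ κ → ℝ := fun p i => Y (pt i) p.1 / p.2
  have hT : Measurable T := measurable_pi_lambda _ fun i =>
    ((h.measurable_spectral _).comp measurable_fst).div measurable_snd
  let ν := ((P.prod volume).restrict D).map T
  have hDmass : (P.prod volume) D = ENNReal.ofReal (∫ ω, min (MA ω) (MB ω) ∂P) :=
    prod_volume_region P (hMA.min hMB)
      (fun ω => le_min (h.max_nonneg x (fun _ => hs) ω) (h.max_nonneg y (fun _ => hs) ω))
      ((h.integrable_max x (fun _ => hs)).inf (h.integrable_max y (fun _ => hs)))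
  have hνu : ν Set.univ = ENNReal.ofReal (∫ ω, min (MA ω) (MB ω) ∂P) := by
    rw [← hDmass, Measure.map_apply hT MeasurableSet.univ, Set.preimage_univ,
      Measure.restrict_apply_univ]
  have : IsFiniteMeasure ν := ⟨by rw [hνu]; exact ENNReal.ofReal_lt_top⟩
  have hGz : ∀ z : ι ⊕ κ → ℝ, (fun _ => s) ≤ z →
      G (Set.Iic z) = ENNReal.ofReal (Real.exp (-∫ ω, ⨆ i, Y (pt i) ω / z i ∂P)) := by
    intro z hz
    have hz' : ∀ i, s ≤ z i := hz
    rw [Measure.map_apply hQ (measurableSet_Iic_pi z),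
      ← h.fdd_fintype pt z (fun i => hs.trans_le (hz' i))]
    congr 1
    ext ω
    simp [Q, Pi.le_def, hz']
  have hGA : ∀ z : ι ⊕ κ → ℝ, (fun _ => s) ≤ z →
      G {u | ∀ i, u (Sum.inl i) ≤ z (Sum.inl i)} =
        ENNReal.ofReal (Real.exp (-∫ ω, ⨆ i, Y (x i) ω / z (Sum.inl i) ∂P)) := by
    intro z hz
    have hz' : ∀ i, s ≤ z i := hz
    change G ((fun (u : ι ⊕ κ → ℝ) i => u (Sum.inl i)) ⁻¹' Set.Iic fun i => z (Sum.inl i)) = _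
    rw [Measure.map_apply hQ (measurable_comp_inl (measurableSet_Iic_pi fun i => z (Sum.inl i))),
      ← h.fdd_fintype x (fun i => z (Sum.inl i)) (fun i => hs.trans_le (hz' _))]
    congr 1
    ext ω
    simp [Q, Pi.le_def, hz', pt]
  have hGB : ∀ z : ι ⊕ κ → ℝ, (fun _ => s) ≤ z →
      G {u | ∀ i, u (Sum.inr i) ≤ z (Sum.inr i)} =
        ENNReal.ofReal (Real.exp (-∫ ω, ⨆ i, Y (y i) ω / z (Sum.inr i) ∂P)) := by
    intro z hz
    have hz' : ∀ i, s ≤ z i := hz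
    change G ((fun (u : ι ⊕ κ → ℝ) i => u (Sum.inr i)) ⁻¹' Set.Iic fun i => z (Sum.inr i)) = _
    rw [Measure.map_apply hQ (measurable_comp_inr (measurableSet_Iic_pi fun i => z (Sum.inr i))),
      ← h.fdd_fintype y (fun i => z (Sum.inr i)) (fun i => hs.trans_le (hz' _))]
    congr 1
    ext ω
    simp [Q, Pi.le_def, hz', pt]
  have hν : ∀ z : ι ⊕ κ → ℝ, (fun _ => s) ≤ z → ν.real
      {u | (¬ ∀ i, u (Sum.inl i) ≤ z (Sum.inl i)) ∧ ¬ ∀ i, u (Sum.inr i) ≤ z (Sum.inr i)} =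
      ∫ ω, min (⨆ i, Y (x i) ω / z (Sum.inl i)) (⨆ i, Y (y i) ω / z (Sum.inr i)) ∂P := by
    intro z hz
    have hz' : ∀ i, s ≤ z i := hz
    have hz0 : ∀ i, 0 < z i := fun i => hs.trans_le (hz' i)
    have hmeas : MeasurableSet {u : ι ⊕ κ → ℝ | (¬ ∀ i, u (Sum.inl i) ≤ z (Sum.inl i)) ∧
        ¬ ∀ i, u (Sum.inr i) ≤ z (Sum.inr i)} :=
      (measurable_comp_inl (measurableSet_Iic_pi fun i => z (Sum.inl i))).compl.inter
        (measurable_comp_inr (measurableSet_Iic_pi fun i => z (Sum.inr i))).compl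
    have hset : T ⁻¹' {u : ι ⊕ κ → ℝ | (¬ ∀ i, u (Sum.inl i) ≤ z (Sum.inl i)) ∧
        ¬ ∀ i, u (Sum.inr i) ≤ z (Sum.inr i)} ∩ D = {p : Ω × ℝ | 0 < p.2 ∧ p.2 <
          min (⨆ i, Y (x i) p.1 / z (Sum.inl i)) (⨆ i, Y (y i) p.1 / z (Sum.inr i))} := by
      ext ⟨ω, t⟩
      have hc : ∀ i, 0 < t → (z i < Y (pt i) ω / t ↔ t < Y (pt i) ω / z i) := by
        intro i ht
        rw [lt_div_iff₀ ht, lt_div_iff₀ (hz0 i), mul_comm]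
      have hc' : ∀ i, t < Y (pt i) ω / z i → t < Y (pt i) ω / s := fun i hi =>
        hi.trans_le (div_le_div_of_nonneg_left (h.pos_spectral _ _).le hs (hz' i))
      simp only [Set.mem_inter_iff, Set.mem_preimage, Set.mem_ofPred_eq, D, T, not_forall, not_le,
        lt_min_iff, MA, MB]
      constructor
      · rintro ⟨⟨⟨i, hi⟩, ⟨j, hj⟩⟩, ht, -⟩
        exact ⟨ht, (lt_iSup_iff_of_pos ht).2 ⟨i, (hc _ ht).1 hi⟩,
          (lt_iSup_iff_of_pos ht).2 ⟨j, (hc _ ht).1 hj⟩⟩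
      · rintro ⟨ht, hi, hj⟩
        obtain ⟨i, hi⟩ := (lt_iSup_iff_of_pos ht).1 hi
        obtain ⟨j, hj⟩ := (lt_iSup_iff_of_pos ht).1 hj
        exact ⟨⟨⟨i, (hc (Sum.inl i) ht).2 hi⟩, ⟨j, (hc (Sum.inr j) ht).2 hj⟩⟩, ht,
          (lt_iSup_iff_of_pos ht).2 ⟨i, hc' (Sum.inl i) hi⟩,
          (lt_iSup_iff_of_pos ht).2 ⟨j, hc' (Sum.inr j) hj⟩⟩
    have hn : ∀ ω, 0 ≤ min (⨆ i, Y (x i) ω / z (Sum.inl i)) (⨆ i, Y (y i) ω / z (Sum.inr i)) :=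
      fun ω => le_min (h.max_nonneg x (fun _ => hz0 _) ω) (h.max_nonneg y (fun _ => hz0 _) ω)
    rw [Measure.real, Measure.map_apply hT hmeas, Measure.restrict_apply (hT hmeas), hset,
      prod_volume_region P ((h.measurable_max x _).min (h.measurable_max y _)) hn
      ((h.integrable_max x (fun _ => hz0 _)).inf (h.integrable_max y (fun _ => hz0 _))),
      ENNReal.toReal_ofReal (integral_nonneg hn)]
  have hGs : ∀ᵐ u ∂G, (fun _ => s) ≤ u := by
    rw [ae_map_iff hQ.aemeasurable measurableSet_Ici]
    exact ae_of_all _ fun ω i => le_max_right _ _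
  have hφ : Measurable fun u : ι ⊕ κ → ℝ =>
      f (fun i => u (Sum.inl i)) * g (fun i => u (Sum.inr i)) :=
    (hf.comp measurable_comp_inl).mul (hg.comp measurable_comp_inr)
  have hM0 : 0 ≤ M := (abs_nonneg _).trans (hM 0)
  have hN0 : 0 ≤ N := (abs_nonneg _).trans (hN 0)
  have main := abs_integral_sub_decouple_le s G ν hGs ?_ hφ (M := M * N) ?_
  · have e1 : ∫ u, f (fun i => u (Sum.inl i)) * g (fun i => u (Sum.inr i)) ∂G =
        ∫ ω, f (fun i => max (Z (x i) ω) s) * g (fun j => max (Z (y j) ω) s) ∂P :=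
      integral_map hQ.aemeasurable hφ.aestronglyMeasurable
    have e2 : ∫ u, f (fun i => u (Sum.inl i)) * g (fun i => u (Sum.inr i)) ∂(decouple G) =
        (∫ ω, f (fun i => max (Z (x i) ω) s) ∂P) * ∫ ω, g (fun j => max (Z (y j) ω) s) ∂P := by
      have := Measure.isProbabilityMeasure_map (μ := G)
        (measurable_comp_inl (ι := ι) (κ := κ)).aemeasurable
      have := Measure.isProbabilityMeasure_map (μ := G)
        (measurable_comp_inr (ι := ι) (κ := κ)).aemeasurable
      rw [decouple, integral_map measurable_sumElim.aemeasurable hφ.aestronglyMeasurable]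
      simp only [Sum.elim_inl, Sum.elim_inr]
      rw [integral_prod_mul (fun a : ι → ℝ => f a) (fun b : κ → ℝ => g b),
        integral_map measurable_comp_inl.aemeasurable hf.aestronglyMeasurable,
        integral_map measurable_comp_inr.aemeasurable hg.aestronglyMeasurable]
      congr 1
      · exact integral_map hQ.aemeasurable (hf.comp measurable_comp_inl).aestronglyMeasurable
      · exact integral_map hQ.aemeasurable (hg.comp measurable_comp_inr).aestronglyMeasurable
    rw [e1, e2] at main
    refine main.trans ?_
    have e3 : ν.real Set.univ ≤ 1 / s * ∑ i, ∑ j, ∫ ω, min (Y (x i) ω) (Y (y j) ω) ∂P := by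
      have himin : ∀ i j, Integrable (fun ω => min (Y (x i) ω / s) (Y (y j) ω / s)) P :=
        fun i j =>
          ((h.integrable_spectral _).div_const _).inf ((h.integrable_spectral _).div_const _)
      have hsum : 1 / s * ∑ i, ∑ j, ∫ ω, min (Y (x i) ω) (Y (y j) ω) ∂P =
          ∫ ω, ∑ i, ∑ j, min (Y (x i) ω / s) (Y (y j) ω / s) ∂P := by
        rw [integral_finsetSum _ fun i _ => integrable_finsetSum _ fun j _ => himin i j,
          Finset.mul_sum]
        refine Finset.sum_congr rfl fun i _ => ?_
        rw [integral_finsetSum _ fun j _ => himin i j, Finset.mul_sum]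
        refine Finset.sum_congr rfl fun j _ => ?_
        rw [← integral_const_mul]
        refine integral_congr_ae (ae_of_all _ fun ω => ?_)
        simp only [min_div_div_right hs.le]
        ring
      rw [Measure.real, hνu, ENNReal.toReal_ofReal (integral_nonneg fun ω =>
        le_min (h.max_nonneg x (fun _ => hs) ω) (h.max_nonneg y (fun _ => hs) ω)), hsum]
      refine integral_mono
        ((h.integrable_max x (fun _ => hs)).inf (h.integrable_max y (fun _ => hs)))
        (integrable_finsetSum _ fun i _ => integrable_finsetSum _ fun j _ => himin i j)
        fun ω => ?_
      exact min_iSup_le_sum_of_nonneg (fun i => (div_pos (h.pos_spectral _ ω) hs).le)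
        (fun i => (div_pos (h.pos_spectral _ ω) hs).le)
    calc 6 * (M * N) * ν.real Set.univ = M * N * (6 * ν.real Set.univ) := by ring
      _ ≤ _ := by gcongr
  · intro z hz
    have hz0 : ∀ i, 0 < z i := fun i => hs.trans_le (hz i)
    rw [decouple_Iic, hGz z hz, hGA z hz, hGB z hz, hν z hz,
      ← ENNReal.ofReal_mul (Real.exp_pos _).le, ← ENNReal.ofReal_mul (by positivity),
      ← Real.exp_add, ← Real.exp_add]
    congr 2
    have hmm : ∀ ω, ⨆ i, Y (pt i) ω / z i = (⨆ i, Y (x i) ω / z (Sum.inl i)) +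
        (⨆ i, Y (y i) ω / z (Sum.inr i)) -
        min (⨆ i, Y (x i) ω / z (Sum.inl i)) (⨆ i, Y (y i) ω / z (Sum.inr i)) := by
      intro ω
      rw [iSup_sum_type_of_nonneg (f := fun i => Y (pt i) ω / z i)
        fun i => (div_pos (h.pos_spectral _ ω) (hz0 i)).le, eq_sub_iff_add_eq]
      exact max_add_min _ _
    have hiA := h.integrable_max x (z := fun i => z (Sum.inl i)) (fun _ => hz0 _)
    have hiB := h.integrable_max y (z := fun i => z (Sum.inr i)) (fun _ => hz0 _)
    have hsumI : Integrable (fun ω => (⨆ i, Y (x i) ω / z (Sum.inl i)) +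
        ⨆ i, Y (y i) ω / z (Sum.inr i)) P := hiA.add hiB
    have hminI : Integrable (fun ω => min (⨆ i, Y (x i) ω / z (Sum.inl i))
        (⨆ i, Y (y i) ω / z (Sum.inr i))) P := hiA.inf hiB
    simp_rw [hmm]
    rw [integral_sub hsumI hminI, integral_add hiA hiB]
    ring
  · intro u
    rw [abs_mul]
    exact mul_le_mul (hM _) (hN _) (abs_nonneg _) hM0

lemma abs_integral_sub_truncated_le (h : IsMaxStableWith P Y Z)
    [IsProbabilityMeasure P] (x : ι → E) {s : ℝ} (hs : 0 < s)
    {f : (ι → ℝ) → ℝ} (hf : Measurable f) {M : ℝ} (hM : ∀ u, |f u| ≤ M) :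
    |∫ ω, f (fun i => Z (x i) ω) ∂P - ∫ ω, f (fun i => max (Z (x i) ω) s) ∂P|
      ≤ 2 * M * (Fintype.card ι * Real.exp (-(1 / s))) := by
  have hm1 : Measurable fun ω => (fun i => Z (x i) ω) :=
    measurable_pi_lambda _ fun i => h.measurable_field _
  have hm2 : Measurable fun ω => (fun i => max (Z (x i) ω) s) :=
    measurable_pi_lambda _ fun i => (h.measurable_field _).max measurable_const
  have hM0 : 0 ≤ M := (abs_nonneg _).trans (hM 0)
  have hint : ∀ {g : Ω → ι → ℝ}, Measurable g → Integrable (fun ω => f (g ω)) P := fun hg =>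
    Integrable.of_bound (hf.comp hg).aestronglyMeasurable M (ae_of_all _ fun _ => hM _)
  let B : Set Ω := ⋃ i, {ω | Z (x i) ω < s}
  have hB : MeasurableSet B := MeasurableSet.iUnion fun i =>
    measurableSet_lt (h.measurable_field _) measurable_const
  have hPB : P.real B ≤ Fintype.card ι * Real.exp (-(1 / s)) := by
    refine (measureReal_iUnion_fintype_le _).trans ?_
    refine (Finset.sum_le_sum fun i _ => h.measure_lt_le (x i) hs).trans ?_
    simp
  rw [← integral_sub (hint hm1) (hint hm2), ← Real.norm_eq_abs]
  calc _ ≤ ∫ ω, B.indicator (fun _ => 2 * M) ω ∂P := by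
        refine norm_integral_le_of_norm_le ((integrable_const _).indicator hB)
          (ae_of_all _ fun ω => ?_)
        by_cases hω : ω ∈ B
        · rw [Set.indicator_of_mem hω, Real.norm_eq_abs]
          have a1 := hM fun i => Z (x i) ω
          have a2 := hM fun i => max (Z (x i) ω) s
          exact (abs_sub _ _).trans (by linarith)
        · have : ∀ i, max (Z (x i) ω) s = Z (x i) ω := by
            intro i
            simp only [B, Set.mem_iUnion, not_exists, Set.mem_ofPred_eq, not_lt] at hω
            exact max_eq_left (hω i)
          simp [this, Set.indicator_of_notMem hω]
    _ = 2 * M * P.real B := by rw [integral_indicator_const _ hB, smul_eq_mul, mul_comm]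
    _ ≤ _ := by gcongr

/-- Mixing bound for two finite families of values of a simple max-stable field. -/
lemma abs_cov_le (h : IsMaxStableWith P Y Z)
    [IsProbabilityMeasure P] (x : ι → E) (y : κ → E) {s : ℝ}
    (hs : 0 < s) {f : (ι → ℝ) → ℝ} {g : (κ → ℝ) → ℝ} (hf : Measurable f) (hg : Measurable g)
    {M N : ℝ} (hM : ∀ u, |f u| ≤ M) (hN : ∀ u, |g u| ≤ N) :
    |∫ ω, f (fun i => Z (x i) ω) * g (fun j => Z (y j) ω) ∂P -
      (∫ ω, f (fun i => Z (x i) ω) ∂P) * ∫ ω, g (fun j => Z (y j) ω) ∂P|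
      ≤ M * N * (4 * ((Fintype.card ι + Fintype.card κ) * Real.exp (-(1 / s))) +
        6 * (1 / s * ∑ i, ∑ j, ∫ ω, min (Y (x i) ω) (Y (y j) ω) ∂P)) := by
  have hM0 : 0 ≤ M := (abs_nonneg _).trans (hM 0)
  have hN0 : 0 ≤ N := (abs_nonneg _).trans (hN 0)
  have h1 := h.abs_integral_truncated_sub_le x y hs hf hg hM hN
  have h2 := h.abs_integral_sub_truncated_le x hs hf hM
  have h3 := h.abs_integral_sub_truncated_le y hs hg hN
  have h4 := h.abs_integral_sub_truncated_le (Sum.elim x y) hs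
    (f := fun u => f (fun i => u (Sum.inl i)) * g (fun i => u (Sum.inr i)))
    ((hf.comp measurable_comp_inl).mul (hg.comp measurable_comp_inr)) (M := M * N)
    (fun u => by rw [abs_mul]; exact mul_le_mul (hM _) (hN _) (abs_nonneg _) hM0)
  simp only [Sum.elim_inl, Sum.elim_inr, Fintype.card_sum, Nat.cast_add] at h4
  have b1 : |∫ ω, f (fun i => Z (x i) ω) ∂P| ≤ M := by
    have := norm_integral_le_of_norm_le_const (μ := P) (f := fun ω => f (fun i => Z (x i) ω))
      (C := M) (ae_of_all _ fun ω => hM _)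
    simpa using this
  have b2 : |∫ ω, g (fun j => max (Z (y j) ω) s) ∂P| ≤ N := by
    have := norm_integral_le_of_norm_le_const (μ := P)
      (f := fun ω => g (fun j => max (Z (y j) ω) s)) (C := N) (ae_of_all _ fun ω => hN _)
    simpa using this
  generalize ∫ ω, f (fun i => Z (x i) ω) * g (fun j => Z (y j) ω) ∂P = a at *
  generalize ∫ ω, f (fun i => max (Z (x i) ω) s) * g (fun j => max (Z (y j) ω) s) ∂P = a' at *
  generalize ∫ ω, f (fun i => Z (x i) ω) ∂P = b at *
  generalize ∫ ω, f (fun i => max (Z (x i) ω) s) ∂P = b' at *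
  generalize ∫ ω, g (fun j => Z (y j) ω) ∂P = c at *
  generalize ∫ ω, g (fun j => max (Z (y j) ω) s) ∂P = c' at *
  have e : a - b * c = (a - a') + (a' - b' * c') - (b * (c - c') + (b - b') * c') := by ring
  have t1 : |b * (c - c')| ≤ M * (2 * N * (Fintype.card κ * Real.exp (-(1 / s)))) := by
    rw [abs_mul]; exact mul_le_mul b1 h3 (abs_nonneg _) hM0
  have t2 : |(b - b') * c'| ≤ 2 * M * (Fintype.card ι * Real.exp (-(1 / s))) * N := by
    rw [abs_mul]; exact mul_le_mul h2 b2 (abs_nonneg _) ((abs_nonneg _).trans h2)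
  rw [e]
  calc _ ≤ |a - a'| + |a' - b' * c'| + (|b * (c - c')| + |(b - b') * c'|) :=
        (abs_sub _ _).trans (add_le_add (abs_add_le _ _) (abs_add_le _ _))
    _ ≤ _ := by linarith

end IsMaxStableWith

end MaxStable

section Gaussian

lemma gaussian_facts {Ω : Type*} [MeasurableSpace Ω] {P : Measure Ω} {X : Ω → ℝ}
    (hX : Measurable X) {v : ℝ≥0} (h : P.map X = gaussianReal 0 v) :
    MemLp X 2 P ∧ ∫ ω, X ω ^ 2 ∂P = v ∧
      ∀ t, Integrable (fun ω => Real.exp (t * X ω)) P ∧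
        ∫ ω, Real.exp (t * X ω) ∂P = Real.exp (v * t ^ 2 / 2) := by
  refine ⟨?_, ?_, fun t => ⟨?_, ?_⟩⟩
  · have := memLp_id_gaussianReal (μ := 0) (v := v) 2
    rw [← h] at this
    exact (memLp_map_measure_iff (by fun_prop) hX.aemeasurable).1 this
  · have := variance_id_gaussianReal (μ := 0) (v := v)
    rw [variance_eq_integral (by fun_prop)] at this
    simp only [id, integral_id_gaussianReal, sub_zero] at this
    rw [← h, integral_map hX.aemeasurable (by fun_prop)] at this
    exact this
  · have := integrable_exp_mul_gaussianReal (μ := 0) (v := v) t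
    rw [← h] at this
    exact (integrable_map_measure (by fun_prop) hX.aemeasurable).1 this
  · have := mgf_gaussianReal h t
    simpa [mgf] using this

lemma continuous_quadInv {d : ℕ} (Sig : Matrix (Fin d) (Fin d) ℝ) :
    Continuous (quadInv Sig) := by
  have hc : Continuous fun (x : EuclideanSpace ℝ (Fin d)) i => x i := by fun_prop
  exact hc.dotProduct (continuous_const.matrix_mulVec hc)

lemma quadInv_smul {d : ℕ} (Sig : Matrix (Fin d) (Fin d) ℝ) (a : ℝ)
    (x : EuclideanSpace ℝ (Fin d)) : quadInv Sig (a • x) = a ^ 2 * quadInv Sig x := by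
  unfold quadInv
  have h1 : (fun i => (a • x) i) = a • fun i => x i := by ext; simp
  rw [h1, mulVec_smul, dotProduct_smul, smul_dotProduct, smul_eq_mul, smul_eq_mul]
  ring

/-- The quadratic form of a positive definite matrix is coercive. -/
lemma exists_le_quadInv {d : ℕ} (hd : 0 < d) {Sig : Matrix (Fin d) (Fin d) ℝ}
    (hSig : Sig.PosDef) : ∃ c > 0, ∀ x, c * ‖x‖ ^ 2 ≤ quadInv Sig x := by
  have : Nonempty (Fin d) := ⟨⟨0, hd⟩⟩
  have hpos : ∀ x : EuclideanSpace ℝ (Fin d), x ≠ 0 → 0 < quadInv Sig x := by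
    intro x hx
    have hx' : (fun i => x i) ≠ 0 := fun h0 => hx (by ext i; exact congrFun h0 i)
    simpa [quadInv] using hSig.inv.dotProduct_mulVec_pos hx'
  obtain ⟨m, hm, hmin⟩ := (isCompact_sphere (0 : EuclideanSpace ℝ (Fin d)) 1).exists_isMinOn
    (NormedSpace.sphere_nonempty.2 zero_le_one) (continuous_quadInv Sig).continuousOn
  have hm0 : m ≠ 0 := by
    rintro rfl
    simp at hm
  refine ⟨quadInv Sig m, hpos m hm0, fun x => ?_⟩
  rcases eq_or_ne x 0 with rfl | hx
  · simp [quadInv]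
  have hn : ‖x‖ ≠ 0 := norm_ne_zero_iff.2 hx
  have h1 : quadInv Sig m ≤ quadInv Sig (‖x‖⁻¹ • x) := hmin (by simp [norm_smul, hn])
  rw [quadInv_smul] at h1
  calc quadInv Sig m * ‖x‖ ^ 2 ≤ (‖x‖⁻¹ ^ 2 * quadInv Sig x) * ‖x‖ ^ 2 := by gcongr
    _ = quadInv Sig x := by field_simp

variable {d : ℕ} {Ω : Type*} [MeasurableSpace Ω] {P : Measure Ω}
    {Sig : Matrix (Fin d) (Fin d) ℝ} {W : EuclideanSpace ℝ (Fin d) → Ω → ℝ}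

/-- The law of `W x + W y`. -/
lemma map_add_eq_gaussianReal (hWmeas : ∀ x, Measurable (W x))
    (hgauss : ∀ (n : ℕ) (x : Fin n → EuclideanSpace ℝ (Fin d)) (c : Fin n → ℝ),
      ∃ v : ℝ≥0, Measure.map (fun ω => ∑ i, c i * W (x i) ω) P = gaussianReal 0 v)
    (hinc : ∀ (x₀ : EuclideanSpace ℝ (Fin d)) (n : ℕ)
      (x : Fin n → EuclideanSpace ℝ (Fin d)),
      Measure.map (fun ω i => W (x i + x₀) ω - W x₀ ω) P
        = Measure.map (fun ω i => W (x i) ω - W 0 ω) P)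
    (hW0 : ∀ᵐ ω ∂P, W 0 ω = 0)
    (hvar : ∀ x : EuclideanSpace ℝ (Fin d), ∫ ω, (W x ω) ^ 2 ∂P = quadInv Sig x)
    (x y : EuclideanSpace ℝ (Fin d)) :
    ∃ v : ℝ≥0, P.map (fun ω => W x ω + W y ω) = gaussianReal 0 v ∧
      (v : ℝ) = 2 * quadInv Sig x + 2 * quadInv Sig y - quadInv Sig (x - y) := by
  have hone : ∀ x, MemLp (W x) 2 P := by
    intro x
    obtain ⟨v, hv⟩ := hgauss 1 (fun _ => x) (fun _ => 1)
    simp only [Finset.univ_unique, Finset.sum_const, Finset.card_singleton, one_smul,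
      one_mul] at hv
    exact (gaussian_facts (hWmeas x) hv).1
  obtain ⟨v, hv⟩ := hgauss 2 ![x, y] (fun _ => 1)
  simp only [Fin.sum_univ_two, one_mul, Matrix.cons_val_zero, Matrix.cons_val_one] at hv
  refine ⟨v, hv, ?_⟩
  rw [← (gaussian_facts ((hWmeas x).add (hWmeas y)) hv).2.1]
  have hsub : ∫ ω, (W x ω - W y ω) ^ 2 ∂P = quadInv Sig (x - y) := by
    have hm1 : Measurable fun ω (_ : Fin 1) => W (x - y + y) ω - W y ω :=
      measurable_pi_lambda _ fun _ => (hWmeas _).sub (hWmeas _)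
    have hm2 : Measurable fun ω (_ : Fin 1) => W (x - y) ω - W 0 ω :=
      measurable_pi_lambda _ fun _ => (hWmeas _).sub (hWmeas _)
    have hmf : Measurable fun u : Fin 1 → ℝ => u 0 ^ 2 := by fun_prop
    have e1 := integral_map (μ := P) hm1.aemeasurable hmf.aestronglyMeasurable
    have e2 := integral_map (μ := P) hm2.aemeasurable hmf.aestronglyMeasurable
    rw [hinc y 1 (fun _ => x - y), e2] at e1
    simp only [sub_add_cancel] at e1
    rw [← e1, ← hvar]
    refine integral_congr_ae ?_
    filter_upwards [hW0] with ω hω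
    simp [hω]
  have hi1 : Integrable (fun ω => 2 * W x ω ^ 2 + 2 * W y ω ^ 2) P :=
    ((hone x).integrable_sq.const_mul 2).add ((hone y).integrable_sq.const_mul 2)
  have hi2 : Integrable (fun ω => (W x ω - W y ω) ^ 2) P := ((hone x).sub (hone y)).integrable_sq
  rw [← hsub, ← hvar x, ← hvar y, ← integral_const_mul, ← integral_const_mul,
    ← integral_add ((hone x).integrable_sq.const_mul 2) ((hone y).integrable_sq.const_mul 2),
    ← integral_sub hi1 hi2]
  refine integral_congr_ae (ae_of_all _ fun ω => ?_)
  simp only [Pi.add_apply]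
  ring

/-- The spectral functions of the Smith field have mean one and their overlap decays. -/
lemma smith_spectral (hWmeas : ∀ x, Measurable (W x))
    (hgauss : ∀ (n : ℕ) (x : Fin n → EuclideanSpace ℝ (Fin d)) (c : Fin n → ℝ),
      ∃ v : ℝ≥0, Measure.map (fun ω => ∑ i, c i * W (x i) ω) P = gaussianReal 0 v)
    (hinc : ∀ (x₀ : EuclideanSpace ℝ (Fin d)) (n : ℕ)
      (x : Fin n → EuclideanSpace ℝ (Fin d)),
      Measure.map (fun ω i => W (x i + x₀) ω - W x₀ ω) P
        = Measure.map (fun ω i => W (x i) ω - W 0 ω) P)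
    (hW0 : ∀ᵐ ω ∂P, W 0 ω = 0)
    (hvar : ∀ x : EuclideanSpace ℝ (Fin d), ∫ ω, (W x ω) ^ 2 ∂P = quadInv Sig x)
    {Y : EuclideanSpace ℝ (Fin d) → Ω → ℝ}
    (hY : ∀ x ω, Y x ω = Real.exp (W x ω - quadInv Sig x / 2)) :
    (∀ x, Integrable (Y x) P ∧ ∫ ω, Y x ω ∂P = 1) ∧
      ∀ x y, ∫ ω, min (Y x ω) (Y y ω) ∂P ≤ Real.exp (-(quadInv Sig (x - y) / 8)) := by
  have key : ∀ x y, Integrable (fun ω => Real.exp ((1 / 2 : ℝ) * (W x ω + W y ω) -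
      (quadInv Sig x + quadInv Sig y) / 4)) P ∧ ∫ ω, Real.exp ((1 / 2 : ℝ) * (W x ω + W y ω) -
      (quadInv Sig x + quadInv Sig y) / 4) ∂P = Real.exp (-(quadInv Sig (x - y) / 8)) := by
    intro x y
    obtain ⟨v, hv, hv'⟩ := map_add_eq_gaussianReal hWmeas hgauss hinc hW0 hvar x y
    obtain ⟨-, -, h⟩ := gaussian_facts ((hWmeas x).add (hWmeas y)) hv
    obtain ⟨h1, h2⟩ := h (1 / 2)
    simp only [Pi.add_apply] at h1 h2
    simp only [Real.exp_sub]
    refine ⟨h1.div_const _, ?_⟩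
    rw [integral_div, h2, ← Real.exp_sub, hv']
    congr 1
    ring
  have hYx : ∀ x, Y x = fun ω => Real.exp ((1 / 2 : ℝ) * (W x ω + W x ω) -
      (quadInv Sig x + quadInv Sig x) / 4) := by
    intro x
    ext ω
    rw [hY]
    congr 1
    ring
  have hone : ∀ x, Integrable (Y x) P ∧ ∫ ω, Y x ω ∂P = 1 := by
    intro x
    rw [hYx]
    refine ⟨(key x x).1, (key x x).2.trans ?_⟩
    simp [quadInv]
  refine ⟨hone, fun x y => ?_⟩
  rw [← (key x y).2]
  refine integral_mono ((hone x).1.inf (hone y).1) (key x y).1 fun ω => ?_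
  simp only [hY]
  rw [← Real.exp_monotone.map_min]
  refine Real.exp_le_exp.2 ?_
  rcases le_total (W x ω - quadInv Sig x / 2) (W y ω - quadInv Sig y / 2) with h | h
  · rw [min_eq_left h]; linarith
  · rw [min_eq_right h]; linarith

end Gaussian

section Mixing

/-- Mixing at an arbitrary polynomial rate for bounded functions of finitely many values. -/
def HasPolyMixing {E Ω : Type*} [PseudoMetricSpace E] [MeasurableSpace Ω] (P : Measure Ω)
    (Z : E → Ω → ℝ) : Prop :=
  ∀ p : ℕ, ∃ A : ℝ, 0 ≤ A ∧ ∀ (ι κ : Type) [Fintype ι] [Fintype κ] (x : ι → E) (y : κ → E) (r : ℝ),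
    0 ≤ r → (∀ i j, r ≤ dist (x i) (y j)) → ∀ (f : (ι → ℝ) → ℝ) (g : (κ → ℝ) → ℝ),
    Measurable f → Measurable g → ∀ M N : ℝ, (∀ u, |f u| ≤ M) → (∀ u, |g u| ≤ N) →
    |∫ ω, f (fun i => Z (x i) ω) * g (fun j => Z (y j) ω) ∂P -
      (∫ ω, f (fun i => Z (x i) ω) ∂P) * ∫ ω, g (fun j => Z (y j) ω) ∂P|
      ≤ M * N * ((Fintype.card ι + Fintype.card κ + Fintype.card ι * Fintype.card κ) *
        (A / (1 + r) ^ p))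

lemma pow_mul_exp_neg_le {t : ℝ} (ht : 0 ≤ t) (p : ℕ) :
    t ^ p * Real.exp (-t) ≤ p.factorial := by
  have := Real.pow_div_factorial_le_exp t ht p
  rw [div_le_iff₀ (by positivity)] at this
  rw [Real.exp_neg, ← div_eq_mul_inv, div_le_iff₀ (Real.exp_pos _)]
  linarith

lemma exp_neg_sq_le {c r : ℝ} (hc : 0 < c) :
    Real.exp (-(c * r ^ 2)) ≤ Real.exp (1 + 1 / (4 * c)) * Real.exp (-(1 + r)) := by
  rw [← Real.exp_add]
  refine Real.exp_le_exp.2 ?_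
  have h : c * r ^ 2 - r + 1 / (4 * c) = c * (r - 1 / (2 * c)) ^ 2 := by
    field_simp
    ring
  nlinarith [mul_nonneg hc.le (sq_nonneg (r - 1 / (2 * c)))]

lemma IsMaxStableWith.hasPolyMixing {E Ω : Type*} [PseudoMetricSpace E] [MeasurableSpace Ω]
    {P : Measure Ω} [IsProbabilityMeasure P] {Y Z : E → Ω → ℝ} (h : IsMaxStableWith P Y Z)
    {c : ℝ} (hc : 0 < c)
    (hmin : ∀ x y, ∫ ω, min (Y x ω) (Y y ω) ∂P ≤ Real.exp (-(c * dist x y ^ 2))) :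
    HasPolyMixing P Z := by
  intro p
  set K : ℝ := Real.exp (1 + 1 / (4 * c))
  refine ⟨4 * p.factorial + 6 * (K * (p + 1).factorial), by positivity, ?_⟩
  intro ι κ _ _ x y r hr hxy f g hf hg M N hM hN
  have hr1 : 0 < 1 + r := by linarith
  refine (h.abs_cov_le x y (s := 1 / (1 + r)) (by positivity) hf hg hM hN).trans ?_
  have hM0 : 0 ≤ M := (abs_nonneg _).trans (hM 0)
  have hN0 : 0 ≤ N := (abs_nonneg _).trans (hN 0)
  rw [one_div_one_div]
  refine mul_le_mul_of_nonneg_left ?_ (mul_nonneg hM0 hN0)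
  have h1 : Real.exp (-(1 + r)) ≤ p.factorial / (1 + r) ^ p := by
    rw [le_div_iff₀ (by positivity), mul_comm]
    exact pow_mul_exp_neg_le hr1.le p
  have h2 : (1 + r) * Real.exp (-(c * r ^ 2)) ≤ K * (p + 1).factorial / (1 + r) ^ p := by
    rw [le_div_iff₀ (by positivity)]
    calc (1 + r) * Real.exp (-(c * r ^ 2)) * (1 + r) ^ p
        ≤ (1 + r) * (K * Real.exp (-(1 + r))) * (1 + r) ^ p := by
          gcongr
          exact exp_neg_sq_le hc
      _ = K * ((1 + r) ^ (p + 1) * Real.exp (-(1 + r))) := by ring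
      _ ≤ _ := by
        gcongr
        exact pow_mul_exp_neg_le hr1.le (p + 1)
  have h3 : (1 + r) * ∑ i, ∑ j, ∫ ω, min (Y (x i) ω) (Y (y j) ω) ∂P ≤
      Fintype.card ι * Fintype.card κ * (K * (p + 1).factorial / (1 + r) ^ p) := by
    calc _ ≤ (1 + r) * ∑ i : ι, ∑ j : κ, Real.exp (-(c * r ^ 2)) := by
          gcongr with i _ j _
          refine (hmin _ _).trans (Real.exp_le_exp.2 ?_)
          have := hxy i j
          gcongr
      _ = Fintype.card ι * Fintype.card κ * ((1 + r) * Real.exp (-(c * r ^ 2))) := by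
          simp
          ring
      _ ≤ _ := by gcongr
  have ha : (0 : ℝ) ≤ Fintype.card ι := by positivity
  have hb : (0 : ℝ) ≤ Fintype.card κ := by positivity
  generalize (Fintype.card ι : ℝ) = a at *
  generalize (Fintype.card κ : ℝ) = b at *
  calc _ ≤ 4 * ((a + b) * (p.factorial / (1 + r) ^ p)) +
        6 * (a * b * (K * (p + 1).factorial / (1 + r) ^ p)) := by gcongr
    _ = (a + b) * (4 * p.factorial / (1 + r) ^ p) +
        a * b * (6 * (K * (p + 1).factorial) / (1 + r) ^ p) := by ring
    _ ≤ (a + b) * ((4 * p.factorial + 6 * (K * (p + 1).factorial)) / (1 + r) ^ p) +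
        a * b * ((4 * p.factorial + 6 * (K * (p + 1).factorial)) / (1 + r) ^ p) := by
        have hK : 0 ≤ K := (Real.exp_pos _).le
        gcongr
        · exact le_add_of_nonneg_right (by positivity)
        · exact le_add_of_nonneg_left (by positivity)
    _ = _ := by ring

end Mixing

section L2

variable {Ω : Type*} [MeasurableSpace Ω] {P : Measure Ω}

/-- Cauchy–Schwarz for the integral of a product. -/
lemma abs_integral_mul_le_sqrt {X Y : Ω → ℝ} (hX : MemLp X 2 P) (hY : MemLp Y 2 P) :
    |∫ ω, X ω * Y ω ∂P| ≤ √(∫ ω, X ω ^ 2 ∂P) * √(∫ ω, Y ω ^ 2 ∂P) := by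
  have := integral_mul_norm_le_Lp_mul_Lq (μ := P) (f := X) (g := Y) (p := 2) (q := 2)
    Real.HolderConjugate.two_two (by simpa using hX) (by simpa using hY)
  simp only [Real.norm_eq_abs, Real.rpow_two, sq_abs, ← Real.sqrt_eq_rpow] at this
  refine (abs_integral_le_integral_abs).trans ?_
  simpa only [abs_mul] using this

lemma abs_integral_le_sqrt [IsProbabilityMeasure P] {X : Ω → ℝ} (hX : MemLp X 2 P) :
    |∫ ω, X ω ∂P| ≤ √(∫ ω, X ω ^ 2 ∂P) := by
  simpa using abs_integral_mul_le_sqrt hX (memLp_const (1 : ℝ))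

lemma abs_cov_le_sqrt [IsProbabilityMeasure P] {X Y : Ω → ℝ} (hX : MemLp X 2 P)
    (hY : MemLp Y 2 P) :
    |cov P X Y| ≤ 2 * (√(∫ ω, X ω ^ 2 ∂P) * √(∫ ω, Y ω ^ 2 ∂P)) := by
  have h1 := abs_integral_mul_le_sqrt hX hY
  have h2 := mul_le_mul (abs_integral_le_sqrt hX) (abs_integral_le_sqrt hY) (abs_nonneg _)
    (Real.sqrt_nonneg _)
  rw [← abs_mul] at h2
  exact (abs_sub _ _).trans (by linarith)

/-- Minkowski's inequality for second moments. -/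
lemma sqrt_integral_add_sq_le {X Y : Ω → ℝ} (hX : MemLp X 2 P) (hY : MemLp Y 2 P) :
    √(∫ ω, (X ω + Y ω) ^ 2 ∂P) ≤ √(∫ ω, X ω ^ 2 ∂P) + √(∫ ω, Y ω ^ 2 ∂P) := by
  have h := (le_abs_self _).trans (abs_integral_mul_le_sqrt hX hY)
  have e : ∫ ω, (X ω + Y ω) ^ 2 ∂P =
      ∫ ω, X ω ^ 2 ∂P + 2 * ∫ ω, X ω * Y ω ∂P + ∫ ω, Y ω ^ 2 ∂P := by
    have hxy : Integrable (fun ω => 2 * (X ω * Y ω)) P := (hX.integrable_mul hY).const_mul 2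
    have hi : Integrable (fun ω => X ω ^ 2 + 2 * (X ω * Y ω)) P := hX.integrable_sq.add hxy
    rw [← integral_const_mul, ← integral_add hX.integrable_sq hxy,
      ← integral_add hi hY.integrable_sq]
    exact integral_congr_ae (ae_of_all _ fun ω => by simp only; ring)
  have hx : 0 ≤ ∫ ω, X ω ^ 2 ∂P := integral_nonneg fun _ => sq_nonneg _
  have hy : 0 ≤ ∫ ω, Y ω ^ 2 ∂P := integral_nonneg fun _ => sq_nonneg _
  rw [Real.sqrt_le_left (by positivity), e, add_sq, Real.sq_sqrt hx, Real.sq_sqrt hy]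
  linarith

end L2

section Clamp

/-- Truncation of a real number to `[-K, K]`. -/
def clamp (K u : ℝ) : ℝ := max (-K) (min u K)

lemma abs_clamp_le {K : ℝ} (hK : 0 ≤ K) (u : ℝ) : |clamp K u| ≤ K :=
  abs_le.2 ⟨le_max_left _ _, max_le (by linarith) (min_le_right _ _)⟩

lemma clamp_of_abs_le {K u : ℝ} (h : |u| ≤ K) : clamp K u = u := by
  rw [clamp, min_eq_left (abs_le.1 h).2, max_eq_right (abs_le.1 h).1]

lemma abs_clamp_sub_clamp_le (K u v : ℝ) : |clamp K u - clamp K v| ≤ |u - v| := by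
  unfold clamp
  refine (abs_max_sub_max_le_max _ _ _ _).trans ?_
  simp only [sub_self, abs_zero]
  refine max_le (abs_nonneg _) ((abs_min_sub_min_le_max _ _ _ _).trans ?_)
  simp

lemma clamp_zero {K : ℝ} (hK : 0 ≤ K) : clamp K 0 = 0 := clamp_of_abs_le (by simpa using hK)

lemma abs_clamp_le_abs {K : ℝ} (hK : 0 ≤ K) (u : ℝ) : |clamp K u| ≤ |u| := by
  simpa [clamp_zero hK] using abs_clamp_sub_clamp_le K u 0

lemma abs_sub_clamp_le {K : ℝ} (hK : 0 ≤ K) (u : ℝ) : |u - clamp K u| ≤ |u| := by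
  unfold clamp
  rcases le_total u K with h | h
  · rw [min_eq_left h]
    rcases le_total (-K) u with h' | h'
    · rw [max_eq_right h']; simp
    · rw [max_eq_left h', abs_of_nonpos (by linarith), abs_of_nonpos (by linarith)]; linarith
  · rw [min_eq_right h, max_eq_right (by linarith), abs_of_nonneg (by linarith),
      abs_of_nonneg (by linarith)]
    linarith

lemma continuous_clamp (K : ℝ) : Continuous (clamp K) := by
  unfold clamp
  fun_prop

lemma sq_le_one_add_rpow {δ : ℝ} (hδ : 0 < δ) (u : ℝ) : u ^ 2 ≤ 1 + |u| ^ (2 + δ) := by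
  rw [← sq_abs]
  rcases le_total |u| 1 with h | h
  · have h1 : |u| ^ 2 ≤ 1 := pow_le_one₀ (abs_nonneg _) h
    have h2 : 0 ≤ |u| ^ (2 + δ) := by positivity
    linarith
  · have : |u| ^ (2 : ℝ) ≤ |u| ^ (2 + δ) := Real.rpow_le_rpow_of_exponent_le h (by linarith)
    rw [Real.rpow_two] at this
    linarith

lemma sub_clamp_sq_le {δ K : ℝ} (hδ : 0 < δ) (hK : 0 < K) (u : ℝ) :
    (u - clamp K u) ^ 2 ≤ |u| ^ (2 + δ) / K ^ δ := by
  rcases le_total |u| K with h | h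
  · rw [clamp_of_abs_le h, sub_self, zero_pow two_ne_zero]
    positivity
  · have hu : 0 < |u| := hK.trans_le h
    rw [le_div_iff₀ (by positivity), Real.rpow_add hu, Real.rpow_two, ← sq_abs (u - _)]
    exact mul_le_mul (pow_le_pow_left₀ (abs_nonneg _) (abs_sub_clamp_le hK.le u) 2)
      (Real.rpow_le_rpow hK.le h hδ.le) (by positivity) (by positivity)

end Clamp

section Davydov

variable {Ω : Type*} [MeasurableSpace Ω] {P : Measure Ω} [IsProbabilityMeasure P]

lemma memLp_two_of_moment {δ : ℝ} (hδ : 0 < δ) {X : Ω → ℝ} (hX : AEStronglyMeasurable X P)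
    (hi : Integrable (fun ω => |X ω| ^ (2 + δ)) P) : MemLp X 2 P := by
  rw [memLp_two_iff_integrable_sq hX]
  refine ((integrable_const 1).add hi).mono' (hX.pow 2) (ae_of_all _ fun ω => ?_)
  rw [Real.norm_eq_abs, abs_of_nonneg (sq_nonneg _)]
  exact sq_le_one_add_rpow hδ _

lemma integral_sq_le_of_moment {δ : ℝ} (hδ : 0 < δ) {X : Ω → ℝ} (hX : AEStronglyMeasurable X P)
    (hi : Integrable (fun ω => |X ω| ^ (2 + δ)) P) :
    ∫ ω, X ω ^ 2 ∂P ≤ 1 + ∫ ω, |X ω| ^ (2 + δ) ∂P := by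
  have h := integral_mono (memLp_two_of_moment hδ hX hi).integrable_sq
    ((integrable_const 1).add hi) fun ω => sq_le_one_add_rpow hδ (X ω)
  have e : ∫ ω, (1 + |X ω| ^ (2 + δ)) ∂P = 1 + ∫ ω, |X ω| ^ (2 + δ) ∂P := by
    rw [integral_add (integrable_const 1) hi]
    simp
  exact h.trans_eq e

lemma memLp_clamp {X : Ω → ℝ} (hX : AEStronglyMeasurable X P) {K : ℝ} (hK : 0 ≤ K)
    (p : ℝ≥0∞) : MemLp (fun ω => clamp K (X ω)) p P :=
  MemLp.of_bound ((continuous_clamp K).comp_aestronglyMeasurable hX) K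
    (ae_of_all _ fun _ => abs_clamp_le hK _)

lemma integral_sub_clamp_sq_le {δ K : ℝ} (hδ : 0 < δ) (hK : 0 < K) {X : Ω → ℝ}
    (hX : AEStronglyMeasurable X P) (hi : Integrable (fun ω => |X ω| ^ (2 + δ)) P) :
    ∫ ω, (X ω - clamp K (X ω)) ^ 2 ∂P ≤ (∫ ω, |X ω| ^ (2 + δ) ∂P) / K ^ δ := by
  rw [← integral_div]
  exact integral_mono ((memLp_two_of_moment hδ hX hi).sub (memLp_clamp hX hK.le 2)).integrable_sq
    (hi.div_const _) fun ω => sub_clamp_sq_le hδ hK _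

lemma cov_sub_cov {X Y X' Y' : Ω → ℝ} (hX : MemLp X 2 P) (hY : MemLp Y 2 P)
    (hX' : MemLp X' 2 P) (hY' : MemLp Y' 2 P) :
    cov P X Y - cov P X' Y' =
      cov P (fun ω => X ω - X' ω) Y + cov P X' (fun ω => Y ω - Y' ω) := by
  have i1 : Integrable (fun ω => X ω * Y ω) P := hX.integrable_mul hY
  have i2 : Integrable (fun ω => X' ω * Y ω) P := hX'.integrable_mul hY
  have i3 : Integrable (fun ω => X' ω * Y' ω) P := hX'.integrable_mul hY'
  simp only [cov, sub_mul, mul_sub]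
  rw [integral_sub i1 i2, integral_sub i2 i3,
    integral_sub (hX.integrable one_le_two) (hX'.integrable one_le_two),
    integral_sub (hY.integrable one_le_two) (hY'.integrable one_le_two)]
  ring

/-- Polynomial decay of covariances under a moment condition of order `2 + δ`. -/
lemma HasPolyMixing.exists_abs_cov_le {E : Type*} [PseudoMetricSpace E] {Z : E → Ω → ℝ}
    (h : HasPolyMixing P Z) (hZ : ∀ x, Measurable (Z x)) {δ : ℝ} (hδ : 0 < δ) (q : ℕ)
    (M : ℝ) : ∃ C : ℝ, 0 ≤ C ∧ ∀ (ι κ : Type) [Fintype ι] [Fintype κ] (x : ι → E) (y : κ → E)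
      (r : ℝ), Fintype.card ι ≤ 2 → Fintype.card κ ≤ 2 → 0 ≤ r →
      (∀ i j, r ≤ dist (x i) (y j)) → ∀ (f : (ι → ℝ) → ℝ) (g : (κ → ℝ) → ℝ),
      Measurable f → Measurable g →
      Integrable (fun ω => |f (fun i => Z (x i) ω)| ^ (2 + δ)) P →
      Integrable (fun ω => |g (fun i => Z (y i) ω)| ^ (2 + δ)) P →
      ∫ ω, |f (fun i => Z (x i) ω)| ^ (2 + δ) ∂P ≤ M →
      ∫ ω, |g (fun i => Z (y i) ω)| ^ (2 + δ) ∂P ≤ M →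
      |cov P (fun ω => f (fun i => Z (x i) ω)) (fun ω => g (fun i => Z (y i) ω))|
        ≤ C / (1 + r) ^ q := by
  obtain ⟨k, hk⟩ := exists_nat_ge (2 * q / δ)
  obtain ⟨A, hA0, hA⟩ := h (2 * k + q)
  refine ⟨8 * A + 4 * (√M * √(1 + M)), by positivity, ?_⟩
  intro ι κ _ _ x y r hι hκ hr hxy f g hf hg hfi hgi hfM hgM
  have hr1 : 1 ≤ 1 + r := by linarith
  have hM : 0 ≤ M := (integral_nonneg fun _ => by positivity).trans hfM
  set K := (1 + r) ^ k with hKdef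
  have hK : 0 < K := by positivity
  set U : Ω → ℝ := fun ω => f (fun i => Z (x i) ω)
  set V : Ω → ℝ := fun ω => g (fun i => Z (y i) ω)
  have hU : AEStronglyMeasurable U P :=
    (hf.comp (measurable_pi_lambda _ fun i => hZ _)).aestronglyMeasurable
  have hV : AEStronglyMeasurable V P :=
    (hg.comp (measurable_pi_lambda _ fun i => hZ _)).aestronglyMeasurable
  have hU2 := memLp_two_of_moment hδ hU hfi
  have hV2 := memLp_two_of_moment hδ hV hgi
  have hUK := memLp_clamp hU hK.le 2
  have hVK := memLp_clamp hV hK.le 2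
  have hKδ : (1 + r) ^ (2 * q) ≤ K ^ δ := by
    rw [hKdef, ← Real.rpow_natCast (1 + r) k, ← Real.rpow_mul (by linarith),
      ← Real.rpow_natCast]
    refine Real.rpow_le_rpow_of_exponent_le hr1 ?_
    rw [div_le_iff₀ hδ] at hk
    push_cast
    exact hk
  have tail : ∀ {X : Ω → ℝ}, AEStronglyMeasurable X P →
      Integrable (fun ω => |X ω| ^ (2 + δ)) P → ∫ ω, |X ω| ^ (2 + δ) ∂P ≤ M →
      √(∫ ω, (X ω - clamp K (X ω)) ^ 2 ∂P) ≤ √M / (1 + r) ^ q := by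
    intro X hX hXi hXM
    rw [Real.sqrt_le_left (by positivity), div_pow, Real.sq_sqrt hM, ← pow_mul, mul_comm q 2]
    refine (integral_sub_clamp_sq_le hδ hK hX hXi).trans ?_
    gcongr
  have two : ∀ {X : Ω → ℝ}, AEStronglyMeasurable X P →
      Integrable (fun ω => |X ω| ^ (2 + δ)) P → ∫ ω, |X ω| ^ (2 + δ) ∂P ≤ M →
      √(∫ ω, X ω ^ 2 ∂P) ≤ √(1 + M) := by
    intro X hX hXi hXM
    exact Real.sqrt_le_sqrt ((integral_sq_le_of_moment hδ hX hXi).trans (by linarith))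
  have hUK2 : √(∫ ω, clamp K (U ω) ^ 2 ∂P) ≤ √(1 + M) := by
    refine le_trans (Real.sqrt_le_sqrt ?_) (two hU hfi hfM)
    exact integral_mono hUK.integrable_sq hU2.integrable_sq fun ω =>
      sq_le_sq.2 (abs_clamp_le_abs hK.le _)
  have main : |cov P (fun ω => clamp K (U ω)) (fun ω => clamp K (V ω))| ≤
      8 * A / (1 + r) ^ q := by
    refine (hA ι κ x y r hr hxy (fun u => clamp K (f u)) (fun u => clamp K (g u))
      ((continuous_clamp K).measurable.comp hf) ((continuous_clamp K).measurable.comp hg) K K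
      (fun _ => abs_clamp_le hK.le _) (fun _ => abs_clamp_le hK.le _)).trans ?_
    have hι' : (Fintype.card ι : ℝ) ≤ 2 := by exact_mod_cast hι
    have hκ' : (Fintype.card κ : ℝ) ≤ 2 := by exact_mod_cast hκ
    have e : K * K = (1 + r) ^ (2 * k) := by rw [hKdef]; ring
    calc _ ≤ K * K * ((2 + 2 + 2 * 2) * (A / (1 + r) ^ (2 * k + q))) := by gcongr
      _ = 8 * A / (1 + r) ^ q := by
        rw [e, pow_add]
        field_simp
        ring
  have e := cov_sub_cov hU2 hV2 hUK hVK
  have b1 := abs_cov_le_sqrt (hU2.sub hUK) hV2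
  have b2 := abs_cov_le_sqrt hUK (hV2.sub hVK)
  have c1 := mul_le_mul (tail hU hfi hfM) (two hV hgi hgM) (Real.sqrt_nonneg _) (by positivity)
  have c2 := mul_le_mul hUK2 (tail hV hgi hgM) (Real.sqrt_nonneg _) (by positivity)
  have e' : cov P U V = cov P (fun ω => clamp K (U ω)) (fun ω => clamp K (V ω)) +
      (cov P (fun ω => U ω - clamp K (U ω)) V +
        cov P (fun ω => clamp K (U ω)) fun ω => V ω - clamp K (V ω)) := by
    rw [← e]; ring
  rw [e']
  calc _ ≤ _ := (abs_add_le _ _).trans (add_le_add main ((abs_add_le _ _).trans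
        (add_le_add (b1.trans (mul_le_mul_of_nonneg_left c1 zero_le_two))
          (b2.trans (mul_le_mul_of_nonneg_left c2 zero_le_two)))))
    _ = _ := by ring

end Davydov

section SecondMoment

lemma abs_integral_mul_le_of_sq {Ω : Type*} [MeasurableSpace Ω] {P : Measure Ω} {B : ℝ}
    {X Y : Ω → ℝ} (hX : MemLp X 2 P) (hY : MemLp Y 2 P)
    (hXB : ∫ ω, X ω ^ 2 ∂P ≤ B) (hYB : ∫ ω, Y ω ^ 2 ∂P ≤ B) :
    ∫ ω, |X ω * Y ω| ∂P ≤ B := by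
  have hB : 0 ≤ B := (integral_nonneg fun _ => sq_nonneg _).trans hXB
  have h := (le_abs_self _).trans (abs_integral_mul_le_sqrt (P := P) (X := fun ω => |X ω|)
    (Y := fun ω => |Y ω|) hX.abs hY.abs)
  simp only [sq_abs, ← abs_mul] at h
  calc _ ≤ _ := h
    _ ≤ √B * √B := by gcongr
    _ = B := Real.mul_self_sqrt hB

variable {α Ω : Type*} [MeasurableSpace α] [MeasurableSpace Ω] {P : Measure Ω}
  [IsProbabilityMeasure P] {μ : Measure α} [IsFiniteMeasure μ] {U : α → Ω → ℝ} {B : ℝ}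

lemma integrable_mul_prod (hU : Measurable fun p : α × Ω => U p.1 p.2)
    (hU2 : ∀ x, MemLp (U x) 2 P) (hB : ∀ x, ∫ ω, U x ω ^ 2 ∂P ≤ B) :
    Integrable (fun p : (α × α) × Ω => U p.1.1 p.2 * U p.1.2 p.2) ((μ.prod μ).prod P) := by
  have hm : Measurable fun p : (α × α) × Ω => U p.1.1 p.2 * U p.1.2 p.2 :=
    (hU.comp ((measurable_fst.comp measurable_fst).prodMk measurable_snd)).mul
      (hU.comp ((measurable_snd.comp measurable_fst).prodMk measurable_snd))
  rw [integrable_prod_iff hm.aestronglyMeasurable]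
  refine ⟨ae_of_all _ fun p => (hU2 p.1).integrable_mul (hU2 p.2), ?_⟩
  refine Integrable.of_bound hm.aestronglyMeasurable.norm.integral_prod_right' B
    (ae_of_all _ fun p => ?_)
  rw [Real.norm_eq_abs, abs_of_nonneg (integral_nonneg fun _ => norm_nonneg _)]
  exact abs_integral_mul_le_of_sq (hU2 p.1) (hU2 p.2) (hB p.1) (hB p.2)

lemma memLp_integral (hU : Measurable fun p : α × Ω => U p.1 p.2)
    (hU2 : ∀ x, MemLp (U x) 2 P) (hB : ∀ x, ∫ ω, U x ω ^ 2 ∂P ≤ B) :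
    MemLp (fun ω => ∫ x, U x ω ∂μ) 2 P := by
  have hm : AEStronglyMeasurable (fun ω => ∫ x, U x ω ∂μ) P :=
    (hU.stronglyMeasurable.integral_prod_left' (μ := μ)).aestronglyMeasurable
  rw [memLp_two_iff_integrable_sq hm]
  have := (integrable_mul_prod (μ := μ) hU hU2 hB).integral_prod_right
  refine this.congr (ae_of_all _ fun ω => ?_)
  simp only
  rw [integral_prod_mul (fun x => U x ω) (fun x => U x ω), sq]

lemma integral_integral_sq (hU : Measurable fun p : α × Ω => U p.1 p.2)
    (hU2 : ∀ x, MemLp (U x) 2 P) (hB : ∀ x, ∫ ω, U x ω ^ 2 ∂P ≤ B) :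
    ∫ ω, (∫ x, U x ω ∂μ) ^ 2 ∂P = ∫ x, ∫ y, ∫ ω, U x ω * U y ω ∂P ∂μ ∂μ := by
  have hi := integrable_mul_prod (μ := μ) hU hU2 hB
  have h1 := integral_integral_swap (f := fun (p : α × α) ω => U p.1 ω * U p.2 ω) hi
  rw [integral_prod _ hi.integral_prod_left] at h1
  simp only at h1
  rw [h1]
  refine integral_congr_ae (ae_of_all _ fun ω => ?_)
  simp only
  rw [integral_prod_mul (fun x => U x ω) (fun x => U x ω), sq]

lemma integrable_integral_mul (hU : Measurable fun p : α × Ω => U p.1 p.2)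
    (hU2 : ∀ x, MemLp (U x) 2 P) (hB : ∀ x, ∫ ω, U x ω ^ 2 ∂P ≤ B) :
    Integrable (fun p : α × α => ∫ ω, U p.1 ω * U p.2 ω ∂P) (μ.prod μ) :=
  (integrable_mul_prod hU hU2 hB).integral_prod_left

end SecondMoment

section Kernel

variable {d : ℕ}

lemma integrable_one_add_norm_pow :
    Integrable (fun x : EuclideanSpace ℝ (Fin d) => 1 / (1 + ‖x‖) ^ (d + 1)) volume := by
  have := integrable_one_add_norm (E := EuclideanSpace ℝ (Fin d)) (μ := volume)
    (r := (d + 1 : ℕ)) (by simp)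
  refine this.congr (ae_of_all _ fun x => ?_)
  simp only
  rw [Real.rpow_neg (by positivity), Real.rpow_natCast, one_div]

/-- Bound on the variance of an integral in terms of a polynomial covariance bound; the factor
`w` allows for small fields. -/
lemma integral_sq_setIntegral_le {Ω : Type*} [MeasurableSpace Ω] {P : Measure Ω}
    [IsProbabilityMeasure P] {U : EuclideanSpace ℝ (Fin d) → Ω → ℝ}
    (hU : Measurable fun p : EuclideanSpace ℝ (Fin d) × Ω => U p.1 p.2)
    (hU2 : ∀ x, MemLp (U x) 2 P) {w C : ℝ} (hw0 : 0 ≤ w)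
    (hw : ∀ x, ∫ ω, U x ω ^ 2 ∂P ≤ w ^ 2)
    (hC : ∀ x y, |∫ ω, U x ω * U y ω ∂P| ≤ C / (1 + dist x y) ^ (2 * (d + 1)))
    (V : Set (EuclideanSpace ℝ (Fin d))) (hV : volume V ≠ ∞) :
    ∫ ω, (∫ x in V, U x ω) ^ 2 ∂P ≤
      w * √C * (∫ x : EuclideanSpace ℝ (Fin d), 1 / (1 + ‖x‖) ^ (d + 1)) * volume.real V := by
  have : IsFiniteMeasure (volume.restrict V) := ⟨by simpa using hV.lt_top⟩
  rw [integral_integral_sq hU hU2 hw]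
  have hC0 : 0 ≤ C := by simpa using (abs_nonneg _).trans (hC 0 0)
  have hk : ∀ x y, ∫ ω, U x ω * U y ω ∂P ≤ w * √C * (1 / (1 + ‖x - y‖) ^ (d + 1)) := by
    intro x y
    have h1 : |∫ ω, U x ω * U y ω ∂P| ≤ w ^ 2 :=
      (abs_integral_le_integral_abs).trans
        (abs_integral_mul_le_of_sq (hU2 x) (hU2 y) (hw x) (hw y))
    have h2 := hC x y
    refine (le_abs_self _).trans (abs_le_of_sq_le_sq' ?_ (by positivity)).2
    calc |∫ ω, U x ω * U y ω ∂P| ^ 2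
        = |∫ ω, U x ω * U y ω ∂P| * |∫ ω, U x ω * U y ω ∂P| := sq _
      _ ≤ w ^ 2 * (C / (1 + dist x y) ^ (2 * (d + 1))) := by gcongr
      _ = (w * √C * (1 / (1 + ‖x - y‖) ^ (d + 1))) ^ 2 := by
        rw [mul_pow, mul_pow, Real.sq_sqrt hC0, dist_eq_norm, div_pow, one_pow, ← pow_mul,
          mul_comm (d + 1) 2]
        ring
  have hki : ∀ x : EuclideanSpace ℝ (Fin d),
      Integrable (fun y => 1 / (1 + ‖x - y‖) ^ (d + 1)) volume := fun x =>
    integrable_one_add_norm_pow.comp_sub_left x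
  have hinner : ∀ᵐ x ∂(volume.restrict V), ∫ y in V, ∫ ω, U x ω * U y ω ∂P ≤
      w * √C * ∫ x : EuclideanSpace ℝ (Fin d), 1 / (1 + ‖x‖) ^ (d + 1) := by
    filter_upwards [(integrable_integral_mul (μ := volume.restrict V) hU hU2 hw).prod_right_ae]
      with x hx
    calc _ ≤ ∫ y in V, w * √C * (1 / (1 + ‖x - y‖) ^ (d + 1)) :=
          integral_mono hx ((hki x).integrableOn.const_mul _) fun y => hk x y
      _ ≤ ∫ y, w * √C * (1 / (1 + ‖x - y‖) ^ (d + 1)) :=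
          setIntegral_le_integral ((hki x).const_mul _) (ae_of_all _ fun y => by positivity)
      _ = _ := by
        rw [integral_const_mul,
          integral_sub_left_eq_self (fun z : EuclideanSpace ℝ (Fin d) =>
            1 / (1 + ‖z‖) ^ (d + 1))]
  refine (integral_mono_ae
    (integrable_integral_mul (μ := volume.restrict V) hU hU2 hw).integral_prod_left
    (integrable_const _) hinner).trans ?_
  simp [mul_comm]

end Kernel

/-- A jointly measurable, sample-continuous, strictly stationary and rapidly mixing field. -/
structure IsMixingField {d : ℕ} {Ω : Type*} [MeasurableSpace Ω] (P : Measure Ω)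
    (Z : EuclideanSpace ℝ (Fin d) → Ω → ℝ) : Prop where
  jointly_measurable : Measurable fun p : EuclideanSpace ℝ (Fin d) × Ω => Z p.1 p.2
  sample_continuous : ∀ᵐ ω ∂P, Continuous fun x => Z x ω
  stationary : ∀ (x₀ : EuclideanSpace ℝ (Fin d)) (n : ℕ)
    (x : Fin n → EuclideanSpace ℝ (Fin d)),
    Measure.map (fun ω i => Z (x i + x₀) ω) P = Measure.map (fun ω i => Z (x i) ω) P
  mixing : HasPolyMixing P Z

namespace IsMixingField

variable {d : ℕ} {Ω : Type*} [MeasurableSpace Ω] {P : Measure Ω}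
  {Z : EuclideanSpace ℝ (Fin d) → Ω → ℝ}

lemma measurable (h : IsMixingField P Z) (x) : Measurable (Z x) :=
  h.jointly_measurable.comp measurable_prodMk_left

lemma map_pair (h : IsMixingField P Z) (x₀ x y : EuclideanSpace ℝ (Fin d)) :
    P.map (fun ω => (Z (x + x₀) ω, Z (y + x₀) ω)) = P.map fun ω => (Z x ω, Z y ω) := by
  have h1 := congrArg (Measure.map fun u : Fin 2 → ℝ => (u 0, u 1)) (h.stationary x₀ 2 ![x, y])
  rw [Measure.map_map (by fun_prop) (measurable_pi_lambda _ fun i => h.measurable _),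
    Measure.map_map (by fun_prop) (measurable_pi_lambda _ fun i => h.measurable _)] at h1
  exact h1

lemma integral_pair (h : IsMixingField P Z) (x₀ x y : EuclideanSpace ℝ (Fin d))
    {f : ℝ × ℝ → ℝ} (hf : Measurable f) :
    ∫ ω, f (Z (x + x₀) ω, Z (y + x₀) ω) ∂P = ∫ ω, f (Z x ω, Z y ω) ∂P := by
  rw [← integral_map (φ := fun ω => (Z (x + x₀) ω, Z (y + x₀) ω))
    ((h.measurable _).prodMk (h.measurable _)).aemeasurable hf.aestronglyMeasurable, h.map_pair,
    integral_map ((h.measurable _).prodMk (h.measurable _)).aemeasurable hf.aestronglyMeasurable]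

lemma integral_pair_sub (h : IsMixingField P Z) (x y : EuclideanSpace ℝ (Fin d))
    {f : ℝ × ℝ → ℝ} (hf : Measurable f) :
    ∫ ω, f (Z x ω, Z y ω) ∂P = ∫ ω, f (Z 0 ω, Z (y - x) ω) ∂P := by
  simpa using h.integral_pair x 0 (y - x) hf

lemma map_eq (h : IsMixingField P Z) (x : EuclideanSpace ℝ (Fin d)) :
    P.map (Z x) = P.map (Z 0) := by
  have h1 := congrArg (Measure.map Prod.fst) (h.map_pair x 0 0)
  rw [Measure.map_map measurable_fst ((h.measurable _).prodMk (h.measurable _)),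
    Measure.map_map measurable_fst ((h.measurable _).prodMk (h.measurable _)), zero_add] at h1
  exact h1

lemma integral_eq (h : IsMixingField P Z) (x : EuclideanSpace ℝ (Fin d))
    {f : ℝ → ℝ} (hf : Measurable f) : ∫ ω, f (Z x ω) ∂P = ∫ ω, f (Z 0 ω) ∂P := by
  rw [← integral_map (h.measurable x).aemeasurable hf.aestronglyMeasurable, h.map_eq,
    integral_map (h.measurable 0).aemeasurable hf.aestronglyMeasurable]

lemma integrable_iff (h : IsMixingField P Z) (x : EuclideanSpace ℝ (Fin d))
    {f : ℝ → ℝ} (hf : Measurable f) :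
    Integrable (fun ω => f (Z x ω)) P ↔ Integrable (fun ω => f (Z 0 ω)) P := by
  have h1 := integrable_map_measure (μ := P) hf.aestronglyMeasurable (h.measurable x).aemeasurable
  have h0 := integrable_map_measure (μ := P) hf.aestronglyMeasurable (h.measurable 0).aemeasurable
  rw [h.map_eq] at h1
  exact h1.symm.trans h0

lemma memLp_iff (h : IsMixingField P Z) (x : EuclideanSpace ℝ (Fin d))
    {f : ℝ → ℝ} (hf : Measurable f) (p : ℝ≥0∞) :
    MemLp (fun ω => f (Z x ω)) p P ↔ MemLp (fun ω => f (Z 0 ω)) p P := by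
  have h1 := memLp_map_measure_iff (μ := P) (p := p) hf.aestronglyMeasurable
    (h.measurable x).aemeasurable
  have h0 := memLp_map_measure_iff (μ := P) (p := p) hf.aestronglyMeasurable
    (h.measurable 0).aemeasurable
  rw [h.map_eq] at h1
  exact h1.symm.trans h0

/-- Continuity in `L²` at the origin of a function of the field. -/
lemma l2_continuous [IsProbabilityMeasure P] (h : IsMixingField P Z) {F : ℝ → ℝ}
    (hF : Measurable F) (hF2 : MemLp (fun ω => F (Z 0 ω)) 2 P) {ε : ℝ} (hε : 0 < ε) :
    ∃ ρ > 0, ∀ u : EuclideanSpace ℝ (Fin d), ‖u‖ ≤ ρ →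
      √(∫ ω, (F (Z u ω) - F (Z 0 ω)) ^ 2 ∂P) ≤ ε := by
  have hZ0 := (h.measurable 0).aemeasurable (μ := P)
  have : IsProbabilityMeasure (P.map (Z 0)) := Measure.isProbabilityMeasure_map hZ0
  have hFm : MemLp F 2 (P.map (Z 0)) :=
    (memLp_map_measure_iff hF.aestronglyMeasurable hZ0).2 hF2
  obtain ⟨g, hg, hg2⟩ := hFm.exists_boundedContinuous_eLpNorm_sub_le (by simp)
    (ε := ENNReal.ofReal (ε / 3)) (by simpa using by positivity)
  have hgm : Measurable g := g.continuous.measurable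
  have happ : ∀ u, √(∫ ω, (F (Z u ω) - g (Z u ω)) ^ 2 ∂P) ≤ ε / 3 := by
    intro u
    rw [h.integral_eq u (f := fun z => (F z - g z) ^ 2) ((hF.sub hgm).pow_const 2),
      ← integral_map (f := fun z => (F z - g z) ^ 2) hZ0
        ((hF.sub hgm).pow_const 2).aestronglyMeasurable]
    have e := (hFm.sub hg2).eLpNorm_eq_integral_rpow_norm two_ne_zero (by simp)
    rw [e, ENNReal.ofReal_le_ofReal_iff (by positivity)] at hg
    simpa [Real.sqrt_eq_rpow] using hg
  have hgL : ∀ u, MemLp (fun ω => g (Z u ω)) 2 P := fun u =>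
    MemLp.of_bound (hgm.comp (h.measurable u)).aestronglyMeasurable ‖g‖
      (ae_of_all _ fun ω => g.norm_coe_le_norm _)
  have hFL : ∀ u, MemLp (fun ω => F (Z u ω)) 2 P := fun u => (h.memLp_iff u hF 2).2 hF2
  have hlim : Tendsto (fun u => ∫ ω, (g (Z u ω) - g (Z 0 ω)) ^ 2 ∂P) (𝓝 0)
      (𝓝 (∫ _ω, (0 : ℝ) ∂P)) := by
    refine tendsto_integral_filter_of_dominated_convergence (fun _ => (2 * ‖g‖) ^ 2) ?_ ?_
      (integrable_const _) ?_
    · exact Eventually.of_forall fun u => (((hgm.comp (h.measurable u)).sub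
        (hgm.comp (h.measurable 0))).pow_const 2).aestronglyMeasurable
    · refine Eventually.of_forall fun u => ae_of_all _ fun ω => ?_
      rw [norm_pow]
      gcongr
      refine (norm_sub_le _ _).trans ?_
      have := g.norm_coe_le_norm (Z u ω)
      have := g.norm_coe_le_norm (Z 0 ω)
      linarith
    · filter_upwards [h.sample_continuous] with ω hω
      have : Continuous fun u => (g (Z u ω) - g (Z 0 ω)) ^ 2 := by
        have := g.continuous.comp hω
        fun_prop
      simpa using this.tendsto 0
  rw [integral_zero] at hlim
  obtain ⟨ρ, hρ, hρ'⟩ := Metric.eventually_nhds_iff_ball.1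
    (hlim.eventually (gt_mem_nhds (show 0 < (ε / 3) ^ 2 by positivity)))
  refine ⟨ρ / 2, by positivity, fun u hu => ?_⟩
  have hu' := (hρ' u (by simp; linarith)).le
  rw [← Real.sqrt_le_left (by positivity)] at hu'
  have s1 := sqrt_integral_add_sq_le ((hFL u).sub (hgL u)) ((hgL u).sub (hgL 0))
  have s2 := sqrt_integral_add_sq_le ((hFL u).sub (hgL 0)) ((hgL 0).sub (hFL 0))
  have s3 : √(∫ ω, (g (Z 0 ω) - F (Z 0 ω)) ^ 2 ∂P) ≤ ε / 3 := by
    refine le_of_eq_of_le ?_ (happ 0)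
    congr 2
    ext ω
    ring
  have h1 := happ u
  simp only [Pi.sub_apply, sub_add_sub_cancel] at s1 s2
  linarith

end IsMixingField

section Grid

variable {d : ℕ}

/-- The index of the half-open cube of side `h` containing a point. -/
def cellIdx (h : ℝ) (x : EuclideanSpace ℝ (Fin d)) : Fin d → ℤ := fun i => ⌊x i / h⌋

/-- The lower corner of the cube with a given index. -/
def gridPt (h : ℝ) (k : Fin d → ℤ) : EuclideanSpace ℝ (Fin d) :=
  WithLp.toLp 2 fun i => h * k i

lemma measurable_cellIdx (h : ℝ) : Measurable (cellIdx (d := d) h) :=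
  measurable_pi_lambda _ fun i => by
    have : Measurable fun x : EuclideanSpace ℝ (Fin d) => x i / h := by fun_prop
    exact this.floor

lemma measurableSet_cell (h : ℝ) (k : Fin d → ℤ) :
    MeasurableSet (cellIdx (d := d) h ⁻¹' {k}) :=
  measurable_cellIdx h (measurableSet_singleton k)

lemma measurable_gridPt (h : ℝ) : Measurable (gridPt (d := d) h) :=
  measurable_of_countable _

lemma sub_gridPt_mem {h : ℝ} (hh : 0 < h) (x : EuclideanSpace ℝ (Fin d)) (i : Fin d) :
    0 ≤ x i - gridPt h (cellIdx h x) i ∧ x i - gridPt h (cellIdx h x) i < h := by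
  have h1 := Int.floor_le (x i / h)
  have h2 := Int.lt_floor_add_one (x i / h)
  rw [le_div_iff₀ hh] at h1
  rw [div_lt_iff₀ hh] at h2
  simp only [gridPt, cellIdx]
  constructor <;> nlinarith

lemma norm_le_of_abs_le {x : EuclideanSpace ℝ (Fin d)} {a : ℝ} (ha : 0 ≤ a)
    (hx : ∀ i, |x i| ≤ a) : ‖x‖ ≤ a * √d := by
  rw [EuclideanSpace.norm_eq, Real.sqrt_le_left (by positivity), mul_pow,
    Real.sq_sqrt (by positivity)]
  calc ∑ i, ‖x i‖ ^ 2 ≤ ∑ i : Fin d, a ^ 2 := by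
        gcongr with i
        exact hx i
    _ = a ^ 2 * d := by simp [mul_comm]

lemma norm_sub_gridPt_le {h : ℝ} (hh : 0 < h) (x : EuclideanSpace ℝ (Fin d)) :
    ‖x - gridPt h (cellIdx h x)‖ ≤ h * √d := by
  refine norm_le_of_abs_le hh.le fun i => ?_
  obtain ⟨h1, h2⟩ := sub_gridPt_mem hh x i
  rw [PiLp.sub_apply, abs_of_nonneg h1]
  exact h2.le

lemma volume_cell {h : ℝ} (hh : 0 < h) (k : Fin d → ℤ) :
    volume (cellIdx (d := d) h ⁻¹' {k}) = ENNReal.ofReal (h ^ d) := by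
  have e : cellIdx (d := d) h ⁻¹' {k} = (WithLp.ofLp : EuclideanSpace ℝ (Fin d) → _) ⁻¹'
      (Set.univ.pi fun i => Set.Ico (h * k i) (h * k i + h)) := by
    ext x
    simp only [Set.mem_preimage, Set.mem_singleton_iff, Set.mem_pi, Set.mem_univ, true_imp_iff,
      Set.mem_Ico, funext_iff, cellIdx, Int.floor_eq_iff, le_div_iff₀ hh, div_lt_iff₀ hh]
    refine forall_congr' fun i => ?_
    rw [mul_comm h, add_mul, one_mul]
  rw [e, (PiLp.volume_preserving_ofLp (Fin d)).measure_preimage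
    (MeasurableSet.univ_pi fun _ => measurableSet_Ico).nullMeasurableSet, volume_pi_pi]
  simp [ENNReal.ofReal_pow hh.le]

lemma le_dist_gridPt {h : ℝ} (hh : 0 < h) {k l : Fin d → ℤ} {R : ℕ} {i : Fin d}
    (hi : (R : ℤ) ≤ |k i - l i|) : h * R ≤ dist (gridPt h k) (gridPt h l) := by
  rw [dist_eq_norm]
  refine le_trans ?_ (PiLp.norm_apply_le _ i)
  simp only [gridPt, PiLp.sub_apply, Real.norm_eq_abs, ← mul_sub, abs_mul, abs_of_pos hh]
  gcongr
  exact_mod_cast hi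

lemma inter_frontier_nonempty_of_isPreconnected {α : Type*} [TopologicalSpace α] {s V : Set α}
    (hs : IsPreconnected s) (h1 : (s ∩ V).Nonempty) (h2 : (s ∩ Vᶜ).Nonempty) :
    (s ∩ frontier V).Nonempty := by
  by_contra hne
  have hsub : s ⊆ interior V ∪ interior Vᶜ := by
    intro z hz
    have hzf : z ∉ frontier V := fun hf => hne ⟨z, hz, hf⟩
    rw [interior_compl]
    by_cases hi : z ∈ interior V
    · exact Or.inl hi
    · exact Or.inr fun hc => hzf ⟨hc, hi⟩
  have key : ∀ U : Set α, (s ∩ U).Nonempty → s ⊆ interior U ∪ interior Uᶜ →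
      (s ∩ interior U).Nonempty := by
    rintro U ⟨z, hz, hzU⟩ hsub
    exact ⟨z, hz, (hsub hz).resolve_right fun h => interior_subset h hzU⟩
  obtain ⟨z, -, hz1, hz2⟩ := hs _ _ isOpen_interior isOpen_interior hsub (key V h1 hsub)
    (key Vᶜ h2 (by rwa [compl_compl, Set.union_comm]))
  exact interior_subset hz2 (interior_subset hz1)

/-- A point of `V` is as close to the frontier as it is to any point outside `V`. -/
lemma infDist_frontier_le {V : Set (EuclideanSpace ℝ (Fin d))} {x y : EuclideanSpace ℝ (Fin d)}
    (hxy : ¬(x ∈ V ↔ y ∈ V)) : Metric.infDist x (frontier V) ≤ dist x y := by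
  have hne : ((segment ℝ x y) ∩ frontier V).Nonempty := by
    have hc : IsPreconnected (segment ℝ x y) := (convex_segment x y).isPreconnected
    by_cases hx : x ∈ V
    · have hy : y ∉ V := fun hy => hxy ⟨fun _ => hy, fun _ => hx⟩
      exact inter_frontier_nonempty_of_isPreconnected hc ⟨x, left_mem_segment ℝ x y, hx⟩
        ⟨y, right_mem_segment ℝ x y, hy⟩
    · have hy : y ∈ V := by tauto
      exact inter_frontier_nonempty_of_isPreconnected hc ⟨y, right_mem_segment ℝ x y, hy⟩
        ⟨x, left_mem_segment ℝ x y, hx⟩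
  obtain ⟨z, hz, hzV⟩ := hne
  refine (Metric.infDist_le_dist_of_mem hzV).trans ?_
  have := dist_add_dist_of_mem_segment hz
  linarith [dist_nonneg (x := z) (y := y)]

end Grid

section Coarse

lemma add_three_rpow_le {a b c p : ℝ} (ha : 0 ≤ a) (hb : 0 ≤ b) (hc : 0 ≤ c) (hp : 0 ≤ p) :
    (a + b + c) ^ p ≤ 3 ^ p * (a ^ p + b ^ p + c ^ p) := by
  have key : ∀ t, 0 ≤ t → a ≤ t → b ≤ t → c ≤ t → t ^ p ≤ a ^ p + b ^ p + c ^ p →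
      (a + b + c) ^ p ≤ 3 ^ p * (a ^ p + b ^ p + c ^ p) := by
    intro t ht h1 h2 h3 h4
    calc (a + b + c) ^ p ≤ (3 * t) ^ p := Real.rpow_le_rpow (by positivity) (by linarith) hp
      _ = 3 ^ p * t ^ p := Real.mul_rpow (by norm_num) ht
      _ ≤ _ := by gcongr
  have a0 : 0 ≤ a ^ p := by positivity
  have b0 : 0 ≤ b ^ p := by positivity
  have c0 : 0 ≤ c ^ p := by positivity
  rcases le_total a b with h1 | h1 <;> rcases le_total b c with h2 | h2 <;>
    rcases le_total a c with h3 | h3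
  · exact key c hc h3 h2 le_rfl (by linarith)
  · exact key c hc (h1.trans h2) h2 le_rfl (by linarith)
  · exact key b hb h1 le_rfl h2 (by linarith)
  · exact key b hb h1 le_rfl h2 (by linarith)
  · exact key c hc h3 h2 le_rfl (by linarith)
  · exact key a ha le_rfl h1 h3 (by linarith)
  · exact key a ha le_rfl h1 (h2.trans h1) (by linarith)
  · exact key a ha le_rfl h1 h3 (by linarith)

variable {d : ℕ} {Ω : Type*} [MeasurableSpace Ω] {P : Measure Ω} [IsProbabilityMeasure P]
  {Z : EuclideanSpace ℝ (Fin d) → Ω → ℝ}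

lemma integral_sub_mean_sq_le {X : Ω → ℝ} (hX : MemLp X 2 P) :
    ∫ ω, (X ω - ∫ ω', X ω' ∂P) ^ 2 ∂P ≤ ∫ ω, X ω ^ 2 ∂P := by
  have := variance_le_expectation_sq hX.aestronglyMeasurable
  rwa [variance_eq_integral hX.aemeasurable] at this

/-- Coarse-graining: the integral of the field is `L²`-close to that of a bounded function of the
field, frozen on the cells of a cubic grid. -/
lemma IsMixingField.exists_coarse_approx (h : IsMixingField P Z) {δ : ℝ} (hδ : 0 < δ) {F : ℝ → ℝ}
    (hF : Measurable F) (hFi : Integrable (fun ω => |F (Z 0 ω)| ^ (2 + δ)) P)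
    (hF0 : ∫ ω, F (Z 0 ω) ∂P = 0) {ε : ℝ} (hε : 0 < ε) :
    ∃ (G : ℝ → ℝ) (K s : ℝ), Measurable G ∧ 0 < K ∧ (∀ u, |G u| ≤ K) ∧
      ∫ ω, G (Z 0 ω) ∂P = 0 ∧ 0 < s ∧ ∀ V : Set (EuclideanSpace ℝ (Fin d)), volume V ≠ ∞ →
        MemLp (fun ω => ∫ x in V, (F (Z x ω) - G (Z (gridPt s (cellIdx s x)) ω))) 2 P ∧
        ∫ ω, (∫ x in V, (F (Z x ω) - G (Z (gridPt s (cellIdx s x)) ω))) ^ 2 ∂P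
          ≤ ε * volume.real V := by
  set M₁ := ∫ ω, |F (Z 0 ω)| ^ (2 + δ) ∂P with hM₁
  have hM₁0 : 0 ≤ M₁ := integral_nonneg fun _ => by positivity
  set m := ∫ ω, |F (Z 0 ω)| ∂P with hm
  have hm0 : 0 ≤ m := integral_nonneg fun _ => abs_nonneg _
  obtain ⟨C, hC0, hC⟩ := h.mixing.exists_abs_cov_le h.measurable hδ (2 * (d + 1))
    (3 ^ (2 + δ) * (M₁ + M₁ + m ^ (2 + δ)))
  set C' := C * 3 ^ (2 * (d + 1)) with hC'
  set κ := ∫ x : EuclideanSpace ℝ (Fin d), 1 / (1 + ‖x‖) ^ (d + 1)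
  have hκ : 0 ≤ κ := integral_nonneg fun _ => by positivity
  set w := ε / (√C' * κ + 1) with hw
  have hw0 : 0 < w := by positivity
  have hwε : w * √C' * κ ≤ ε := by
    have : w * (√C' * κ + 1) = ε := div_mul_cancel₀ _ (by positivity)
    nlinarith
  -- truncation level
  set K := (M₁ / (w / 2) ^ 2 + 1) ^ (1 / δ) with hK
  have hK0 : 0 < K := by positivity
  have hKδ : K ^ δ = M₁ / (w / 2) ^ 2 + 1 := by
    rw [hK, ← Real.rpow_mul (by positivity), one_div_mul_cancel hδ.ne', Real.rpow_one]
  have hFm : ∀ x, AEStronglyMeasurable (fun ω => F (Z x ω)) P := fun x =>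
    (hF.comp (h.measurable x)).aestronglyMeasurable
  have hF2 : ∀ x, MemLp (fun ω => F (Z x ω)) 2 P := fun x =>
    (h.memLp_iff x hF 2).2 (memLp_two_of_moment hδ (hFm 0) hFi)
  have hcl : ∀ x, MemLp (fun ω => clamp K (F (Z x ω))) 2 P := fun x => memLp_clamp (hFm x) hK0.le 2
  have hclm : Measurable fun u => clamp K (F u) := (continuous_clamp K).measurable.comp hF
  -- mesh of the grid
  obtain ⟨ρ, hρ, hρ'⟩ := h.l2_continuous hF (hF2 0) (half_pos hw0)
  set s := min ρ 1 / (√d + 1) with hs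
  have hs0 : 0 < s := by positivity
  have hsd : s * √d ≤ min ρ 1 := by
    have : s * (√d + 1) = min ρ 1 := div_mul_cancel₀ _ (by positivity)
    nlinarith
  set b := ∫ ω, clamp K (F (Z 0 ω)) ∂P with hb
  have hbm : |b| ≤ m := by
    refine abs_integral_le_integral_abs.trans (integral_mono
      ((hcl 0).integrable one_le_two).abs ((hF2 0).integrable one_le_two).abs fun ω => ?_)
    exact abs_clamp_le_abs hK0.le _
  have hbK : |b| ≤ K := by
    have := norm_integral_le_of_norm_le_const (μ := P) (f := fun ω => clamp K (F (Z 0 ω)))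
      (C := K) (ae_of_all _ fun ω => abs_clamp_le hK0.le _)
    simpa using this
  set G : ℝ → ℝ := fun u => clamp K (F u) - b with hG
  have hGm : Measurable G := hclm.sub_const b
  have hG2 : ∀ x, MemLp (fun ω => G (Z x ω)) 2 P := fun x => (hcl x).sub (memLp_const b)
  have hG0 : ∀ x, ∫ ω, G (Z x ω) ∂P = 0 := by
    intro x
    rw [h.integral_eq x hGm]
    simp only [hG]
    rw [integral_sub ((hcl 0).integrable one_le_two) (integrable_const _)]
    simp [hb]
  set π : EuclideanSpace ℝ (Fin d) → EuclideanSpace ℝ (Fin d) := fun x => gridPt s (cellIdx s x)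
    with hπ
  have hπm : Measurable π := (measurable_gridPt s).comp (measurable_cellIdx s)
  have hπd : ∀ x, ‖x - π x‖ ≤ min ρ 1 := fun x => (norm_sub_gridPt_le hs0 x).trans hsd
  set U : EuclideanSpace ℝ (Fin d) → Ω → ℝ := fun x ω => F (Z x ω) - G (Z (π x) ω) with hU
  have hUm : Measurable fun p : EuclideanSpace ℝ (Fin d) × Ω => U p.1 p.2 :=
    (hF.comp h.jointly_measurable).sub (hGm.comp (h.jointly_measurable.comp
      ((hπm.comp measurable_fst).prodMk measurable_snd)))
  have hU2 : ∀ x, MemLp (U x) 2 P := fun x => (hF2 x).sub (hG2 (π x))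
  have hU0 : ∀ x, ∫ ω, U x ω ∂P = 0 := by
    intro x
    simp only [hU]
    rw [integral_sub ((hF2 x).integrable one_le_two) ((hG2 _).integrable one_le_two), hG0,
      h.integral_eq x hF, hF0, sub_zero]
  have hUw : ∀ x, ∫ ω, U x ω ^ 2 ∂P ≤ w ^ 2 := by
    intro x
    rw [← Real.sqrt_le_left hw0.le]
    have s1 := sqrt_integral_add_sq_le ((hF2 x).sub (hG2 x)) ((hG2 x).sub (hG2 (π x)))
    simp only [Pi.sub_apply, sub_add_sub_cancel] at s1
    have s2 : √(∫ ω, (F (Z x ω) - G (Z x ω)) ^ 2 ∂P) ≤ w / 2 := by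
      rw [Real.sqrt_le_left (by positivity),
        h.integral_eq x (f := fun u => (F u - G u) ^ 2) ((hF.sub hGm).pow_const 2)]
      have hA : MemLp (fun ω => F (Z 0 ω) - clamp K (F (Z 0 ω))) 2 P := (hF2 0).sub (hcl 0)
      have e : ∫ ω, (F (Z 0 ω) - clamp K (F (Z 0 ω))) ∂P = -b := by
        rw [integral_sub ((hF2 0).integrable one_le_two) ((hcl 0).integrable one_le_two), hF0,
          zero_sub]
      have h1 := integral_sub_mean_sq_le hA
      rw [e] at h1
      refine le_trans (le_of_eq ?_) (h1.trans
        ((integral_sub_clamp_sq_le hδ hK0 (hFm 0) hFi).trans ?_))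
      · refine integral_congr_ae (ae_of_all _ fun ω => ?_)
        simp only [hG]
        ring
      · rw [hKδ, div_le_iff₀ (by positivity), mul_add, mul_div_cancel₀ _ (by positivity)]
        have : 0 ≤ (w / 2) ^ 2 := by positivity
        linarith
    have s3 : √(∫ ω, (G (Z x ω) - G (Z (π x) ω)) ^ 2 ∂P) ≤ w / 2 := by
      refine le_trans (Real.sqrt_le_sqrt ?_) (hρ' (x - π x) ((hπd x).trans (min_le_left _ _)))
      have e := h.integral_pair (π x) (x - π x) 0 (f := fun p => (F p.1 - F p.2) ^ 2)
        (((hF.comp measurable_fst).sub (hF.comp measurable_snd)).pow_const 2)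
      simp only [sub_add_cancel, zero_add] at e
      rw [← e]
      refine integral_mono ((hG2 x).sub (hG2 _)).integrable_sq
        ((hF2 x).sub (hF2 _)).integrable_sq fun ω => ?_
      simp only [hG, sub_sub_sub_cancel_right]
      exact sq_le_sq.2 (abs_clamp_sub_clamp_le K _ _)
    exact s1.trans (by linarith)
  have hUi : ∀ x, Integrable (fun ω => |U x ω| ^ (2 + δ)) P ∧
      ∫ ω, |U x ω| ^ (2 + δ) ∂P ≤ 3 ^ (2 + δ) * (M₁ + M₁ + m ^ (2 + δ)) := by
    intro x
    have hp : Measurable fun u => |F u| ^ (2 + δ) := by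
      have := hF.norm
      exact this.pow_const _
    have i1 : ∀ x, Integrable (fun ω => |F (Z x ω)| ^ (2 + δ)) P := fun x =>
      (h.integrable_iff x hp).2 hFi
    have e1 : ∀ x, ∫ ω, |F (Z x ω)| ^ (2 + δ) ∂P = M₁ := fun x => h.integral_eq x hp
    have i2 : Integrable (fun ω => 3 ^ (2 + δ) * (|F (Z x ω)| ^ (2 + δ) +
        |F (Z (π x) ω)| ^ (2 + δ) + m ^ (2 + δ))) P :=
      (((i1 x).add (i1 (π x))).add (integrable_const _)).const_mul _
    have hle : ∀ ω, |U x ω| ^ (2 + δ) ≤ 3 ^ (2 + δ) * (|F (Z x ω)| ^ (2 + δ) +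
        |F (Z (π x) ω)| ^ (2 + δ) + m ^ (2 + δ)) := by
      intro ω
      refine le_trans ?_ (add_three_rpow_le (abs_nonneg _) (abs_nonneg _) hm0 (by positivity))
      refine Real.rpow_le_rpow (abs_nonneg _) ?_ (by positivity)
      have t1 := abs_clamp_le_abs hK0.le (F (Z (π x) ω))
      have t2 : |U x ω| ≤ |F (Z x ω)| + |G (Z (π x) ω)| := abs_sub _ _
      have t3 : |G (Z (π x) ω)| ≤ |clamp K (F (Z (π x) ω))| + |b| := abs_sub _ _
      linarith
    have i3 : Integrable (fun ω => |U x ω| ^ (2 + δ)) P := by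
      refine i2.mono' ?_ (ae_of_all _ fun ω => ?_)
      · have : Measurable fun ω => |U x ω| :=
          (hUm.comp measurable_prodMk_left).norm
        exact (this.pow_const _).aestronglyMeasurable
      · rw [Real.norm_eq_abs, abs_of_nonneg (by positivity)]
        exact hle ω
    refine ⟨i3, (integral_mono i3 i2 hle).trans_eq ?_⟩
    have i4 : Integrable (fun ω => |F (Z x ω)| ^ (2 + δ) + |F (Z (π x) ω)| ^ (2 + δ)) P :=
      (i1 x).add (i1 (π x))
    rw [integral_const_mul, integral_add i4 (integrable_const _), integral_add (i1 x) (i1 _), e1,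
      e1]
    simp
  refine ⟨G, 2 * K, s, hGm, by positivity, fun u => ?_, hG0 0, hs0, fun V hV => ?_⟩
  · have := abs_clamp_le hK0.le (F u)
    exact (abs_sub _ _).trans (by linarith)
  have : IsFiniteMeasure (volume.restrict V) := ⟨by simpa using hV.lt_top⟩
  refine ⟨memLp_integral hUm hU2 hUw, ?_⟩
  refine (integral_sq_setIntegral_le hUm hU2 hw0.le hUw (C := C') ?_ V hV).trans ?_
  · intro x y
    have hr : 0 ≤ max 0 (dist x y - 2) := le_max_left _ _
    have hd : ∀ i j : Fin 2, max 0 (dist x y - 2) ≤ dist (![x, π x] i) (![y, π y] j) := by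
      have b1 : ∀ i : Fin 2, dist x (![x, π x] i) ≤ 1 := by
        intro i
        fin_cases i
        · simp
        · simpa [dist_eq_norm] using (hπd x).trans (min_le_right _ _)
      have b2 : ∀ i : Fin 2, dist (![y, π y] i) y ≤ 1 := by
        intro i
        fin_cases i
        · simp
        · rw [dist_comm]
          simpa [dist_eq_norm] using (hπd y).trans (min_le_right _ _)
      intro i j
      refine max_le dist_nonneg ?_
      have := dist_triangle4 x (![x, π x] i) (![y, π y] j) y
      linarith [b1 i, b2 j]
    have hfm : Measurable fun u : Fin 2 → ℝ => F (u 0) - G (u 1) :=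
      (hF.comp (measurable_pi_apply 0)).sub (hGm.comp (measurable_pi_apply 1))
    have hc := hC (Fin 2) (Fin 2) ![x, π x] ![y, π y] _ (by simp) (by simp) hr hd
      (fun u => F (u 0) - G (u 1)) (fun u => F (u 0) - G (u 1)) hfm hfm
      (hUi x).1 (hUi y).1 (hUi x).2 (hUi y).2
    have e : cov P (U x) (U y) = ∫ ω, U x ω * U y ω ∂P := by
      rw [cov, hU0, zero_mul, sub_zero]
    rw [← e]
    refine le_trans hc ?_
    rw [div_le_div_iff₀ (by positivity) (by positivity), hC', mul_assoc, ← mul_pow]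
    gcongr
    rcases le_total (dist x y) 2 with h2 | h2
    · rw [max_eq_left (by linarith)]; linarith
    · rw [max_eq_right (by linarith)]; linarith
  · exact mul_le_mul_of_nonneg_right hwε measureReal_nonneg

end Coarse

section VarianceLimit

variable {d : ℕ}

lemma volume_infDist_frontier_ne_top {V : Set (EuclideanSpace ℝ (Fin d))}
    (hb : Bornology.IsBounded V) (h0 : volume V ≠ 0) (r : ℝ) :
    volume {x | Metric.infDist x (frontier V) ≤ r} ≠ ∞ := by
  by_cases hne : (frontier V).Nonempty
  · have hfb : Bornology.IsBounded (frontier V) :=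
      hb.closure.subset frontier_subset_closure
    refine ((hfb.cthickening (δ := r)).subset fun x hx => ?_).measure_lt_top.ne
    rw [Metric.mem_cthickening_iff, ← ENNReal.ofReal_toReal (Metric.infEDist_ne_top hne)]
    exact ENNReal.ofReal_le_ofReal hx
  · have hcl : IsClopen V := isClopen_iff_frontier_eq_empty.2 (Set.not_nonempty_iff_eq_empty.1 hne)
    rcases isClopen_iff.1 hcl with h | h
    · simp [h] at h0
    · exact (hb.subset (h ▸ Set.subset_univ _)).measure_lt_top.ne

lemma abs_setIntegral_setIntegral_sub_le {c : EuclideanSpace ℝ (Fin d) → ℝ}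
    (hc : Integrable c volume) {V : Set (EuclideanSpace ℝ (Fin d))} (hV : MeasurableSet V)
    (hVf : volume V ≠ ∞) (hint : IntegrableOn (fun x => ∫ y in V, c (y - x)) V volume) {r : ℝ}
    (hNf : volume {x | Metric.infDist x (frontier V) ≤ r} ≠ ∞) :
    |(∫ x in V, ∫ y in V, c (y - x)) - volume.real V * ∫ u, c u| ≤
      (∫ u, |c u|) * volume.real {x | Metric.infDist x (frontier V) ≤ r} +
        (∫ u in {u | r < ‖u‖}, |c u|) * volume.real V := by
  set N := {x | Metric.infDist x (frontier V) ≤ r} with hN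
  have hNm : MeasurableSet N :=
    measurableSet_le (Metric.continuous_infDist_pt _).measurable measurable_const
  have hT : MeasurableSet {u : EuclideanSpace ℝ (Fin d) | r < ‖u‖} :=
    measurableSet_lt measurable_const measurable_norm
  set τ := ∫ u in {u | r < ‖u‖}, |c u| with hτ
  have hτ0 : 0 ≤ τ := integral_nonneg fun _ => abs_nonneg _
  have : IsFiniteMeasure (volume.restrict V) := ⟨by simpa using hVf.lt_top⟩
  have hca := hc.abs
  have key : ∀ x ∈ V, |(∫ y in V, c (y - x)) - ∫ u, c u| ≤
      N.indicator (fun _ => ∫ u, |c u|) x + τ := by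
    intro x hx
    have hs := hc.comp_sub_right x
    have hsa := hca.comp_sub_right x
    have e1 : ∫ u, c u = (∫ y in V, c (y - x)) + ∫ y in Vᶜ, c (y - x) := by
      rw [integral_add_compl hV hs, integral_sub_right_eq_self c x]
    have e2 : |∫ y in Vᶜ, c (y - x)| ≤ ∫ y in Vᶜ, |c (y - x)| := abs_integral_le_integral_abs
    rw [e1, sub_add_cancel_left, abs_neg]
    refine e2.trans ?_
    by_cases hxN : x ∈ N
    · rw [Set.indicator_of_mem hxN, ← integral_sub_right_eq_self (fun u => |c u|) x]
      have := setIntegral_le_integral (s := Vᶜ) hsa (ae_of_all _ fun _ => abs_nonneg _)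
      linarith
    · rw [Set.indicator_of_notMem hxN, zero_add, hτ, ← integral_indicator hT,
        
        ← integral_sub_right_eq_self (μ := volume) ({u | r < ‖u‖}.indicator fun u => |c u|) x,
        ← integral_indicator hV.compl]
      refine integral_mono (hsa.indicator hV.compl) ?_ fun y => ?_
      · exact (hca.indicator hT).comp_sub_right x
      · by_cases hy : y ∈ V
        · rw [Set.indicator_of_notMem (by simpa using hy)]
          exact Set.indicator_nonneg (fun _ _ => abs_nonneg _) _
        · have hd := infDist_frontier_le (x := x) (y := y) (V := V) (by tauto)
          have hr : r < ‖y - x‖ := by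
            rw [hN, Set.mem_ofPred_eq, not_le] at hxN
            rw [← dist_eq_norm, dist_comm]
            exact hxN.trans_le hd
          rw [Set.indicator_of_mem (show y ∈ Vᶜ from hy),
            Set.indicator_of_mem (show y - x ∈ {u | r < ‖u‖} from hr)]
  have hci : Integrable (fun _ : EuclideanSpace ℝ (Fin d) => ∫ u, c u) (volume.restrict V) :=
    integrable_const _
  have e3 : (∫ x in V, ∫ y in V, c (y - x)) - volume.real V * ∫ u, c u =
      ∫ x in V, ((∫ y in V, c (y - x)) - ∫ u, c u) := by
    rw [integral_sub hint hci]
    simp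
  have hbi1 : Integrable (fun x => N.indicator (fun _ => ∫ u, |c u|) x) (volume.restrict V) :=
    (integrable_const _).indicator hNm
  have hbi : Integrable (fun x => N.indicator (fun _ => ∫ u, |c u|) x + τ) (volume.restrict V) :=
    hbi1.add (integrable_const τ)
  have h := norm_integral_le_of_norm_le hbi
    (f := fun x => (∫ y in V, c (y - x)) - ∫ u, c u) ((ae_restrict_iff' hV).2 (ae_of_all _ key))
  rw [e3]
  refine h.trans ?_
  have hmono : volume.real (N ∩ V) ≤ volume.real N := measureReal_mono Set.inter_subset_left hNf
  have hc0 : 0 ≤ ∫ u, |c u| := integral_nonneg fun _ => abs_nonneg _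
  rw [integral_add hbi1 (integrable_const τ), integral_indicator_const _ hNm]
  simp only [integral_const, smul_eq_mul, measureReal_restrict_apply hNm,
    measureReal_restrict_apply MeasurableSet.univ, Set.univ_inter]
  nlinarith

variable {Ω : Type*} [MeasurableSpace Ω] {P : Measure Ω} [IsProbabilityMeasure P]
  {Z : EuclideanSpace ℝ (Fin d) → Ω → ℝ} {F : ℝ → ℝ} {δ : ℝ}

lemma IsMixingField.integrable_integral_mul (h : IsMixingField P Z) (hδ : 0 < δ)
    (hF : Measurable F) (hFi : Integrable (fun ω => |F (Z 0 ω)| ^ (2 + δ)) P)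
    (hF0 : ∫ ω, F (Z 0 ω) ∂P = 0) :
    Integrable (fun u => ∫ ω, F (Z 0 ω) * F (Z u ω) ∂P) volume := by
  obtain ⟨C, hC0, hC⟩ := h.mixing.exists_abs_cov_le h.measurable hδ (d + 1)
    (∫ ω, |F (Z 0 ω)| ^ (2 + δ) ∂P)
  have hFm : Measurable fun u => |F u| ^ (2 + δ) := by fun_prop
  have hm : StronglyMeasurable fun u => ∫ ω, F (Z 0 ω) * F (Z u ω) ∂P := by
    have : Measurable fun p : EuclideanSpace ℝ (Fin d) × Ω => F (Z 0 p.2) * F (Z p.1 p.2) :=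
      (hF.comp ((h.measurable 0).comp measurable_snd)).mul (hF.comp h.jointly_measurable)
    exact this.stronglyMeasurable.integral_prod_right
  refine (integrable_one_add_norm_pow.const_mul C).mono' hm.aestronglyMeasurable
    (ae_of_all _ fun u => ?_)
  have := hC Unit Unit (fun _ => 0) (fun _ => u) ‖u‖ (by simp) (by simp) (norm_nonneg _)
    (fun _ _ => by simp) (fun v => F (v ())) (fun v => F (v ())) (by fun_prop) (by fun_prop)
    hFi ((h.integrable_iff u hFm).2 hFi) le_rfl (h.integral_eq u hFm).le
  simp only [cov, h.integral_eq u hF, hF0, mul_zero, sub_zero] at this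
  rw [Real.norm_eq_abs, mul_one_div]
  exact this

lemma IsMixingField.tendsto_variance (h : IsMixingField P Z) (hδ : 0 < δ)
    (hF : Measurable F) (hFi : Integrable (fun ω => |F (Z 0 ω)| ^ (2 + δ)) P)
    (hF0 : ∫ ω, F (Z 0 ω) ∂P = 0) {V : ℕ → Set (EuclideanSpace ℝ (Fin d))} (hV : IsVanHove V) :
    Tendsto (fun n => (∫ ω, (∫ x in V n, F (Z x ω)) ^ 2 ∂P) / volume.real (V n)) atTop
      (𝓝 (∫ u, ∫ ω, F (Z 0 ω) * F (Z u ω) ∂P)) := by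
  obtain ⟨hVb, hVm, -, -, hVinf, hVN⟩ := hV
  set c := fun u => ∫ ω, F (Z 0 ω) * F (Z u ω) ∂P with hcdef
  have hc : Integrable c volume := h.integrable_integral_mul hδ hF hFi hF0
  have hF2 : ∀ x, MemLp (fun ω => F (Z x ω)) 2 P := fun x => (h.memLp_iff x hF 2).2
    (memLp_two_of_moment hδ (hF.comp (h.measurable 0)).aestronglyMeasurable hFi)
  have hU : Measurable fun p : EuclideanSpace ℝ (Fin d) × Ω => F (Z p.1 p.2) :=
    hF.comp h.jointly_measurable
  have hB : ∀ x, ∫ ω, F (Z x ω) ^ 2 ∂P ≤ ∫ ω, F (Z 0 ω) ^ 2 ∂P := fun x =>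
    (h.integral_eq x (f := fun u => F u ^ 2) (by fun_prop)).le
  have hcov : ∀ x y, ∫ ω, F (Z x ω) * F (Z y ω) ∂P = c (y - x) := fun x y =>
    h.integral_pair_sub x y (f := fun p => F p.1 * F p.2) (by fun_prop)
  have hVf : ∀ n, volume (V n) ≠ ∞ := fun n => (hVb n).measure_lt_top.ne
  have hbound : ∀ r, 0 < r → ∀ n, 0 < volume.real (V n) →
      |(∫ ω, (∫ x in V n, F (Z x ω)) ^ 2 ∂P) / volume.real (V n) - ∫ u, c u| ≤
      (∫ u, |c u|) * ((volume {x | Metric.infDist x (frontier (V n)) ≤ r}).toReal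
        / (volume (V n)).toReal) + ∫ u in {u | r < ‖u‖}, |c u| := by
    intro r hr n hn
    have : IsFiniteMeasure (volume.restrict (V n)) := ⟨by simpa using (hVf n).lt_top⟩
    have e := integral_integral_sq (μ := volume.restrict (V n)) hU hF2 hB
    have hi := (_root_.integrable_integral_mul (μ := volume.restrict (V n)) hU hF2 hB)
    have hi2 : Integrable (fun x => ∫ y in V n, ∫ ω, F (Z x ω) * F (Z y ω) ∂P)
      (volume.restrict (V n)) := hi.integral_prod_left
    simp only [hcov] at e hi2
    have key := abs_setIntegral_setIntegral_sub_le hc (hVm n) (hVf n) hi2 (r := r)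
      (volume_infDist_frontier_ne_top (hVb n) (fun h0 => by simp [Measure.real, h0] at hn) r)
    rw [← e] at key
    rw [← mul_div_assoc]
    change _ ≤ _ / volume.real (V n) + _
    rw [div_add' _ _ _ hn.ne', le_div_iff₀ hn]
    calc _ = _ := by rw [← abs_of_pos hn, ← abs_mul, abs_of_pos hn, sub_mul,
                      div_mul_cancel₀ _ hn.ne', mul_comm (∫ u, c u)]
      _ ≤ _ := key
  have hτ : Tendsto (fun k : ℕ => ∫ u in {u : EuclideanSpace ℝ (Fin d) | (k : ℝ) < ‖u‖}, |c u|)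
      atTop (𝓝 0) := by
    have := tendsto_setIntegral_of_antitone (μ := volume) (f := fun u => |c u|)
      (s := fun k : ℕ => {u : EuclideanSpace ℝ (Fin d) | (k : ℝ) < ‖u‖})
      (fun k => measurableSet_lt measurable_const measurable_norm)
      (fun i j hij u (hu : (j : ℝ) < ‖u‖) => (Nat.cast_le.2 hij).trans_lt hu)
      ⟨0, hc.abs.integrableOn⟩
    have he : ⋂ k : ℕ, {u : EuclideanSpace ℝ (Fin d) | (k : ℝ) < ‖u‖} = ∅ := by
      ext u
      obtain ⟨k, hk⟩ := exists_nat_ge ‖u‖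
      simp only [Set.mem_iInter, Set.mem_ofPred_eq, Set.mem_empty_iff_false, iff_false, not_forall]
      exact ⟨k, not_lt.2 hk⟩
    simpa [he] using this
  rw [Metric.tendsto_atTop']
  intro ε hε
  obtain ⟨k, hk, hk0⟩ := ((hτ.eventually (gt_mem_nhds (half_pos hε))).and
    (eventually_gt_atTop 0)).exists
  have h2 : Tendsto (fun n => (∫ u, |c u|) * ((volume {x | Metric.infDist x (frontier (V n)) ≤
      (k : ℝ)}).toReal / (volume (V n)).toReal)) atTop (𝓝 0) := by
    simpa using (hVN k (by exact_mod_cast hk0)).const_mul (∫ u, |c u|)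
  obtain ⟨n₀, hn₀⟩ := eventually_atTop.1 ((h2.eventually (gt_mem_nhds (half_pos hε))).and
    (hVinf.eventually_gt_atTop 0))
  refine ⟨n₀, fun n hn => ?_⟩
  obtain ⟨h3, h4⟩ := hn₀ n hn.le
  rw [Real.dist_eq]
  have := hbound k (by exact_mod_cast hk0) n h4
  linarith

end VarianceLimit

section SteinMethod

open Complex in
lemma norm_exp_mul_I_sub_one_sub_le (x : ℝ) : ‖exp (x * I) - 1 - x * I‖ ≤ 3 * x ^ 2 := by
  have hx : ‖(x * I : ℂ)‖ = |x| := by simp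
  rcases le_total |x| 1 with h | h
  · have := norm_exp_sub_one_sub_id_le (x := x * I) (hx.trans_le h)
    rw [hx, sq_abs] at this
    nlinarith [sq_nonneg x]
  · have h1 := norm_sub_le (exp (x * I) - 1) (x * I)
    have h2 := norm_sub_le (exp (x * I)) 1
    rw [norm_exp_ofReal_mul_I, norm_one] at h2
    rw [hx] at h1
    nlinarith [sq_abs x]

variable {Ω : Type*} [MeasurableSpace Ω] {P : Measure Ω} [IsProbabilityMeasure P]

open Complex in
lemma integrable_ofReal_mul_exp {X Y : Ω → ℝ} (hX : Measurable X) (hY : Measurable Y) {B : ℝ}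
    (hB : ∀ ω, |X ω| ≤ B) : Integrable (fun ω => (X ω : ℂ) * exp (Y ω * I)) P := by
  refine Integrable.of_bound (by fun_prop) B (ae_of_all _ fun ω => ?_)
  rw [norm_mul, norm_exp_ofReal_mul_I, mul_one, norm_real]
  exact hB ω

open Complex in
lemma hasDerivAt_integral_exp {S : Ω → ℝ} (hS : Measurable S) {B : ℝ} (hB : ∀ ω, |S ω| ≤ B)
    (u : ℝ) : HasDerivAt (fun u : ℝ => ∫ ω, exp ((u * S ω : ℝ) * I) ∂P)
      (∫ ω, S ω * exp ((u * S ω : ℝ) * I) * I ∂P) u := by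
  have hd : ∀ ω (v : ℝ), HasDerivAt (fun v : ℝ => exp ((v * S ω : ℝ) * I))
      (S ω * exp ((v * S ω : ℝ) * I) * I) v := by
    intro ω v
    have h1 : HasDerivAt (fun v : ℝ => ((v * S ω : ℝ) : ℂ) * I) (S ω * I) v := by
      have := ((hasDerivAt_id v).mul_const (S ω)).ofReal_comp
      simpa using this.mul_const I
    convert h1.cexp using 1
    ring
  refine (hasDerivAt_integral_of_dominated_loc_of_deriv_le (bound := fun _ => B) univ_mem
    (Eventually.of_forall fun v => ?_) ?_ ?_ (ae_of_all _ fun ω v _ => ?_) (integrable_const B)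
    (ae_of_all _ fun ω v _ => hd ω v)).2
  · exact Measurable.aestronglyMeasurable (by fun_prop)
  · simpa using integrable_ofReal_mul_exp (P := P) (X := fun _ => 1) (Y := fun ω => u * S ω)
      measurable_const (by fun_prop) (B := 1) (by simp)
  · exact Measurable.aestronglyMeasurable (by fun_prop)
  · rw [norm_mul, norm_mul, norm_exp_ofReal_mul_I, mul_one, norm_I, mul_one, norm_real]
    exact hB ω

variable {ι : Type*} {J : Finset ι} {X D : ι → Ω → ℝ} {L B a τ β : ℝ}

open Complex in
lemma norm_deriv_charFun_add_le (hX : ∀ j, Measurable (X j)) (hD : ∀ j, Measurable (D j))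
    (hXL : ∀ j ω, |X j ω| ≤ L) (hDB : ∀ j ω, |D j ω| ≤ B)
    {u : ℝ} (ha : ∀ j ∈ J,
      ‖∫ ω, (X j ω : ℂ) * exp ((u * (∑ k ∈ J, X k ω - D j ω) : ℝ) * I) ∂P‖ ≤ a)
    (hτ : √(∫ ω, (∑ j ∈ J, X j ω * D j ω - ∫ ω, ∑ j ∈ J, X j ω * D j ω ∂P) ^ 2 ∂P) ≤ τ)
    (hβ : |∫ ω, ∑ j ∈ J, X j ω * D j ω ∂P - ∫ ω, (∑ j ∈ J, X j ω) ^ 2 ∂P| ≤ β) :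
    ‖∫ ω, ((∑ j ∈ J, X j ω : ℝ) : ℂ) * exp ((u * ∑ j ∈ J, X j ω : ℝ) * I) * I ∂P +
      u * (∫ ω, (∑ j ∈ J, X j ω) ^ 2 ∂P : ℝ) * ∫ ω, exp ((u * ∑ j ∈ J, X j ω : ℝ) * I) ∂P‖ ≤
      J.card * a + |u| * (τ + β) + J.card * (L * (3 * (u * B) ^ 2)) := by
  set S : Ω → ℝ := fun ω => ∑ j ∈ J, X j ω with hS
  set T : Ω → ℝ := fun ω => ∑ j ∈ J, X j ω * D j ω with hT
  set v : ℝ := ∫ ω, S ω ^ 2 ∂P with hv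
  set θ : ℝ := ∫ ω, T ω ∂P with hθ
  have hSm : Measurable S := by fun_prop
  have hTm : Measurable T := by fun_prop
  have hTB : ∀ ω, |T ω| ≤ ∑ j ∈ J, L * B := fun ω =>
    (Finset.abs_sum_le_sum_abs _ _).trans (Finset.sum_le_sum fun j _ => by
      rw [abs_mul]
      exact mul_le_mul (hXL j ω) (hDB j ω) (abs_nonneg _) ((abs_nonneg _).trans (hXL j ω)))
  set e : Ω → ℂ := fun ω => exp ((u * S ω : ℝ) * I) with he
  have hen : ∀ ω, ‖e ω‖ = 1 := fun ω => norm_exp_ofReal_mul_I _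
  have hei : Integrable e P := by
    simpa [he] using integrable_ofReal_mul_exp (P := P) (X := fun _ => 1) (Y := fun ω => u * S ω)
      measurable_const (by fun_prop) (B := 1) (by simp)
  have hTi : Integrable (fun ω => (T ω : ℂ) * e ω) P :=
    integrable_ofReal_mul_exp hTm (by fun_prop) hTB
  set A : ι → Ω → ℂ := fun j ω => (X j ω : ℂ) * exp ((u * (S ω - D j ω) : ℝ) * I) with hA
  have hAi : ∀ j, Integrable (A j) P := fun j =>
    integrable_ofReal_mul_exp (hX j) (by fun_prop) (hXL j)
  set r : ι → Ω → ℂ := fun j ω =>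
    X j ω * e ω * (exp ((-(u * D j ω) : ℝ) * I) - 1 - (-(u * D j ω) : ℝ) * I) with hr
  have hrn : ∀ j ω, ‖r j ω‖ ≤ L * (3 * (u * B) ^ 2) := by
    intro j ω
    rw [hr]
    simp only
    rw [norm_mul, norm_mul, hen, mul_one, norm_real]
    refine mul_le_mul (hXL j ω) ((norm_exp_mul_I_sub_one_sub_le _).trans ?_) (norm_nonneg _)
      ((abs_nonneg _).trans (hXL j ω))
    rw [neg_sq, mul_pow, mul_pow]
    have := sq_le_sq' (abs_le.1 (hDB j ω)).1 (abs_le.1 (hDB j ω)).2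
    gcongr
  have hri : ∀ j, Integrable (r j) P := fun j =>
    Integrable.of_bound (Measurable.aestronglyMeasurable (by fun_prop)) _ (ae_of_all _ (hrn j))
  have hpt : ∀ ω, (S ω : ℂ) * e ω * I = I * ∑ j ∈ J, A j ω - u * (T ω * e ω) -
      I * ∑ j ∈ J, r j ω := by
    intro ω
    have h1 : ∀ j, A j ω = X j ω * e ω * exp ((-(u * D j ω) : ℝ) * I) := by
      intro j
      rw [hA, he]
      simp only
      rw [mul_assoc, ← Complex.exp_add]
      congr 2
      push_cast
      ring
    have h2 : ∀ j, A j ω - r j ω = X j ω * e ω - u * (X j ω * D j ω) * e ω * I := by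
      intro j
      rw [h1, hr]
      push_cast
      ring
    have h3 : ∑ j ∈ J, A j ω - ∑ j ∈ J, r j ω = S ω * e ω - u * T ω * e ω * I := by
      rw [← Finset.sum_sub_distrib, Finset.sum_congr rfl fun j _ => h2 j, Finset.sum_sub_distrib,
        hS, hT]
      push_cast
      simp only [Finset.sum_mul, Finset.mul_sum]
    linear_combination (-I) * h3 + u * T ω * e ω * I_sq
  have hsA : Integrable (fun ω => I * ∑ j ∈ J, A j ω) P :=
    (integrable_finsetSum _ fun j _ => hAi j).const_mul I
  have hsr : Integrable (fun ω => I * ∑ j ∈ J, r j ω) P :=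
    (integrable_finsetSum _ fun j _ => hri j).const_mul I
  have hsT : Integrable (fun ω => (u : ℂ) * (T ω * e ω)) P := hTi.const_mul _
  have hAT : Integrable (fun ω => I * ∑ j ∈ J, A j ω - u * (T ω * e ω)) P := hsA.sub hsT
  have hmain : ∫ ω, (S ω : ℂ) * e ω * I ∂P = I * ∑ j ∈ J, ∫ ω, A j ω ∂P -
      u * ∫ ω, T ω * e ω ∂P - I * ∑ j ∈ J, ∫ ω, r j ω ∂P := by
    simp only [hpt]
    rw [integral_sub hAT hsr, integral_sub hsA hsT, integral_const_mul, integral_const_mul,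
      integral_const_mul, integral_finsetSum _ fun j _ => hAi j,
      integral_finsetSum _ fun j _ => hri j]
  have hθc : Integrable (fun ω => (θ : ℂ) * e ω) P := hei.const_mul _
  have hTθ : ‖∫ ω, T ω * e ω ∂P - θ * ∫ ω, e ω ∂P‖ ≤ τ := by
    rw [← integral_const_mul, ← integral_sub hTi hθc]
    have hL2 : MemLp (fun ω => |T ω - θ|) 2 P :=
      MemLp.of_bound (by fun_prop) (∑ j ∈ J, L * B + |θ|) (ae_of_all _ fun ω => by
        rw [Real.norm_eq_abs, abs_abs]
        exact (abs_sub _ _).trans (by linarith [hTB ω]))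
    calc _ ≤ ∫ ω, ‖(T ω : ℂ) * e ω - θ * e ω‖ ∂P := norm_integral_le_integral_norm _
      _ = ∫ ω, |T ω - θ| ∂P := by
        refine integral_congr_ae (ae_of_all _ fun ω => ?_)
        simp only
        rw [← sub_mul, norm_mul, hen, mul_one, ← ofReal_sub, norm_real, Real.norm_eq_abs]
      _ ≤ √(∫ ω, |T ω - θ| ^ 2 ∂P) := (le_abs_self _).trans (abs_integral_le_sqrt hL2)
      _ ≤ τ := by simpa only [sq_abs] using hτ
  have hφ : ‖∫ ω, e ω ∂P‖ ≤ 1 := by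
    refine (norm_integral_le_integral_norm _).trans ?_
    simp [hen]
  have hvθ : ‖∫ ω, T ω * e ω ∂P - v * ∫ ω, e ω ∂P‖ ≤ τ + β := by
    have e1 : ∫ ω, T ω * e ω ∂P - v * ∫ ω, e ω ∂P =
        (∫ ω, T ω * e ω ∂P - θ * ∫ ω, e ω ∂P) + ((θ - v : ℝ) : ℂ) * ∫ ω, e ω ∂P := by
      push_cast
      ring
    rw [e1]
    refine (norm_add_le _ _).trans (add_le_add hTθ ?_)
    rw [norm_mul, norm_real, Real.norm_eq_abs]
    exact (mul_le_of_le_one_right (abs_nonneg _) hφ).trans hβ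
  have hsumA : ‖∑ j ∈ J, ∫ ω, A j ω ∂P‖ ≤ J.card * a :=
    (norm_sum_le _ _).trans ((Finset.sum_le_sum ha).trans (by simp))
  have hsumr : ‖∑ j ∈ J, ∫ ω, r j ω ∂P‖ ≤ J.card * (L * (3 * (u * B) ^ 2)) :=
    (norm_sum_le _ _).trans ((Finset.sum_le_sum (g := fun _ => L * (3 * (u * B) ^ 2)) fun j _ =>
      (norm_integral_le_of_norm_le_const (ae_of_all _ (hrn j))).trans_eq (by simp)).trans (by simp))
  have e2 : ∫ ω, (S ω : ℂ) * e ω * I ∂P + u * v * ∫ ω, e ω ∂P =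
      I * ∑ j ∈ J, ∫ ω, A j ω ∂P - u * (∫ ω, T ω * e ω ∂P - v * ∫ ω, e ω ∂P) -
        I * ∑ j ∈ J, ∫ ω, r j ω ∂P := by
    rw [hmain]
    ring
  refine (congrArg norm e2).trans_le ?_
  refine (norm_sub_le _ _).trans (add_le_add ((norm_sub_le _ _).trans (add_le_add ?_ ?_)) ?_)
  · simpa using hsumA
  · rw [norm_mul, norm_real, Real.norm_eq_abs]
    gcongr
  · simpa using hsumr

open Complex in
/-- A quantitative central limit theorem for sums of bounded weakly dependent variables, by
Stein's method for characteristic functions; `D j` is the part of the sum that may strongly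
depend on `X j`. -/
lemma norm_charFun_sub_exp_le (hX : ∀ j, Measurable (X j)) (hD : ∀ j, Measurable (D j))
    (hXL : ∀ j ω, |X j ω| ≤ L) (hDB : ∀ j ω, |D j ω| ≤ B) (ha0 : 0 ≤ a) (hL0 : 0 ≤ L)
    (ha : ∀ u : ℝ, ∀ j ∈ J,
      ‖∫ ω, (X j ω : ℂ) * exp ((u * (∑ k ∈ J, X k ω - D j ω) : ℝ) * I) ∂P‖ ≤ a)
    (hτ : √(∫ ω, (∑ j ∈ J, X j ω * D j ω - ∫ ω, ∑ j ∈ J, X j ω * D j ω ∂P) ^ 2 ∂P) ≤ τ)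
    (hβ : |∫ ω, ∑ j ∈ J, X j ω * D j ω ∂P - ∫ ω, (∑ j ∈ J, X j ω) ^ 2 ∂P| ≤ β) (t : ℝ) :
    ‖∫ ω, exp ((t * ∑ j ∈ J, X j ω : ℝ) * I) ∂P -
      exp ((-(t ^ 2 * (∫ ω, (∑ j ∈ J, X j ω) ^ 2 ∂P) / 2) : ℝ))‖ ≤
      |t| * (J.card * a + |t| * (τ + β) + J.card * (L * (3 * (t * B) ^ 2))) := by
  set v : ℝ := ∫ ω, (∑ j ∈ J, X j ω) ^ 2 ∂P with hv
  have hv0 : 0 ≤ v := integral_nonneg fun _ => sq_nonneg _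
  set φ : ℝ → ℂ := fun u => ∫ ω, exp ((u * ∑ j ∈ J, X j ω : ℝ) * I) ∂P with hφ
  have hSB : ∀ ω, |∑ j ∈ J, X j ω| ≤ ∑ j ∈ J, L := fun ω =>
    (Finset.abs_sum_le_sum_abs _ _).trans (Finset.sum_le_sum fun j _ => hXL j ω)
  have hφd : ∀ u, HasDerivAt φ
      (∫ ω, ((∑ j ∈ J, X j ω : ℝ) : ℂ) * exp ((u * ∑ j ∈ J, X j ω : ℝ) * I) * I ∂P) u := fun u =>
    hasDerivAt_integral_exp (S := fun ω => ∑ j ∈ J, X j ω) (by fun_prop) hSB u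
  have hEd : ∀ u : ℝ, HasDerivAt (fun u : ℝ => exp ((u ^ 2 * v / 2 : ℝ) : ℂ))
      (exp ((u ^ 2 * v / 2 : ℝ) : ℂ) * ((u * v : ℝ) : ℂ)) u := by
    intro u
    have h1 : HasDerivAt (fun u : ℝ => u ^ 2 * v / 2) (u * v) u := by
      refine (((hasDerivAt_pow 2 u).mul_const v).div_const 2).congr_deriv ?_
      norm_num
      ring
    exact h1.ofReal_comp.cexp
  have hg := fun u => (hφd u).mul (hEd u)
  have hbound : ∀ u ∈ Set.Icc (-|t|) |t|, ‖(∫ ω, ((∑ j ∈ J, X j ω : ℝ) : ℂ) *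
      exp ((u * ∑ j ∈ J, X j ω : ℝ) * I) * I ∂P) * exp ((u ^ 2 * v / 2 : ℝ) : ℂ) +
      φ u * (exp ((u ^ 2 * v / 2 : ℝ) : ℂ) * ((u * v : ℝ) : ℂ))‖ ≤
      (J.card * a + |t| * (τ + β) + J.card * (L * (3 * (t * B) ^ 2))) *
        Real.exp (t ^ 2 * v / 2) := by
    intro u hu
    have hut : |u| ≤ |t| := abs_le.2 hu
    have hτβ : 0 ≤ τ + β := add_nonneg ((Real.sqrt_nonneg _).trans hτ) ((abs_nonneg _).trans hβ)
    have h1 := norm_deriv_charFun_add_le hX hD hXL hDB (ha u) hτ hβ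
    have h2 : u ^ 2 ≤ t ^ 2 := sq_le_sq.2 hut
    calc _ = ‖(∫ ω, ((∑ j ∈ J, X j ω : ℝ) : ℂ) * exp ((u * ∑ j ∈ J, X j ω : ℝ) * I) * I ∂P +
          u * v * φ u) * exp ((u ^ 2 * v / 2 : ℝ) : ℂ)‖ := by
          congr 1
          push_cast
          ring
      _ ≤ (J.card * a + |u| * (τ + β) + J.card * (L * (3 * (u * B) ^ 2))) *
          Real.exp (u ^ 2 * v / 2) := by
          rw [norm_mul, norm_exp_ofReal]
          gcongr
      _ ≤ _ := by
          rw [mul_pow, mul_pow]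
          gcongr
  have hmv := (convex_Icc (-|t|) |t|).norm_image_sub_le_of_norm_hasDerivWithin_le
    (fun u _ => (hg u).hasDerivWithinAt) hbound
    (show (0 : ℝ) ∈ Set.Icc (-|t|) |t| from ⟨by simp, abs_nonneg t⟩)
    (show t ∈ Set.Icc (-|t|) |t| from ⟨neg_abs_le t, le_abs_self t⟩)
  have hφ0 : φ 0 = 1 := by simp [hφ]
  simp only [Pi.mul_apply, hφ0, sub_zero, Real.norm_eq_abs] at hmv
  have hE : (exp ((t ^ 2 * v / 2 : ℝ) : ℂ)) * exp ((-(t ^ 2 * v / 2) : ℝ) : ℂ) = 1 := by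
    rw [← Complex.exp_add, ← ofReal_add, add_neg_cancel, ofReal_zero, Complex.exp_zero]
  have hEr : Real.exp (t ^ 2 * v / 2) * Real.exp (-(t ^ 2 * v / 2)) = 1 := by
    rw [← Real.exp_add, add_neg_cancel, Real.exp_zero]
  calc _ = ‖(φ t * exp ((t ^ 2 * v / 2 : ℝ) : ℂ) - 1) * exp ((-(t ^ 2 * v / 2) : ℝ) : ℂ)‖ := by
        rw [sub_mul, mul_assoc, hE, mul_one, one_mul]
    _ ≤ (J.card * a + |t| * (τ + β) + J.card * (L * (3 * (t * B) ^ 2))) *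
        Real.exp (t ^ 2 * v / 2) * |t| * Real.exp (-(t ^ 2 * v / 2)) := by
        rw [norm_mul, norm_exp_ofReal]
        gcongr
        simpa using hmv
    _ = _ := by
      linear_combination ((J.card : ℝ) * a + |t| * (τ + β) + J.card * (L * (3 * (t * B) ^ 2))) * |t|
        * hEr

end SteinMethod

section Lattice

variable {d : ℕ} {Ω : Type*} [MeasurableSpace Ω] {P : Measure Ω} [IsProbabilityMeasure P]

/-- Values of a lattice field at index sets a distance `R` apart are nearly uncorrelated. -/
def IsBlockMixing (P : Measure Ω) (X : (Fin d → ℤ) → Ω → ℝ) (R : ℕ) (α : ℝ) : Prop :=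
  ∀ (ι κ : Type) [Fintype ι] [Fintype κ] (k : ι → Fin d → ℤ) (l : κ → Fin d → ℤ),
    (∀ i j, ∃ c, (R : ℤ) ≤ |k i c - l j c|) → ∀ (f : (ι → ℝ) → ℝ) (g : (κ → ℝ) → ℝ),
    Measurable f → Measurable g → ∀ M N : ℝ, (∀ ω, |f fun i => X (k i) ω| ≤ M) →
    (∀ ω, |g fun i => X (l i) ω| ≤ N) →
    |∫ ω, f (fun i => X (k i) ω) * g (fun j => X (l j) ω) ∂P -
      (∫ ω, f (fun i => X (k i) ω) ∂P) * ∫ ω, g (fun j => X (l j) ω) ∂P|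
      ≤ M * N * ((Fintype.card ι + Fintype.card κ + Fintype.card ι * Fintype.card κ) * α)

/-- The indices of `J` within distance less than `R` of `j`. -/
def nearIdx (J : Finset (Fin d → ℤ)) (R : ℕ) (j : Fin d → ℤ) : Finset (Fin d → ℤ) :=
  J.filter fun k => ∀ c, |j c - k c| < R

lemma card_nearIdx_le (J : Finset (Fin d → ℤ)) (R : ℕ) (j : Fin d → ℤ) :
    (nearIdx J R j).card ≤ (2 * R + 1) ^ d := by
  have hsub : nearIdx J R j ⊆ Finset.Icc (fun c => j c - R) (fun c => j c + R) := by
    intro k hk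
    simp only [nearIdx, Finset.mem_filter] at hk
    simp only [Finset.mem_Icc, Pi.le_def]
    constructor <;> intro c <;> have := abs_lt.1 (hk.2 c) <;> omega
  refine (Finset.card_le_card hsub).trans ?_
  rw [Pi.card_Icc]
  simp only [Int.card_Icc]
  refine (Finset.prod_le_pow_card _ _ (2 * R + 1) fun c _ => ?_).trans (by simp)
  omega

variable {X : (Fin d → ℤ) → Ω → ℝ} {R : ℕ} {α L : ℝ} {J : Finset (Fin d → ℤ)}

lemma abs_sum_le_card_mul {ι : Type*} (J : Finset ι) {f : ι → ℝ} {C : ℝ} (h : ∀ j ∈ J, |f j| ≤ C) :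
    |∑ j ∈ J, f j| ≤ J.card * C :=
  (Finset.abs_sum_le_sum_abs _ _).trans ((Finset.sum_le_sum h).trans (by simp))

lemma sum_sub_sum_nearIdx (X : (Fin d → ℤ) → ℝ) (j : Fin d → ℤ) :
    ∑ k ∈ J, X k - ∑ k ∈ nearIdx J R j, X k =
      ∑ k ∈ J.filter (fun k => ¬ ∀ c, |j c - k c| < R), X k := by
  rw [nearIdx, ← Finset.sum_filter_add_sum_filter_not J (fun k => ∀ c, |j c - k c| < R) X,
    add_sub_cancel_left]

lemma IsBlockMixing.abs_integral_mul_far_le (h : IsBlockMixing P X R α)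
    (hXL : ∀ j ω, |X j ω| ≤ L) (hα : 0 ≤ α)
    (hX0 : ∀ j, ∫ ω, X j ω ∂P = 0) {g : ℝ → ℝ} (hg : Measurable g) {N : ℝ} (j : Fin d → ℤ)
    (hgN : ∀ ω, |g (∑ k ∈ J, X k ω - ∑ k ∈ nearIdx J R j, X k ω)| ≤ N) :
    |∫ ω, X j ω * g (∑ k ∈ J, X k ω - ∑ k ∈ nearIdx J R j, X k ω) ∂P| ≤
      L * N * ((2 * J.card + 1) * α) := by
  simp only [sum_sub_sum_nearIdx (R := R)] at hgN ⊢
  set J' := J.filter (fun k => ¬ ∀ c, |j c - k c| < R) with hJ'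
  have hs : ∀ ω, ∑ k : J', X k ω = ∑ k ∈ J', X k ω := fun ω =>
    Finset.sum_coe_sort J' fun k => X k ω
  obtain ⟨ω₀⟩ : Nonempty Ω := nonempty_of_isProbabilityMeasure P
  have hL : 0 ≤ L := (abs_nonneg _).trans (hXL j ω₀)
  have hN : 0 ≤ N := (abs_nonneg _).trans (hgN ω₀)
  have := h Unit J' (fun _ => j) (fun k => k) (fun _ k => by
    have hk := (Finset.mem_filter.1 k.2).2
    push Not at hk
    exact hk) (fun v => v ()) (fun v => g (∑ k, v k)) (by fun_prop) (by fun_prop) L N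
    (fun ω => hXL j ω) (fun ω => by simpa only [hs] using hgN ω)
  simp only [hs, hX0, zero_mul, sub_zero] at this
  refine this.trans ?_
  have hcard : (Fintype.card J' : ℝ) ≤ J.card := by
    rw [Fintype.card_coe]
    exact_mod_cast Finset.card_filter_le _ _
  rw [Fintype.card_unit]
  refine mul_le_mul_of_nonneg_left (mul_le_mul_of_nonneg_right ?_ hα) (by positivity)
  push_cast
  linarith

open Complex in
lemma IsBlockMixing.norm_integral_mul_exp_far_le (h : IsBlockMixing P X R α)
    (hX : ∀ j, Measurable (X j)) (hXL : ∀ j ω, |X j ω| ≤ L) (hα : 0 ≤ α)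
    (hX0 : ∀ j, ∫ ω, X j ω ∂P = 0) (u : ℝ) (j : Fin d → ℤ) :
    ‖∫ ω, (X j ω : ℂ) *
        exp ((u * (∑ k ∈ J, X k ω - ∑ k ∈ nearIdx J R j, X k ω) : ℝ) * I) ∂P‖ ≤
      2 * (L * ((2 * J.card + 1) * α)) := by
  set Y : Ω → ℝ := fun ω => ∑ k ∈ J, X k ω - ∑ k ∈ nearIdx J R j, X k ω with hY
  have hYm : Measurable Y := by fun_prop
  have hc := h.abs_integral_mul_far_le (J := J) hXL hα hX0 (g := fun y => Real.cos (u * y))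
    (by fun_prop) (N := 1) j (fun _ => Real.abs_cos_le_one _)
  have hs := h.abs_integral_mul_far_le (J := J) hXL hα hX0 (g := fun y => Real.sin (u * y))
    (by fun_prop) (N := 1) j (fun _ => Real.abs_sin_le_one _)
  have hb : ∀ {g : ℝ → ℝ}, Measurable g → (∀ y, |g y| ≤ 1) →
      Integrable (fun ω => ((X j ω * g (Y ω) : ℝ) : ℂ)) P := fun {g} hg hg1 =>
    have hi : Integrable (fun ω => X j ω * g (Y ω)) P :=
      Integrable.of_bound (by fun_prop) (L * 1) (ae_of_all _ fun ω => by
        rw [Real.norm_eq_abs, abs_mul]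
        exact mul_le_mul (hXL j ω) (hg1 _) (abs_nonneg _) ((abs_nonneg _).trans (hXL j ω)))
    hi.ofReal
  have e : ∀ ω, (X j ω : ℂ) * exp ((u * Y ω : ℝ) * I) =
      ((X j ω * Real.cos (u * Y ω) : ℝ) : ℂ) + ((X j ω * Real.sin (u * Y ω) : ℝ) : ℂ) * I := by
    intro ω
    rw [exp_mul_I, ← ofReal_cos, ← ofReal_sin]
    push_cast
    ring
  have hi1 := hb (g := fun y => Real.cos (u * y)) (by fun_prop) fun _ => Real.abs_cos_le_one _
  have hi2 : Integrable (fun ω => ((X j ω * Real.sin (u * Y ω) : ℝ) : ℂ) * I) P :=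
    (hb (g := fun y => Real.sin (u * y)) (by fun_prop) fun _ => Real.abs_sin_le_one _).mul_const I
  change ‖∫ ω, (X j ω : ℂ) * exp ((u * Y ω : ℝ) * I) ∂P‖ ≤ _
  simp only [e]
  rw [integral_add hi1 hi2, integral_mul_const, integral_complex_ofReal,
    integral_complex_ofReal]
  refine (norm_add_le _ _).trans ?_
  rw [norm_mul, norm_I, norm_real, norm_real, Real.norm_eq_abs, Real.norm_eq_abs]
  linarith

lemma IsBlockMixing.abs_integral_sum_sub_le (h : IsBlockMixing P X R α)
    (hX : ∀ j, Measurable (X j)) (hXL : ∀ j ω, |X j ω| ≤ L) (hα : 0 ≤ α)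
    (hX0 : ∀ j, ∫ ω, X j ω ∂P = 0) :
    |∫ ω, ∑ j ∈ J, X j ω * ∑ k ∈ nearIdx J R j, X k ω ∂P - ∫ ω, (∑ j ∈ J, X j ω) ^ 2 ∂P| ≤
      J.card * (L * (J.card * L) * ((2 * J.card + 1) * α)) := by
  have hXi : ∀ j, MemLp (X j) 2 P := fun j =>
    MemLp.of_bound (hX j).aestronglyMeasurable L (ae_of_all _ fun ω => hXL j ω)
  have hsi : ∀ J : Finset (Fin d → ℤ), MemLp (fun ω => ∑ k ∈ J, X k ω) 2 P := fun J =>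
    memLp_finsetSum _ fun k _ => hXi k
  have hm : ∀ j (J : Finset (Fin d → ℤ)), Integrable (fun ω => X j ω * ∑ k ∈ J, X k ω) P :=
    fun j J => (hXi j).integrable_mul (hsi J)
  have e : ∫ ω, ∑ j ∈ J, X j ω * ∑ k ∈ nearIdx J R j, X k ω ∂P - ∫ ω, (∑ j ∈ J, X j ω) ^ 2 ∂P =
      -∑ j ∈ J, ∫ ω, X j ω * (∑ k ∈ J, X k ω - ∑ k ∈ nearIdx J R j, X k ω) ∂P := by
    have h1 : ∀ ω, (∑ j ∈ J, X j ω) ^ 2 = ∑ j ∈ J, X j ω * ∑ k ∈ J, X k ω := fun ω => by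
      rw [sq, Finset.sum_mul]
    simp only [h1, mul_sub]
    rw [integral_finsetSum _ fun j _ => hm j _, integral_finsetSum _ fun j _ => hm j _,
      ← Finset.sum_sub_distrib, ← Finset.sum_neg_distrib]
    refine Finset.sum_congr rfl fun j _ => ?_
    rw [integral_sub (hm j _) (hm j _), neg_sub]
  rw [e, abs_neg]
  refine abs_sum_le_card_mul J fun j _ => ?_
  refine h.abs_integral_mul_far_le (g := id) hXL hα hX0 measurable_id j fun ω => ?_
  rw [id, sum_sub_sum_nearIdx]
  refine (abs_sum_le_card_mul _ fun k _ => hXL k ω).trans ?_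
  have := (abs_nonneg _).trans (hXL j ω)
  gcongr
  exact Finset.filter_subset _ _

lemma abs_covariance_le_of_bound {U W : Ω → ℝ} {q : ℝ}
    (hUq : ∀ ω, |U ω| ≤ q) (hWq : ∀ ω, |W ω| ≤ q) : |cov P U W| ≤ 2 * q ^ 2 := by
  obtain ⟨ω₀⟩ : Nonempty Ω := nonempty_of_isProbabilityMeasure P
  have hq : 0 ≤ q := (abs_nonneg _).trans (hUq ω₀)
  have hb : ∀ {f : Ω → ℝ} {C : ℝ}, (∀ ω, |f ω| ≤ C) → |∫ ω, f ω ∂P| ≤ C := fun {f C} hf => by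
    simpa using norm_integral_le_of_norm_le_const (μ := P) (f := f) (ae_of_all _ hf)
  refine (abs_sub _ _).trans ?_
  rw [abs_mul, two_mul]
  refine add_le_add (hb fun ω => ?_) ?_
  · rw [abs_mul, sq]
    exact mul_le_mul (hUq ω) (hWq ω) (abs_nonneg _) hq
  · rw [sq]
    exact mul_le_mul (hb hUq) (hb hWq) (abs_nonneg _) hq

lemma IsBlockMixing.integral_sum_sub_sq_le (h : IsBlockMixing P X R α)
    (hX : ∀ j, Measurable (X j)) (hXL : ∀ j ω, |X j ω| ≤ L) (hα : 0 ≤ α) (hR : 0 < R)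
    {m m₃ : ℝ} (hm : ((2 * R + 1 : ℕ) : ℝ) ^ d ≤ m) (hm₃ : ((2 * (3 * R) + 1 : ℕ) : ℝ) ^ d ≤ m₃) :
    ∫ ω, (∑ j ∈ J, X j ω * ∑ k ∈ nearIdx J R j, X k ω -
      ∫ ω, ∑ j ∈ J, X j ω * ∑ k ∈ nearIdx J R j, X k ω ∂P) ^ 2 ∂P ≤
      J.card * (m₃ * (2 * (L * (m * L)) ^ 2) +
        J.card * ((L * (m * L)) ^ 2 * ((2 * m + m ^ 2) * α))) := by
  obtain ⟨ω₀⟩ : Nonempty Ω := nonempty_of_isProbabilityMeasure P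
  have hL : 0 ≤ L := (abs_nonneg _).trans (hXL 0 ω₀)
  have hm0 : 0 ≤ m := le_trans (by positivity) hm
  set q := L * (m * L) with hq
  set Q : (Fin d → ℤ) → Ω → ℝ := fun j ω => X j ω * ∑ k ∈ nearIdx J R j, X k ω with hQ
  have hcard : ∀ j, ((nearIdx J R j).card : ℝ) ≤ m := fun j =>
    le_trans (by exact_mod_cast card_nearIdx_le J R j) hm
  have hQm : ∀ j, Measurable (Q j) := fun j => by fun_prop
  have hQq : ∀ j ω, |Q j ω| ≤ q := fun j ω => by
    rw [hQ, abs_mul]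
    refine mul_le_mul (hXL j ω) ((abs_sum_le_card_mul _ fun k _ => hXL k ω).trans ?_)
      (abs_nonneg _) hL
    gcongr
    exact hcard j
  have hQ2 : ∀ j, MemLp (Q j) 2 P := fun j =>
    MemLp.of_bound (hQm j).aestronglyMeasurable q (ae_of_all _ fun ω => hQq j ω)
  have hfar : ∀ j ∈ J, ∀ j' ∈ J, j' ∉ nearIdx J (3 * R) j →
      |cov P (Q j) (Q j')| ≤ q ^ 2 * ((2 * m + m ^ 2) * α) := by
    intro j hj j' hj' hn
    have hself : ∀ {j}, j ∈ J → j ∈ nearIdx J R j := fun {j} hj =>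
      Finset.mem_filter.2 ⟨hj, fun c => by simpa using hR⟩
    have hs : ∀ j ω, ∑ k : nearIdx J R j, X k ω = ∑ k ∈ nearIdx J R j, X k ω := fun j ω =>
      Finset.sum_coe_sort _ fun k => X k ω
    have hc := h (nearIdx J R j) (nearIdx J R j') (fun k => k) (fun k => k) (fun k l => by
      have hk := (Finset.mem_filter.1 k.2).2
      have hl := (Finset.mem_filter.1 l.2).2
      simp only [nearIdx, Finset.mem_filter, hj', true_and, not_forall, not_lt] at hn
      obtain ⟨c, hc⟩ := hn
      refine ⟨c, ?_⟩
      have h1 := hk c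
      have h2 := hl c
      push_cast at hc
      rw [abs_lt] at h1 h2
      rw [le_abs] at hc ⊢
      rcases hc with hc | hc
      · left; linarith
      · right; linarith)
      (fun v => v ⟨j, hself hj⟩ * ∑ k, v k) (fun v => v ⟨j', hself hj'⟩ * ∑ k, v k)
      (by fun_prop) (by fun_prop) q q
      (fun ω => by simpa only [hs, hQ] using hQq j ω)
      (fun ω => by simpa only [hs, hQ] using hQq j' ω)
    simp only [hs] at hc
    refine hc.trans ?_
    rw [Fintype.card_coe, Fintype.card_coe, ← sq]
    have hc1 := hcard j
    have hc2 := hcard j'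
    have : ((nearIdx J R j).card : ℝ) * (nearIdx J R j').card ≤ m ^ 2 := by
      rw [sq]
      gcongr
    gcongr
    linarith
  have hcovQ : ∀ j j', cov[Q j, Q j'; P] = cov P (Q j) (Q j') := fun j j' =>
    covariance_eq_sub (hQ2 j) (hQ2 j')
  have hvar := variance_fun_sum' (s := J) (X := Q) fun j _ => hQ2 j
  rw [variance_eq_integral (by fun_prop)] at hvar
  rw [hvar]
  simp only [hcovQ]
  have hrow : ∀ j ∈ J, ∑ j' ∈ J, cov P (Q j) (Q j') ≤
      m₃ * (2 * q ^ 2) + J.card * (q ^ 2 * ((2 * m + m ^ 2) * α)) := by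
    intro j hj
    rw [← Finset.sum_filter_add_sum_filter_not J (· ∈ nearIdx J (3 * R) j)]
    refine add_le_add ?_ ?_
    · refine (le_abs_self _).trans ((abs_sum_le_card_mul _ fun j' _ =>
        abs_covariance_le_of_bound (hQq j) (hQq j')).trans ?_)
      gcongr
      refine le_trans ?_ hm₃
      have : J.filter (· ∈ nearIdx J (3 * R) j) ⊆ nearIdx J (3 * R) j := fun x hx =>
        (Finset.mem_filter.1 hx).2
      exact_mod_cast (Finset.card_le_card this).trans (card_nearIdx_le J (3 * R) j)
    · refine (le_abs_self _).trans ((abs_sum_le_card_mul _ fun j' hj' =>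
        hfar j hj j' (Finset.mem_filter.1 hj').1 (Finset.mem_filter.1 hj').2).trans ?_)
      gcongr
      exact Finset.filter_subset _ _
  exact (Finset.sum_le_sum hrow).trans (by simp [mul_add])

open Complex in
lemma IsBlockMixing.norm_charFun_sub_exp_le (h : IsBlockMixing P X R α)
    (hX : ∀ j, Measurable (X j)) (hXL : ∀ j ω, |X j ω| ≤ L) (hα : 0 ≤ α)
    (hX0 : ∀ j, ∫ ω, X j ω ∂P = 0) (hR : 0 < R) {m m₃ : ℝ}
    (hm : ((2 * R + 1 : ℕ) : ℝ) ^ d ≤ m) (hm₃ : ((2 * (3 * R) + 1 : ℕ) : ℝ) ^ d ≤ m₃) (t : ℝ) :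
    ‖∫ ω, exp ((t * ∑ j ∈ J, X j ω : ℝ) * I) ∂P -
      exp ((-(t ^ 2 * (∫ ω, (∑ j ∈ J, X j ω) ^ 2 ∂P) / 2) : ℝ))‖ ≤
      |t| * (J.card * (2 * (L * ((2 * J.card + 1) * α))) +
        |t| * (√(J.card * (m₃ * (2 * (L * (m * L)) ^ 2) +
          J.card * ((L * (m * L)) ^ 2 * ((2 * m + m ^ 2) * α)))) +
          J.card * (L * (J.card * L) * ((2 * J.card + 1) * α))) +
        J.card * (L * (3 * (t * (m * L)) ^ 2))) := by
  obtain ⟨ω₀⟩ : Nonempty Ω := nonempty_of_isProbabilityMeasure P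
  have hL : 0 ≤ L := (abs_nonneg _).trans (hXL 0 ω₀)
  refine _root_.norm_charFun_sub_exp_le hX (D := fun j ω => ∑ k ∈ nearIdx J R j, X k ω)
    (fun j => by fun_prop) hXL (fun j ω => ?_) (by positivity) hL
    (fun u j _ => h.norm_integral_mul_exp_far_le hX hXL hα hX0 u j)
    (Real.sqrt_le_sqrt (h.integral_sum_sub_sq_le hX hXL hα hR hm hm₃))
    (h.abs_integral_sum_sub_le hX hXL hα hX0) t
  refine (abs_sum_le_card_mul _ fun k _ => hXL k ω).trans ?_
  gcongr
  exact le_trans (by exact_mod_cast card_nearIdx_le J R j) hm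

end Lattice

section CoarseSum

variable {d : ℕ}

lemma finite_image_cellIdx {V : Set (EuclideanSpace ℝ (Fin d))} (hV : Bornology.IsBounded V)
    {s : ℝ} (hs : 0 < s) : (cellIdx s '' V).Finite := by
  obtain ⟨ρ, hρ⟩ := hV.exists_norm_le
  refine (Set.finite_Icc (fun _ : Fin d => ⌊-ρ / s⌋) (fun _ => ⌊ρ / s⌋)).subset ?_
  rintro _ ⟨x, hx, rfl⟩
  have hi : ∀ i, |x i| ≤ ρ := fun i => (PiLp.norm_apply_le x i).trans (hρ x hx)
  constructor <;> intro i <;> refine Int.floor_le_floor ?_ <;> gcongr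
  · exact (abs_le.1 (hi i)).1
  · exact (abs_le.1 (hi i)).2

lemma setIntegral_comp_cellIdx {V : Set (EuclideanSpace ℝ (Fin d))} (hVm : MeasurableSet V)
    (hVf : volume V ≠ ∞) {s : ℝ} {J : Finset (Fin d → ℤ)} (hJ : ∀ x ∈ V, cellIdx s x ∈ J)
    (H : (Fin d → ℤ) → ℝ) :
    ∫ x in V, H (cellIdx s x) = ∑ k ∈ J, volume.real (cellIdx s ⁻¹' {k} ∩ V) * H k := by
  have : IsFiniteMeasure (volume.restrict V) := ⟨by simpa using hVf.lt_top⟩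
  have e : ∀ x ∈ V, H (cellIdx s x) =
      ∑ k ∈ J, (cellIdx s ⁻¹' {k}).indicator (fun _ => H k) x := by
    intro x hx
    rw [Finset.sum_eq_single_of_mem _ (hJ x hx), Set.indicator_of_mem (by simp)]
    intro k _ hk
    exact Set.indicator_of_notMem (by simpa using hk.symm) _
  rw [setIntegral_congr_fun hVm e, integral_finsetSum _ fun k _ =>
    (integrable_const _).indicator (measurableSet_cell s k)]
  refine Finset.sum_congr rfl fun k _ => ?_
  rw [integral_indicator_const _ (measurableSet_cell s k),
    measureReal_restrict_apply (measurableSet_cell s k), smul_eq_mul]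

lemma dist_le_of_cellIdx_eq {s : ℝ} (hs : 0 < s) {x y : EuclideanSpace ℝ (Fin d)}
    (hxy : cellIdx s x = cellIdx s y) : dist x y ≤ 2 * (s * √d) := by
  have h1 := norm_sub_gridPt_le hs x
  have h2 := norm_sub_gridPt_le hs y
  rw [← dist_eq_norm] at h1 h2
  rw [hxy] at h1
  linarith [dist_triangle_right x y (gridPt s (cellIdx s y))]

lemma card_mul_le_volume {V : Set (EuclideanSpace ℝ (Fin d))} {s : ℝ} (hs : 0 < s)
    {J : Finset (Fin d → ℤ)} (hJ : ∀ k ∈ J, ∃ x ∈ V, cellIdx s x = k) (hVf : volume V ≠ ∞) {r : ℝ}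
    (hr : 2 * (s * √d) ≤ r) (hNf : volume {x | Metric.infDist x (frontier V) ≤ r} ≠ ∞) :
    J.card * s ^ d ≤ volume.real V + volume.real {x | Metric.infDist x (frontier V) ≤ r} := by
  have hsub : (⋃ k ∈ J, cellIdx s ⁻¹' {k}) ⊆ V ∪ {x | Metric.infDist x (frontier V) ≤ r} := by
    intro x hx
    simp only [Set.mem_iUnion, Set.mem_preimage, Set.mem_singleton_iff] at hx
    obtain ⟨k, hk, hxk⟩ := hx
    obtain ⟨y, hy, hyk⟩ := hJ k hk
    by_cases hxV : x ∈ V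
    · exact Or.inl hxV
    · exact Or.inr ((infDist_frontier_le (by tauto)).trans
        ((dist_le_of_cellIdx_eq hs (hxk.trans hyk.symm)).trans hr))
  have hcell : ∀ k : Fin d → ℤ, volume.real (cellIdx s ⁻¹' {k}) = s ^ d := fun k => by
    rw [Measure.real, volume_cell hs, ENNReal.toReal_ofReal (by positivity)]
  have hU := measureReal_biUnion_finset (μ := volume) (s := J) (f := fun k => cellIdx s ⁻¹' {k})
    (fun k _ l _ hkl => by
      refine Set.disjoint_left.2 fun x hx hy => hkl ?_
      exact hx.symm.trans hy) (fun k _ => measurableSet_cell s k)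
    (fun k _ => by rw [volume_cell hs]; exact ENNReal.ofReal_ne_top)
  simp only [hcell, Finset.sum_const, nsmul_eq_mul] at hU
  rw [← hU]
  exact (measureReal_mono hsub (measure_union_ne_top hVf hNf)).trans (measureReal_union_le _ _)

/-- Numerical estimate for the error of the normal approximation in terms of the eighth root
`ρ` of the volume. -/
lemma normal_error_le {c ρ N L α t : ℝ} (hc : 1 ≤ c) (hρ : 1 ≤ ρ) (hN0 : 0 ≤ N)
    (hN : N ≤ c * ρ ^ 8) (hL0 : 0 ≤ L) (hL : L ≤ c / ρ ^ 4) (hα0 : 0 ≤ α) (hα : α ≤ c / ρ ^ 32) :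
    |t| * (N * (2 * (L * ((2 * N + 1) * α))) +
        |t| * (√(N * (c * ρ * (2 * (L * (c * ρ * L)) ^ 2) +
          N * ((L * (c * ρ * L)) ^ 2 * ((2 * (c * ρ) + (c * ρ) ^ 2) * α)))) +
          N * (L * (N * L) * ((2 * N + 1) * α))) +
        N * (L * (3 * (t * (c * ρ * L)) ^ 2))) ≤
      |t| * (6 + |t| * 6 + 3 * t ^ 2) * c ^ 6 / ρ := by
  have hρ0 : 0 < ρ := by linarith
  have hN1 : 2 * N + 1 ≤ 3 * (c * ρ ^ 8) := by
    have : (1 : ℝ) ≤ c * ρ ^ 8 := by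
      have := one_le_pow₀ hρ (n := 8)
      nlinarith
    linarith
  have hpow : ∀ k : ℕ, 1 / ρ ^ (k + 1) ≤ 1 / ρ := fun k => by
    rw [pow_succ]
    refine one_div_le_one_div_of_le hρ0 (le_mul_of_one_le_left hρ0.le (one_le_pow₀ hρ))
  have hcpow : ∀ {i j : ℕ}, i ≤ j → c ^ i ≤ c ^ j := fun hij => pow_le_pow_right₀ hc hij
  have hq : L * (c * ρ * L) ≤ c ^ 3 / ρ ^ 7 := by
    calc _ ≤ c / ρ ^ 4 * (c * ρ * (c / ρ ^ 4)) := by gcongr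
      _ = _ := by field_simp
  have h1 : N * (2 * (L * ((2 * N + 1) * α))) ≤ 6 * c ^ 6 / ρ := by
    calc _ ≤ c * ρ ^ 8 * (2 * (c / ρ ^ 4 * (3 * (c * ρ ^ 8) * (c / ρ ^ 32)))) := by gcongr
      _ = 6 * c ^ 4 * (1 / ρ ^ (19 + 1)) := by field_simp; ring
      _ ≤ 6 * c ^ 6 * (1 / ρ) := by
        gcongr 6 * ?_ * ?_
        · exact hcpow (i := 4) (j := 6) (by norm_num)
        · exact hpow _
      _ = _ := by ring
  have h2 : N * (L * (N * L) * ((2 * N + 1) * α)) ≤ 3 * c ^ 6 / ρ := by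
    calc _ ≤ c * ρ ^ 8 * (c / ρ ^ 4 * (c * ρ ^ 8 * (c / ρ ^ 4)) *
          (3 * (c * ρ ^ 8) * (c / ρ ^ 32))) := by gcongr
      _ = 3 * c ^ 6 * (1 / ρ ^ (15 + 1)) := by field_simp
      _ ≤ 3 * c ^ 6 * (1 / ρ) := by
        gcongr 3 * c ^ 6 * ?_
        exact hpow _
      _ = _ := by ring
  have h3 : N * (L * (3 * (t * (c * ρ * L)) ^ 2)) ≤ 3 * t ^ 2 * c ^ 6 / ρ := by
    calc _ = 3 * t ^ 2 * (N * (L * (c * ρ * L) ^ 2)) := by ring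
      _ ≤ 3 * t ^ 2 * (c * ρ ^ 8 * (c / ρ ^ 4 * (c * ρ * (c / ρ ^ 4)) ^ 2)) := by gcongr
      _ = 3 * t ^ 2 * c ^ 6 * (1 / ρ ^ (1 + 1)) := by field_simp
      _ ≤ 3 * t ^ 2 * c ^ 6 * (1 / ρ) := by
        gcongr 3 * t ^ 2 * c ^ 6 * ?_
        exact hpow _
      _ = _ := by ring
  have h4 : √(N * (c * ρ * (2 * (L * (c * ρ * L)) ^ 2) +
      N * ((L * (c * ρ * L)) ^ 2 * ((2 * (c * ρ) + (c * ρ) ^ 2) * α)))) ≤ 3 * c ^ 6 / ρ := by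
    refine Real.sqrt_le_iff.2 ⟨by positivity, ?_⟩
    have hcρ : 2 * (c * ρ) + (c * ρ) ^ 2 ≤ 3 * (c * ρ) ^ 2 := by
      have : 1 ≤ c * ρ := one_le_mul_of_one_le_of_one_le hc hρ
      nlinarith
    calc _ ≤ c * ρ ^ 8 * (c * ρ * (2 * (c ^ 3 / ρ ^ 7) ^ 2) +
          c * ρ ^ 8 * ((c ^ 3 / ρ ^ 7) ^ 2 * (3 * (c * ρ) ^ 2 * (c / ρ ^ 32)))) := by gcongr
      _ = 2 * c ^ 8 * (1 / ρ ^ (4 + 1)) + 3 * c ^ 11 * (1 / ρ ^ (27 + 1)) := by field_simp; ring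
      _ ≤ 2 * c ^ 12 * (1 / ρ ^ 2) + 3 * c ^ 12 * (1 / ρ ^ 2) := by
        gcongr 2 * ?_ * ?_ + 3 * ?_ * ?_
        · exact hcpow (j := 12) (by norm_num)
        · exact one_div_le_one_div_of_le (by positivity) (pow_le_pow_right₀ hρ (by norm_num))
        · exact hcpow (j := 12) (by norm_num)
        · exact one_div_le_one_div_of_le (by positivity) (pow_le_pow_right₀ hρ (by norm_num))
      _ ≤ (3 * c ^ 6 / ρ) ^ 2 := by
        rw [div_pow, mul_pow, ← pow_mul]
        have : 0 ≤ c ^ 12 / ρ ^ 2 := by positivity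
        ring_nf at this ⊢
        linarith
  calc _ ≤ |t| * (6 * c ^ 6 / ρ + |t| * (3 * c ^ 6 / ρ + 3 * c ^ 6 / ρ) +
        3 * t ^ 2 * c ^ 6 / ρ) := by gcongr
    _ = _ := by ring

end CoarseSum

section CoarseCLT

variable {d : ℕ} {Ω : Type*} [MeasurableSpace Ω] {P : Measure Ω} [IsProbabilityMeasure P]
  {Z : EuclideanSpace ℝ (Fin d) → Ω → ℝ} {G : ℝ → ℝ} {K s : ℝ}

lemma IsMixingField.exists_isBlockMixing (h : IsMixingField P Z) (hs : 0 < s) (p : ℕ) :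
    ∃ A : ℝ, 0 ≤ A ∧ ∀ H : (Fin d → ℤ) → ℝ → ℝ, (∀ k, Measurable (H k)) → ∀ R : ℕ,
      IsBlockMixing P (fun k ω => H k (Z (gridPt s k) ω)) R (A / (1 + s * R) ^ p) := by
  obtain ⟨A, hA0, hA⟩ := h.mixing p
  refine ⟨A, hA0, fun H hH R ι κ _ _ k l hkl f g hf hg M N hM hN => ?_⟩
  obtain ⟨ω₀⟩ : Nonempty Ω := nonempty_of_isProbabilityMeasure P
  have hM0 : 0 ≤ M := (abs_nonneg _).trans (hM ω₀)
  have hN0 : 0 ≤ N := (abs_nonneg _).trans (hN ω₀)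
  have key := hA ι κ (fun i => gridPt s (k i)) (fun j => gridPt s (l j)) (s * R) (by positivity)
    (fun i j => (hkl i j).elim fun c hc => le_dist_gridPt hs hc)
    (fun u => clamp M (f fun i => H (k i) (u i))) (fun u => clamp N (g fun j => H (l j) (u j)))
    ((continuous_clamp M).measurable.comp (hf.comp (measurable_pi_lambda _ fun i =>
      (hH (k i)).comp (measurable_pi_apply i))))
    ((continuous_clamp N).measurable.comp (hg.comp (measurable_pi_lambda _ fun j =>
      (hH (l j)).comp (measurable_pi_apply j))))
    M N (fun u => abs_clamp_le hM0 _) (fun u => abs_clamp_le hN0 _)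
  simpa only [clamp_of_abs_le (hM _), clamp_of_abs_le (hN _)] using key

open Complex in
/-- Quantitative normal approximation for integrals of a field that is constant on the cells of
a grid. -/
lemma IsMixingField.exists_norm_charFun_coarse_sub_le (h : IsMixingField P Z) (hd : 0 < d)
    (hG : Measurable G) (hGK : ∀ u, |G u| ≤ K) (hG0 : ∫ ω, G (Z 0 ω) ∂P = 0) (hs : 0 < s) :
    ∃ c : ℝ, ∀ (V : Set (EuclideanSpace ℝ (Fin d))) (J : Finset (Fin d → ℤ)),
      MeasurableSet V → volume V ≠ ∞ → (∀ x ∈ V, cellIdx s x ∈ J) → 1 ≤ volume.real V →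
      J.card * s ^ d ≤ 2 * volume.real V → ∀ t : ℝ,
      ‖∫ ω, exp ((t * ((∫ x in V, G (Z (gridPt s (cellIdx s x)) ω)) / √(volume.real V)) : ℝ) * I)
          ∂P - exp ((-(t ^ 2 * (∫ ω, ((∫ x in V, G (Z (gridPt s (cellIdx s x)) ω)) /
          √(volume.real V)) ^ 2 ∂P) / 2) : ℝ))‖ ≤
        |t| * (6 + |t| * 6 + 3 * t ^ 2) * c ^ 6 / volume.real V ^ (1 / 8 : ℝ) := by
  obtain ⟨A, hA0, hA⟩ := h.exists_isBlockMixing hs (32 * d)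
  have hK0 : 0 ≤ K := (abs_nonneg _).trans (hGK 0)
  set τ := min 1 s with hτ
  have hτ0 : 0 < τ := lt_min one_pos hs
  have c1 : 0 ≤ 2 / s ^ d := by positivity
  have c2 : 0 ≤ s ^ d * K := by positivity
  have c3 : (0 : ℝ) ≤ 7 ^ d := by positivity
  have c4 : 0 ≤ A / τ ^ (32 * d) := by positivity
  refine ⟨1 + 2 / s ^ d + s ^ d * K + 7 ^ d + A / τ ^ (32 * d), ?_⟩
  set c := 1 + 2 / s ^ d + s ^ d * K + 7 ^ d + A / τ ^ (32 * d) with hc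
  intro V J hVm hVf hJ hV1 hJc t
  set ℓ := volume.real V with hℓ
  set ρ := ℓ ^ (1 / 8 : ℝ) with hρ
  have hℓ0 : 0 ≤ ℓ := by linarith
  have hρ1 : 1 ≤ ρ := Real.one_le_rpow hV1 (by norm_num)
  have hρ8 : ρ ^ 8 = ℓ := by
    rw [hρ, ← Real.rpow_natCast, ← Real.rpow_mul hℓ0]
    norm_num
  have hsq : √ℓ = ρ ^ 4 := by
    rw [← hρ8, show ρ ^ 8 = (ρ ^ 4) ^ 2 by ring, Real.sqrt_sq (by positivity)]
  set a := ρ ^ (1 / d : ℝ) with ha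
  have had : a ^ d = ρ := by
    rw [ha, one_div, Real.rpow_inv_natCast_pow (by linarith) hd.ne']
  have ha1 : 1 ≤ a := Real.one_le_rpow hρ1 (by positivity)
  set R := ⌊a⌋₊ with hR
  have hR0 : 0 < R := Nat.floor_pos.2 ha1
  have hRa : (R : ℝ) ≤ a := Nat.floor_le (by linarith)
  have haR : a ≤ 1 + R := by linarith [Nat.lt_floor_add_one a]
  set w : (Fin d → ℤ) → ℝ := fun k => volume.real (cellIdx s ⁻¹' {k} ∩ V) / √ℓ with hw
  have hw0 : ∀ k, 0 ≤ w k := fun k => by positivity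
  have hwle : ∀ k, w k ≤ s ^ d / ρ ^ 4 := fun k => by
    rw [hw, ← hsq]
    dsimp only
    gcongr
    calc volume.real (cellIdx s ⁻¹' {k} ∩ V) ≤ volume.real (cellIdx s ⁻¹' {k}) :=
          measureReal_mono Set.inter_subset_left
            (by rw [volume_cell hs]; exact ENNReal.ofReal_ne_top)
      _ = s ^ d := by
          rw [Measure.real, volume_cell hs, ENNReal.toReal_ofReal (by positivity)]
  have hsum : ∀ ω, (∫ x in V, G (Z (gridPt s (cellIdx s x)) ω)) / √ℓ =
      ∑ k ∈ J, w k * G (Z (gridPt s k) ω) := fun ω => by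
    rw [setIntegral_comp_cellIdx hVm hVf hJ fun k => G (Z (gridPt s k) ω), Finset.sum_div]
    exact Finset.sum_congr rfl fun k _ => by rw [hw]; ring
  simp only [hsum]
  refine ((hA (fun k u => w k * G u) (fun k => hG.const_mul _) R).norm_charFun_sub_exp_le
    (L := s ^ d * K / ρ ^ 4) (m := c * ρ) (m₃ := c * ρ) (J := J)
    (fun k => (hG.comp (h.measurable _)).const_mul _) (fun k ω => ?_) (by positivity)
    (fun k => ?_) hR0 ?_ ?_ t).trans (normal_error_le (by linarith) hρ1 (by positivity) ?_
      (by positivity) ?_ (by positivity) ?_)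
  · rw [abs_mul, abs_of_nonneg (hw0 k), mul_div_right_comm]
    exact mul_le_mul (hwle k) (hGK _) (abs_nonneg _) (by positivity)
  · rw [integral_const_mul, h.integral_eq _ hG, hG0, mul_zero]
  · calc ((2 * R + 1 : ℕ) : ℝ) ^ d ≤ (7 * a) ^ d := by
          gcongr
          push_cast
          linarith
      _ = 7 ^ d * ρ := by rw [mul_pow, had]
      _ ≤ c * ρ := by gcongr; linarith
  · calc ((2 * (3 * R) + 1 : ℕ) : ℝ) ^ d ≤ (7 * a) ^ d := by
          gcongr
          push_cast
          linarith
      _ = 7 ^ d * ρ := by rw [mul_pow, had]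
      _ ≤ c * ρ := by gcongr; linarith
  · calc (J.card : ℝ) ≤ 2 / s ^ d * ℓ := by
          rw [div_mul_eq_mul_div]
          exact (le_div_iff₀ (by positivity)).2 hJc
      _ ≤ c * ρ ^ 8 := by rw [hρ8]; gcongr; linarith
  · gcongr
    linarith
  · have e : τ ^ (32 * d) * ρ ^ 32 ≤ (1 + s * R) ^ (32 * d) := by
      calc τ ^ (32 * d) * ρ ^ 32 = (τ * a) ^ (32 * d) := by
            rw [mul_pow, mul_comm 32 d, pow_mul a, had]
        _ ≤ (1 + s * R) ^ (32 * d) := by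
            gcongr
            calc τ * a ≤ τ * (1 + R) := by gcongr
              _ = τ + τ * R := by ring
              _ ≤ 1 + s * R := by gcongr; exacts [min_le_left _ _, min_le_right _ _]
    calc A / (1 + s * R) ^ (32 * d) ≤ A / (τ ^ (32 * d) * ρ ^ 32) := by gcongr
      _ = A / τ ^ (32 * d) / ρ ^ 32 := by rw [div_div]
      _ ≤ c / ρ ^ 32 := by gcongr; linarith

open Complex in
lemma IsMixingField.tendsto_charFun_coarse (h : IsMixingField P Z) (hd : 0 < d)
    (hG : Measurable G) (hGK : ∀ u, |G u| ≤ K) (hG0 : ∫ ω, G (Z 0 ω) ∂P = 0) (hs : 0 < s)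
    {V : ℕ → Set (EuclideanSpace ℝ (Fin d))} (hV : IsVanHove V) (t : ℝ) :
    Tendsto (fun n =>
      ‖∫ ω, exp ((t * ((∫ x in V n, G (Z (gridPt s (cellIdx s x)) ω)) /
          √(volume.real (V n))) : ℝ) * I) ∂P -
        exp ((-(t ^ 2 * (∫ ω, ((∫ x in V n, G (Z (gridPt s (cellIdx s x)) ω)) /
          √(volume.real (V n))) ^ 2 ∂P) / 2) : ℝ))‖) atTop (𝓝 0) := by
  obtain ⟨c, hc⟩ := h.exists_norm_charFun_coarse_sub_le hd hG hGK hG0 hs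
  obtain ⟨hVb, hVm, -, -, hVinf, hVN⟩ := hV
  have hVf : ∀ n, volume (V n) ≠ ∞ := fun n => (hVb n).measure_lt_top.ne
  refine squeeze_zero' (.of_forall fun n => norm_nonneg _) ?_
    (Tendsto.div_atTop (tendsto_const_nhds (x := |t| * (6 + |t| * 6 + 3 * t ^ 2) * c ^ 6))
      ((tendsto_rpow_atTop (by norm_num : (0 : ℝ) < 1 / 8)).comp hVinf))
  have hr : 0 < 2 * (s * √d) + 1 := by positivity
  filter_upwards [hVinf.eventually_ge_atTop 1, (hVN _ hr).eventually_le_const one_pos]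
    with n hn1 hn2
  have hf := finite_image_cellIdx (hVb n) hs
  refine hc (V n) hf.toFinset (hVm n) (hVf n)
    (fun x hx => hf.mem_toFinset.2 (Set.mem_image_of_mem _ hx)) hn1 ?_ t
  have h0 : volume (V n) ≠ 0 := fun h0 => by
    rw [h0] at hn1
    norm_num at hn1
  refine (card_mul_le_volume hs (fun k hk => hf.mem_toFinset.1 hk) (hVf n) (le_add_of_nonneg_right
    zero_le_one) (volume_infDist_frontier_ne_top (hVb n) h0 _)).trans ?_
  rw [div_le_one (by linarith)] at hn2
  exact (add_le_add le_rfl hn2).trans_eq (two_mul _).symm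

end CoarseCLT

section Approximation

variable {Ω : Type*} [MeasurableSpace Ω] {P : Measure Ω}

lemma abs_exp_neg_sub_exp_neg_le {u v : ℝ} (hu : 0 ≤ u) (hv : 0 ≤ v) :
    |Real.exp (-u) - Real.exp (-v)| ≤ |u - v| := by
  have key : ∀ a b : ℝ, 0 ≤ a → a ≤ b → Real.exp (-a) - Real.exp (-b) ≤ b - a := by
    intro a b ha hab
    have e : Real.exp (-b) = Real.exp (-a) * Real.exp (a - b) := by
      rw [← Real.exp_add]
      ring_nf
    have h1 := Real.add_one_le_exp (a - b)
    have h2 : Real.exp (-a) ≤ 1 := Real.exp_le_one_iff.2 (by linarith)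
    have h3 := Real.exp_pos (-a)
    rw [e]
    nlinarith
  rcases le_total u v with h | h
  · rw [abs_of_nonneg (sub_nonneg.2 (Real.exp_le_exp.2 (by linarith))), abs_sub_comm,
      abs_of_nonneg (sub_nonneg.2 h)]
    exact key u v hu h
  · rw [abs_sub_comm, abs_of_nonneg (sub_nonneg.2 (Real.exp_le_exp.2 (by linarith))),
      abs_of_nonneg (sub_nonneg.2 h)]
    exact key v u hv h

open Complex in
lemma norm_exp_ofReal_mul_I_sub_le (x y : ℝ) : ‖exp (x * I) - exp (y * I)‖ ≤ |x - y| := by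
  have e : exp (x * I) - exp (y * I) = exp (y * I) * (exp (I * ((x - y : ℝ) : ℂ)) - 1) := by
    rw [mul_sub, mul_one, ← exp_add]
    push_cast
    ring_nf
  rw [e, norm_mul, norm_exp_ofReal_mul_I, one_mul]
  exact Real.norm_exp_I_mul_ofReal_sub_one_le

lemma integrable_exp_ofReal_mul_I [IsProbabilityMeasure P] {A : Ω → ℝ}
    (hA : AEStronglyMeasurable A P) :
    Integrable (fun ω => Complex.exp (A ω * Complex.I)) P :=
  Integrable.of_bound (C := 1)
    ((by fun_prop : Continuous fun x : ℝ => Complex.exp (x * Complex.I)).comp_aestronglyMeasurable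
      hA)
    (ae_of_all _ fun ω => (Complex.norm_exp_ofReal_mul_I _).le)

open Complex in
lemma norm_integral_exp_sub_le [IsProbabilityMeasure P] {A B : Ω → ℝ} (hA : MemLp A 2 P)
    (hB : MemLp B 2 P) {ε : ℝ} (hε : ∫ ω, (A ω - B ω) ^ 2 ∂P ≤ ε) (t : ℝ) :
    ‖∫ ω, exp ((t * A ω : ℝ) * I) ∂P - ∫ ω, exp ((t * B ω : ℝ) * I) ∂P‖ ≤ |t| * √ε := by
  have hAB : MemLp (fun ω => A ω - B ω) 2 P := hA.sub hB
  rw [← integral_sub (integrable_exp_ofReal_mul_I (hA.aestronglyMeasurable.const_mul t))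
    (integrable_exp_ofReal_mul_I (hB.aestronglyMeasurable.const_mul t))]
  calc _ ≤ ∫ ω, |t| * |A ω - B ω| ∂P := by
        refine norm_integral_le_of_norm_le (((hAB.integrable one_le_two).abs).const_mul _)
          (ae_of_all _ fun ω => (norm_exp_ofReal_mul_I_sub_le _ _).trans_eq ?_)
        rw [← mul_sub, abs_mul]
    _ = |t| * ∫ ω, |A ω - B ω| ∂P := integral_const_mul _ _
    _ ≤ |t| * √ε := by
        gcongr
        have := abs_integral_le_sqrt hAB.abs
        simp only [Pi.abs_apply, sq_abs] at this
        exact (le_abs_self _).trans (this.trans (Real.sqrt_le_sqrt hε))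

lemma abs_integral_sq_sub_le {A B : Ω → ℝ} (hA : MemLp A 2 P) (hB : MemLp B 2 P) {ε : ℝ}
    (hε : ∫ ω, (A ω - B ω) ^ 2 ∂P ≤ ε) :
    |∫ ω, B ω ^ 2 ∂P - ∫ ω, A ω ^ 2 ∂P| ≤ √ε * (2 * √(∫ ω, A ω ^ 2 ∂P) + √ε) := by
  set a := ∫ ω, A ω ^ 2 ∂P
  set b := ∫ ω, B ω ^ 2 ∂P
  have ha : 0 ≤ a := integral_nonneg fun _ => sq_nonneg _
  have hb : 0 ≤ b := integral_nonneg fun _ => sq_nonneg _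
  have hs : √(∫ ω, (A ω - B ω) ^ 2 ∂P) ≤ √ε := Real.sqrt_le_sqrt hε
  have h1 := sqrt_integral_add_sq_le (hA.sub hB) hB
  have h2 := sqrt_integral_add_sq_le (hB.sub hA) hA
  simp only [Pi.sub_apply, sub_add_cancel] at h1 h2
  simp only [sub_sq_comm (B _) (A _)] at h2
  have h3 : |√b - √a| ≤ √ε := abs_le.2 ⟨by linarith, by linarith⟩
  have e : b - a = (√b - √a) * (√b + √a) := by
    rw [mul_comm, ← sq_sub_sq, Real.sq_sqrt ha, Real.sq_sqrt hb]
  rw [e, abs_mul, abs_of_nonneg (by positivity : 0 ≤ √b + √a)]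
  exact mul_le_mul h3 (by linarith [(abs_le.1 h3).2]) (by positivity) (Real.sqrt_nonneg _)

open Complex in
lemma norm_charFun_sub_exp_le_of_approx [IsProbabilityMeasure P] {A B : Ω → ℝ} (hA : MemLp A 2 P)
    (hB : MemLp B 2 P) {ε v : ℝ} (hε : ∫ ω, (A ω - B ω) ^ 2 ∂P ≤ ε) (hv : 0 ≤ v) (t : ℝ) :
    ‖∫ ω, exp ((t * A ω : ℝ) * I) ∂P - exp ((-(t ^ 2 * v / 2) : ℝ))‖ ≤
      |t| * √ε + ‖∫ ω, exp ((t * B ω : ℝ) * I) ∂P -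
        exp ((-(t ^ 2 * (∫ ω, B ω ^ 2 ∂P) / 2) : ℝ))‖ +
      t ^ 2 / 2 * (√ε * (2 * √(∫ ω, A ω ^ 2 ∂P) + √ε) + |∫ ω, A ω ^ 2 ∂P - v|) := by
  set b := ∫ ω, B ω ^ 2 ∂P with hb
  have hb0 : 0 ≤ b := integral_nonneg fun _ => sq_nonneg _
  have h1 := norm_integral_exp_sub_le hA hB hε t
  have h2 := abs_integral_sq_sub_le hA hB hε
  have h3 : ‖exp ((-(t ^ 2 * b / 2) : ℝ)) - exp ((-(t ^ 2 * v / 2) : ℝ))‖ ≤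
      t ^ 2 / 2 * (√ε * (2 * √(∫ ω, A ω ^ 2 ∂P) + √ε) + |∫ ω, A ω ^ 2 ∂P - v|) := by
    rw [← ofReal_exp, ← ofReal_exp, ← ofReal_sub, norm_real, Real.norm_eq_abs]
    refine (abs_exp_neg_sub_exp_neg_le (by positivity) (by positivity)).trans ?_
    rw [show t ^ 2 * b / 2 - t ^ 2 * v / 2 = t ^ 2 / 2 * (b - v) by ring, abs_mul,
      abs_of_nonneg (by positivity : 0 ≤ t ^ 2 / 2)]
    gcongr
    exact (abs_sub_le _ _ _).trans (add_le_add h2 le_rfl)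
  refine (norm_sub_le_norm_sub_add_norm_sub _ (exp ((-(t ^ 2 * b / 2) : ℝ))) _).trans
    (add_le_add ((norm_sub_le_norm_sub_add_norm_sub _
      (∫ ω, exp ((t * B ω : ℝ) * I) ∂P) _).trans ?_) h3)
  exact add_le_add h1 le_rfl

end Approximation

section CLT

variable {d : ℕ} {Ω : Type*} [MeasurableSpace Ω] {P : Measure Ω} [IsProbabilityMeasure P]
  {Z : EuclideanSpace ℝ (Fin d) → Ω → ℝ} {F : ℝ → ℝ} {δ : ℝ}

lemma IsMixingField.ae_integrableOn (h : IsMixingField P Z) (hF : Measurable F)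
    (hFi : Integrable (fun ω => F (Z 0 ω)) P) {V : Set (EuclideanSpace ℝ (Fin d))}
    (hV : volume V ≠ ∞) : ∀ᵐ ω ∂P, IntegrableOn (fun x => F (Z x ω)) V := by
  have : IsFiniteMeasure (volume.restrict V) := ⟨by simpa using hV.lt_top⟩
  have hm : AEStronglyMeasurable (fun p : EuclideanSpace ℝ (Fin d) × Ω => F (Z p.1 p.2))
      ((volume.restrict V).prod P) := (hF.comp h.jointly_measurable).aestronglyMeasurable
  refine Integrable.prod_left_ae ((integrable_prod_iff hm).2
    ⟨ae_of_all _ fun x => (h.integrable_iff x hF).2 hFi, ?_⟩)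
  simp_rw [fun x => h.integral_eq x (f := fun u => ‖F u‖) hF.norm]
  exact integrable_const _

open Complex in
lemma IsMixingField.tendsto_charFun (h : IsMixingField P Z) (hd : 0 < d) (hδ : 0 < δ)
    (hF : Measurable F) (hFi : Integrable (fun ω => |F (Z 0 ω)| ^ (2 + δ)) P)
    (hF0 : ∫ ω, F (Z 0 ω) ∂P = 0) {V : ℕ → Set (EuclideanSpace ℝ (Fin d))} (hV : IsVanHove V)
    (hv : 0 ≤ ∫ u, ∫ ω, F (Z 0 ω) * F (Z u ω) ∂P) (t : ℝ) :
    Tendsto (fun n => ∫ ω, exp ((t * ((∫ x in V n, F (Z x ω)) / √(volume.real (V n))) : ℝ) * I) ∂P)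
      atTop (𝓝 (exp ((-(t ^ 2 * (∫ u, ∫ ω, F (Z 0 ω) * F (Z u ω) ∂P) / 2) : ℝ)))) := by
  set v := ∫ u, ∫ ω, F (Z 0 ω) * F (Z u ω) ∂P with hvdef
  have hvar := h.tendsto_variance hδ hF hFi hF0 hV
  have hF2 : ∀ x, MemLp (fun ω => F (Z x ω)) 2 P := fun x => (h.memLp_iff x hF 2).2
    (memLp_two_of_moment hδ (hF.comp (h.measurable 0)).aestronglyMeasurable hFi)
  have hVf : ∀ n, volume (V n) ≠ ∞ := fun n => (hV.1 n).measure_lt_top.ne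
  have hU : Measurable fun p : EuclideanSpace ℝ (Fin d) × Ω => F (Z p.1 p.2) :=
    hF.comp h.jointly_measurable
  have hB : ∀ x, ∫ ω, F (Z x ω) ^ 2 ∂P ≤ ∫ ω, F (Z 0 ω) ^ 2 ∂P := fun x =>
    (h.integral_eq x (f := fun u => F u ^ 2) (by fun_prop)).le
  set A : ℕ → Ω → ℝ := fun n ω => (∫ x in V n, F (Z x ω)) / √(volume.real (V n)) with hA
  have hA2 : ∀ n, MemLp (A n) 2 P := fun n => by
    have : IsFiniteMeasure (volume.restrict (V n)) := ⟨by simpa using (hVf n).lt_top⟩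
    simp only [hA, div_eq_mul_inv]
    exact (memLp_integral (μ := volume.restrict (V n)) hU hF2 hB).mul_const _
  have hAv : Tendsto (fun n => ∫ ω, A n ω ^ 2 ∂P) atTop (𝓝 v) := by
    refine hvar.congr fun n => ?_
    simp only [hA, div_pow, Real.sq_sqrt measureReal_nonneg]
    rw [integral_div]
  rw [Metric.tendsto_nhds]
  intro η hη
  have hlim : Tendsto (fun ε => |t| * √ε + t ^ 2 / 2 * (√ε * (2 * √v + √ε))) (𝓝[>] 0) (𝓝 0) := by
    have hc : Continuous fun ε => |t| * √ε + t ^ 2 / 2 * (√ε * (2 * √v + √ε)) := by fun_prop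
    simpa using (hc.tendsto 0).mono_left nhdsWithin_le_nhds
  obtain ⟨ε, hεη, hε⟩ := ((hlim.eventually_lt_const hη).and self_mem_nhdsWithin).exists
  obtain ⟨G, K, s, hG, hK, hGK, hG0, hs, happ⟩ := h.exists_coarse_approx hδ hF hFi hF0 hε
  have hcore := h.tendsto_charFun_coarse hd hG hGK hG0 hs hV t
  have htot : Tendsto (fun n => |t| * √ε +
      ‖∫ ω, exp ((t * ((∫ x in V n, G (Z (gridPt s (cellIdx s x)) ω)) /
          √(volume.real (V n))) : ℝ) * I) ∂P -
        exp ((-(t ^ 2 * (∫ ω, ((∫ x in V n, G (Z (gridPt s (cellIdx s x)) ω)) /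
          √(volume.real (V n))) ^ 2 ∂P) / 2) : ℝ))‖ +
      t ^ 2 / 2 * (√ε * (2 * √(∫ ω, A n ω ^ 2 ∂P) + √ε) + |∫ ω, A n ω ^ 2 ∂P - v|)) atTop
      (𝓝 (|t| * √ε + 0 + t ^ 2 / 2 * (√ε * (2 * √v + √ε) + |v - v|))) :=
    (tendsto_const_nhds.add hcore).add ((((((hAv.sqrt).const_mul 2).add_const _).const_mul _).add
      (hAv.sub_const v).abs).const_mul _)
  simp only [sub_self, abs_zero, add_zero] at htot
  have hpos : ∀ᶠ n in atTop, 0 < volume.real (V n) := hV.2.2.2.2.1.eventually_gt_atTop 0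
  filter_upwards [htot.eventually_lt_const hεη, hpos] with n hn hn0
  rw [dist_eq_norm]
  refine lt_of_le_of_lt ?_ hn
  have hπm : Measurable fun x : EuclideanSpace ℝ (Fin d) => gridPt s (cellIdx s x) :=
    (measurable_gridPt s).comp (measurable_cellIdx s)
  have hfin : IsFiniteMeasure (volume.restrict (V n)) := ⟨by simpa using (hVf n).lt_top⟩
  set B : Ω → ℝ := fun ω => (∫ x in V n, G (Z (gridPt s (cellIdx s x)) ω)) / √(volume.real (V n))
    with hBdef
  have hAB : (fun ω => A n ω - B ω) =ᵐ[P] fun ω =>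
      (∫ x in V n, (F (Z x ω) - G (Z (gridPt s (cellIdx s x)) ω))) * (√(volume.real (V n)))⁻¹ := by
    filter_upwards [h.ae_integrableOn hF ((hF2 0).integrable one_le_two) (hVf n)] with ω hω
    have hGi : Integrable (fun x => G (Z (gridPt s (cellIdx s x)) ω)) (volume.restrict (V n)) :=
      Integrable.of_bound (C := K) (hG.comp (h.jointly_measurable.comp
        (hπm.prodMk measurable_const))).aestronglyMeasurable (ae_of_all _ fun x => hGK _)
    rw [integral_sub hω hGi, ← div_eq_mul_inv, sub_div]
  have hAB2 : MemLp (fun ω => A n ω - B ω) 2 P :=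
    (memLp_congr_ae hAB).2 ((happ (V n) (hVf n)).1.mul_const _)
  have hB2 : MemLp B 2 P := by
    have := (hA2 n).sub hAB2
    simpa only [Pi.sub_def, sub_sub_cancel] using this
  refine norm_charFun_sub_exp_le_of_approx (hA2 n) hB2 ?_ hv t
  calc ∫ ω, (A n ω - B ω) ^ 2 ∂P = (∫ ω, (∫ x in V n, (F (Z x ω) -
        G (Z (gridPt s (cellIdx s x)) ω))) ^ 2 ∂P) * (volume.real (V n))⁻¹ := by
        rw [← integral_mul_const]
        refine integral_congr_ae (hAB.mono fun ω hω => ?_)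
        simp only at hω ⊢
        rw [hω, mul_pow, inv_pow, Real.sq_sqrt hn0.le]
    _ ≤ ε * volume.real (V n) * (volume.real (V n))⁻¹ := by
        gcongr
        exact (happ (V n) (hVf n)).2
    _ = ε := mul_inv_cancel_right₀ hn0.ne' ε

/-- **Central limit theorem** for a function of a stationary, polynomially mixing field. -/
theorem IsMixingField.tendstoInDistribution (h : IsMixingField P Z) (hd : 0 < d) (hδ : 0 < δ)
    (hF : Measurable F) (hFi : Integrable (fun ω => |F (Z 0 ω)| ^ (2 + δ)) P)
    (hF0 : ∫ ω, F (Z 0 ω) ∂P = 0) {V : ℕ → Set (EuclideanSpace ℝ (Fin d))} (hV : IsVanHove V)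
    (hv : 0 ≤ ∫ u, ∫ ω, F (Z 0 ω) * F (Z u ω) ∂P) :
    _root_.TendstoInDistribution P
      (fun n ω => (∫ x in V n, F (Z x ω)) / √(volume (V n)).toReal)
      (gaussianReal 0 (∫ u, ∫ ω, F (Z 0 ω) * F (Z u ω) ∂P).toNNReal) := by
  set v := ∫ u, ∫ ω, F (Z 0 ω) * F (Z u ω) ∂P with hvdef
  have hm : ∀ n, Measurable fun ω => (∫ x in V n, F (Z x ω)) / √(volume (V n)).toReal := fun n => by
    have hU : Measurable fun p : EuclideanSpace ℝ (Fin d) × Ω => F (Z p.1 p.2) :=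
      hF.comp h.jointly_measurable
    exact ((hU.stronglyMeasurable.integral_prod_left' (μ := volume.restrict (V n))).measurable
      ).div_const _
  let μ : ℕ → ProbabilityMeasure ℝ := fun n =>
    ⟨P.map fun ω => (∫ x in V n, F (Z x ω)) / √(volume (V n)).toReal,
      Measure.isProbabilityMeasure_map (hm n).aemeasurable⟩
  have hμ : Tendsto μ atTop (𝓝 ⟨gaussianReal 0 v.toNNReal, inferInstance⟩) := by
    refine ProbabilityMeasure.tendsto_iff_tendsto_charFun.2 fun t => ?_
    simp only [μ, ProbabilityMeasure.coe_mk, charFun_gaussianReal]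
    convert h.tendsto_charFun hd hδ hF hFi hF0 hV hv t using 2
    · rw [charFun_apply_real, integral_map (hm _).aemeasurable (by fun_prop)]
      refine integral_congr_ae (ae_of_all _ fun ω => ?_)
      simp [Measure.real]
    · rw [← hvdef, Real.coe_toNNReal _ hv]
      push_cast
      ring_nf
  intro f
  have := (ProbabilityMeasure.tendsto_iff_forall_integral_tendsto.1 hμ) f
  simp only [μ, ProbabilityMeasure.coe_mk] at this
  simpa only [integral_map (hm _).aemeasurable f.continuous.aestronglyMeasurable] using this

end CLT

lemma integrable_abs_sub_const_rpow {Ω : Type*} [MeasurableSpace Ω] {P : Measure Ω}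
    [IsProbabilityMeasure P] {F : ℝ → ℝ} (hF : Measurable F) {X : Ω → ℝ} (hX : Measurable X)
    {p : ℝ} (hp : 0 ≤ p) (hi : Integrable (fun ω => |F (X ω)| ^ p) P) (a : ℝ) :
    Integrable (fun ω => |F (X ω) - a| ^ p) P := by
  have hm : Measurable fun ω => |F (X ω) - a| ^ p := by fun_prop
  refine (((hi.add (integrable_const (|a| ^ p))).add (integrable_const (0 ^ p))).const_mul
    (3 ^ p)).mono' hm.aestronglyMeasurable (ae_of_all _ fun ω => ?_)
  rw [Real.norm_eq_abs, abs_of_nonneg (by positivity)]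
  refine le_trans ?_ (add_three_rpow_le (abs_nonneg _) (abs_nonneg a) le_rfl hp)
  exact Real.rpow_le_rpow (abs_nonneg _) ((abs_sub _ _).trans (by simp)) hp

/-- **CLT for functions of the Smith random field.**
Let `Σ` be a symmetric positive-definite `d×d` matrix and `Z` a strictly stationary,
sample-continuous, jointly measurable version of the Smith random field with covariance
matrix `Σ`, i.e. of the Brown–Resnick field with variogram `γ(x) = xᵀΣ⁻¹x`. For any Borel
measurable `F` with a `(2+δ)`-moment and `σ² = ∫ Cov(F(Z(0)), F(Z(x))) dx > 0`, the field
`X = F(Z(·))` satisfies the CLT. -/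
theorem clt_smith
    {d : ℕ} (hd : 0 < d) {Ω : Type*} [MeasurableSpace Ω]
    (P : Measure Ω) [IsProbabilityMeasure P]
    (Sig : Matrix (Fin d) (Fin d) ℝ) (hSig : Sig.PosDef)
    (W : EuclideanSpace ℝ (Fin d) → Ω → ℝ)
    (hWmeas : ∀ x, Measurable (W x))
    -- centred Gaussian random field: every finite linear combination is centred Gaussian
    (hgauss : ∀ (n : ℕ) (x : Fin n → EuclideanSpace ℝ (Fin d)) (c : Fin n → ℝ),
      ∃ v : ℝ≥0, Measure.map (fun ω => ∑ i, c i * W (x i) ω) P = gaussianReal 0 v)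
    -- stationary increments
    (hinc : ∀ (x₀ : EuclideanSpace ℝ (Fin d)) (n : ℕ)
      (x : Fin n → EuclideanSpace ℝ (Fin d)),
      Measure.map (fun ω i => W (x i + x₀) ω - W x₀ ω) P
        = Measure.map (fun ω i => W (x i) ω - W 0 ω) P)
    -- W(0) = 0 almost surely
    (hW0 : ∀ᵐ ω ∂P, W 0 ω = 0)
    -- variogram of the Smith field: Var(W(x)) = xᵀΣ⁻¹x
    (hvar : ∀ x : EuclideanSpace ℝ (Fin d), ∫ ω, (W x ω) ^ 2 ∂P = quadInv Sig x)
    -- the spectral field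
    (Y : EuclideanSpace ℝ (Fin d) → Ω → ℝ)
    (hY : ∀ x ω, Y x ω = Real.exp (W x ω - quadInv Sig x / 2))
    (Z : EuclideanSpace ℝ (Fin d) → Ω → ℝ)
    -- joint measurability
    (hjm : Measurable fun p : EuclideanSpace ℝ (Fin d) × Ω => Z p.1 p.2)
    -- sample continuity
    (hcont : ∀ᵐ ω ∂P, Continuous fun x => Z x ω)
    -- strict stationarity
    (hstat : ∀ (x₀ : EuclideanSpace ℝ (Fin d)) (n : ℕ)
      (x : Fin n → EuclideanSpace ℝ (Fin d)),
      Measure.map (fun ω i => Z (x i + x₀) ω) P = Measure.map (fun ω i => Z (x i) ω) P)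
    -- the finite-dimensional distributions are those of the Smith field
    (hfdd : ∀ (n : ℕ) (x : Fin n → EuclideanSpace ℝ (Fin d)) (z : Fin n → ℝ),
      (∀ i, 0 < z i) →
      P {ω | ∀ i, Z (x i) ω ≤ z i}
        = ENNReal.ofReal (Real.exp (-(∫ ω, ⨆ i, Y (x i) ω / z i ∂P))))
    (δ : ℝ) (hδ : 0 < δ)
    (F : ℝ → ℝ) (hF : Measurable F)
    -- moment condition
    (hmom : Integrable (fun ω => |F (Z 0 ω)| ^ ((2 : ℝ) + δ)) P)
    -- positive asymptotic variance
    (σ2 : ℝ)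
    (hσ2def : σ2 = ∫ x, cov P (fun ω => F (Z 0 ω)) (fun ω => F (Z x ω)) ∂volume)
    (hσ2pos : 0 < σ2) :
    Integrable
      (fun x => |cov P (fun ω => F (Z 0 ω)) (fun ω => F (Z x ω))|) volume ∧
    ∀ V : ℕ → Set (EuclideanSpace ℝ (Fin d)), IsVanHove V →
      TendstoInDistribution P
        (fun n ω =>
          (∫ x in V n, (F (Z x ω) - ∫ ω', F (Z x ω') ∂P) ∂volume)
            / Real.sqrt (volume (V n)).toReal)
        (gaussianReal 0 (Real.toNNReal σ2)) := by
  have hZ : ∀ x, Measurable (Z x) := fun x => hjm.comp measurable_prodMk_left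
  obtain ⟨hY1, hYmin⟩ := smith_spectral hWmeas hgauss hinc hW0 hvar hY
  have hms : IsMaxStableWith P Y Z :=
    { measurable_spectral := fun x => by
        rw [funext (hY x)]
        exact ((hWmeas x).sub_const _).exp
      pos_spectral := fun x ω => hY x ω ▸ Real.exp_pos _
      integrable_spectral := fun x => (hY1 x).1
      integral_spectral := fun x => (hY1 x).2
      measurable_field := hZ
      fdd := hfdd }
  obtain ⟨c, hc, hcq⟩ := exists_le_quadInv hd hSig
  have h : IsMixingField P Z :=
    { jointly_measurable := hjm
      sample_continuous := hcont
      stationary := hstat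
      mixing := hms.hasPolyMixing (c := c / 8) (by positivity) fun x y => by
        refine (hYmin x y).trans (Real.exp_le_exp.2 (neg_le_neg ?_))
        have := hcq (x - y)
        rw [dist_eq_norm]
        linarith }
  have hFx : ∀ x, Integrable (fun ω => F (Z x ω)) P := fun x => (h.integrable_iff x hF).2
    ((memLp_two_of_moment hδ (hF.comp (hZ 0)).aestronglyMeasurable hmom).integrable one_le_two)
  have hF2 : ∀ x, MemLp (fun ω => F (Z x ω)) 2 P := fun x => (h.memLp_iff x hF 2).2
    (memLp_two_of_moment hδ (hF.comp (hZ 0)).aestronglyMeasurable hmom)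
  set a := ∫ ω, F (Z 0 ω) ∂P with ha
  have hmean : ∀ x, ∫ ω, F (Z x ω) ∂P = a := fun x => h.integral_eq x hF
  have hFa : Measurable fun u => F u - a := hF.sub_const a
  have hFa0 : ∫ ω, (F (Z 0 ω) - a) ∂P = 0 := by
    rw [integral_sub (hFx 0) (integrable_const a)]
    simp [ha]
  have hFai : Integrable (fun ω => |F (Z 0 ω) - a| ^ (2 + δ)) P :=
    integrable_abs_sub_const_rpow hF (hZ 0) (by positivity) hmom a
  have hcov : ∀ x, cov P (fun ω => F (Z 0 ω)) (fun ω => F (Z x ω)) =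
      ∫ ω, (F (Z 0 ω) - a) * (F (Z x ω) - a) ∂P := fun x => by
    have i1 : Integrable (fun ω => F (Z 0 ω) * F (Z x ω)) P := (hF2 0).integrable_mul (hF2 x)
    have i2 : Integrable (fun ω => a * F (Z 0 ω)) P := (hFx 0).const_mul a
    have i3 : Integrable (fun ω => a * F (Z x ω)) P := (hFx x).const_mul a
    have i4 : Integrable (fun ω => F (Z 0 ω) * F (Z x ω) - a * F (Z 0 ω)) P := i1.sub i2
    have i5 : Integrable (fun ω => F (Z 0 ω) * F (Z x ω) - a * F (Z 0 ω) - a * F (Z x ω)) P :=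
      i4.sub i3
    calc _ = ∫ ω, (F (Z 0 ω) * F (Z x ω) - a * F (Z 0 ω) - a * F (Z x ω) + a * a) ∂P := by
          rw [integral_add i5 (integrable_const _), integral_sub i4 i3, integral_sub i1 i2,
            integral_const_mul, integral_const_mul, cov]
          simp [hmean]
      _ = _ := integral_congr_ae (ae_of_all _ fun ω => by ring)
  simp only [hcov] at hσ2def ⊢
  refine ⟨(h.integrable_integral_mul hδ hFa hFai hFa0).abs, fun V hV => ?_⟩
  simp only [hmean]
  rw [hσ2def]
  exact h.tendstoInDistribution hd hδ hFa hFai hFa0 hV (hσ2def ▸ hσ2pos.le)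

end
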